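/- Let g be a homeomorphism of ℝ² and p ≥ 1 an integer such that g^p is the translation z ↦ z + v by some nonzero vector v ∈ ℝ². Then there exists a homeomorphism h of ℝ² such that h ∘ g ∘ h⁻¹ is either the translation (x,y) ↦ (x+1, y) or the map (x,y) ↦ (x+1, −y). -/

import Mathlib

open Set Metric Filter Topology Complex

def HasLog {X : Type*} [TopologicalSpace X] (K : Set X) (F : X → ℂ) : Prop :=
  ∃ φ : X → ℂ, ContinuousOn φ K ∧ ∀ z ∈ K, exp (φ z) = F z

section logs
variable {X Y : Type*} [TopologicalSpace X] [TopologicalSpace Y]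

theorem HasLog.mono {K L : Set X} {F : X → ℂ} (h : HasLog L F) (hs : K ⊆ L) : HasLog K F := by
  obtain ⟨φ, h1, h2⟩ := h
  exact ⟨φ, h1.mono hs, fun z hz => h2 z (hs hz)⟩

theorem HasLog.congr {K : Set X} {F G : X → ℂ} (h : HasLog K F) (hs : ∀ z ∈ K, G z = F z) :
    HasLog K G := by
  obtain ⟨φ, h1, h2⟩ := h
  exact ⟨φ, h1, fun z hz => (h2 z hz).trans (hs z hz).symm⟩

theorem HasLog.mul {K : Set X} {F G : X → ℂ} (h : HasLog K F) (h' : HasLog K G) :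
    HasLog K (fun z => F z * G z) := by
  obtain ⟨φ, h1, h2⟩ := h
  obtain ⟨ψ, h3, h4⟩ := h'
  exact ⟨fun z => φ z + ψ z, h1.add h3, fun z hz => by rw [exp_add, h2 z hz, h4 z hz]⟩

theorem HasLog.inv {K : Set X} {F : X → ℂ} (h : HasLog K F) :
    HasLog K (fun z => (F z)⁻¹) := by
  obtain ⟨φ, h1, h2⟩ := h
  exact ⟨fun z => - φ z, h1.neg, fun z hz => by rw [exp_neg, h2 z hz]⟩

theorem HasLog.comp {K : Set X} {L : Set Y} {F : Y → ℂ} (h : HasLog L F) {γ : X → Y}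
    (hγ : ContinuousOn γ K) (hm : MapsTo γ K L) : HasLog K (fun x => F (γ x)) := by
  obtain ⟨φ, h1, h2⟩ := h
  exact ⟨fun z => φ (γ z), h1.comp hγ hm, fun z hz => h2 _ (hm hz)⟩

theorem contOn_invFunOn [Nonempty X] [T2Space Y] {K : Set X} (hK : IsCompact K) {γ : X → Y}
    (hγ : ContinuousOn γ K) (hi : InjOn γ K) :
    ContinuousOn (Function.invFunOn γ K) (γ '' K) := by
  rw [continuousOn_iff_isClosed]
  intro t ht
  refine ⟨γ '' (K ∩ t), ((hK.inter_right ht).image_of_continuousOn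
    (hγ.mono inter_subset_left)).isClosed, ?_⟩
  ext y
  constructor
  · rintro ⟨h, x, hx, rfl⟩
    rw [mem_preimage, hi.leftInvOn_invFunOn hx] at h
    exact ⟨⟨x, ⟨hx, h⟩, rfl⟩, x, hx, rfl⟩
  · rintro ⟨⟨x, ⟨hx, hxt⟩, rfl⟩, -⟩
    refine ⟨?_, x, hx, rfl⟩
    rw [mem_preimage, hi.leftInvOn_invFunOn hx]
    exact hxt

theorem HasLog.image [Nonempty X] [T2Space Y] {K : Set X} (hK : IsCompact K) {γ : X → Y}
    (hγ : ContinuousOn γ K) (hi : InjOn γ K) {F : Y → ℂ} (h : HasLog K (fun x => F (γ x))) :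
    HasLog (γ '' K) F := by
  have h1 := h.comp (contOn_invFunOn hK hγ hi)
    (by rintro _ ⟨x, hx, rfl⟩; rw [hi.leftInvOn_invFunOn hx]; exact hx)
  refine h1.congr ?_
  rintro _ ⟨x, hx, rfl⟩
  simp only [hi.leftInvOn_invFunOn hx]

theorem log_unique {K : Set X} (hK : IsPreconnected K) {φ ψ : X → ℂ} (h1 : ContinuousOn φ K)
    (h2 : ContinuousOn ψ K) (h : ∀ z ∈ K, exp (φ z) = exp (ψ z)) {a : X} (ha : a ∈ K)
    (haa : φ a = ψ a) : EqOn φ ψ K :=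
  isCoveringMap_exp.eqOn_of_comp_eqOn hK h1 h2
    (fun z hz => Subtype.ext (h z hz)) ha haa

theorem log_unique' {K : Set X} (hK : IsPreconnected K) {φ ψ : X → ℂ} (h1 : ContinuousOn φ K)
    (h2 : ContinuousOn ψ K) (h : ∀ z ∈ K, exp (φ z) = exp (ψ z)) :
    ∃ c : ℂ, exp c = 1 ∧ ∀ z ∈ K, φ z = ψ z + c := by
  rcases K.eq_empty_or_nonempty with rfl | ⟨a, ha⟩
  · exact ⟨0, by simp⟩
  · have hc : exp (φ a - ψ a) = 1 := by rw [exp_sub, h a ha, div_self (exp_ne_zero _)]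
    refine ⟨φ a - ψ a, hc, ?_⟩
    exact log_unique hK h1 (h2.add continuousOn_const)
      (fun z hz => by rw [exp_add, hc, mul_one, h z hz]) ha (by ring)

theorem HasLog.glue {K L : Set X} {F : X → ℂ} (hK : IsClosed K) (hL : IsClosed L)
    (hc : IsPreconnected (K ∩ L)) (h : HasLog K F) (h' : HasLog L F) : HasLog (K ∪ L) F := by
  classical
  obtain ⟨φ, h1, h2⟩ := h
  obtain ⟨ψ, h3, h4⟩ := h'
  obtain ⟨c, hc1, hc2⟩ := log_unique' hc (h1.mono inter_subset_left) (h3.mono inter_subset_right)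
    (fun z hz => by rw [h2 z hz.1, h4 z hz.2])
  have e1 : EqOn (K.piecewise φ (fun z => ψ z + c)) φ K := fun z hz => by simp [hz]
  have e2 : EqOn (K.piecewise φ (fun z => ψ z + c)) (fun z => ψ z + c) L := fun z hz => by
    by_cases hzK : z ∈ K
    · simp only [Set.piecewise_eq_of_mem _ _ _ hzK]; exact hc2 z ⟨hzK, hz⟩
    · simp [hzK]
  refine ⟨K.piecewise φ (fun z => ψ z + c), ?_, ?_⟩
  · exact (h1.congr e1).union_of_isClosed ((h3.add continuousOn_const).congr e2) hK hL
  · rintro z (hz | hz)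
    · rw [e1 hz, h2 z hz]
    · rw [e2 hz, exp_add, hc1, mul_one, h4 z hz]

theorem HasLog.homotopy {K : Set X} {H : ℝ → X → ℂ}
    (hH : ContinuousOn (Function.uncurry H) (Icc 0 1 ×ˢ K))
    (h0 : ∀ t ∈ Icc (0:ℝ) 1, ∀ z ∈ K, H t z ≠ 0) (hl : HasLog K (H 0)) : HasLog K (H 1) := by
  classical
  obtain ⟨φ, h1, h2⟩ := hl
  let HH : C(unitInterval × K, {z : ℂ // z ≠ 0}) :=
    ⟨fun p => ⟨H p.1 p.2, h0 _ p.1.2 _ p.2.2⟩, by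
      apply Continuous.subtype_mk
      exact hH.comp_continuous (f := fun p : unitInterval × K => ((p.1:ℝ), (p.2:X)))
        (by fun_prop) (fun p => ⟨p.1.2, p.2.2⟩)⟩
  let f : C(K, ℂ) := ⟨fun x => φ x, continuousOn_iff_continuous_domRestrict.1 h1⟩
  have H0 : ∀ a, HH (0, a) = ⟨exp (f a), exp_ne_zero _⟩ := fun a =>
    Subtype.ext (h2 a a.2).symm
  let G := isCoveringMap_exp.liftHomotopy HH f H0
  have hG := isCoveringMap_exp.liftHomotopy_lifts HH f H0
  refine ⟨fun x => if hx : x ∈ K then G (1, ⟨x, hx⟩) else 0, ?_, ?_⟩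
  · rw [continuousOn_iff_continuous_domRestrict]
    have : Continuous fun x : K => G (1, x) := by fun_prop
    refine this.congr fun x => ?_
    simp [Set.domRestrict]
  · intro z hz
    simp only [hz, dif_pos]
    have := congrArg Subtype.val (congrFun hG (1, ⟨z, hz⟩))
    exact this

theorem HasLog.const {K : Set X} {c : ℂ} (hc : c ≠ 0) : HasLog K (fun _ => c) :=
  ⟨fun _ => log c, continuousOn_const, fun _ _ => exp_log hc⟩

theorem hasLog_of_starConvex {E : Type*} [NormedAddCommGroup E] [NormedSpace ℝ E] {K : Set E}
    {c : E} (hc : StarConvex ℝ c K) {F : E → ℂ} (hF : ContinuousOn F K)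
    (h0 : ∀ z ∈ K, F z ≠ 0) : HasLog K F := by
  rcases K.eq_empty_or_nonempty with rfl | hne
  · exact ⟨0, by simp⟩
  have hcK : c ∈ K := hc.mem hne
  have hm : ∀ t ∈ Icc (0:ℝ) 1, ∀ z ∈ K, c + t • (z - c) ∈ K := fun t ht z hz =>
    hc.add_smul_sub_mem hz ht.1 ht.2
  have := HasLog.homotopy (K := K) (H := fun t z => F (c + t • (z - c))) ?_
    (fun t ht z hz => h0 _ (hm t ht z hz)) (by simpa using HasLog.const (h0 c hcK))
  · simpa using this
  · refine hF.comp (f := fun p : ℝ × E => c + p.1 • (p.2 - c)) (by fun_prop) ?_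
    rintro ⟨t, z⟩ ⟨ht, hz⟩
    exact hm t ht z hz

theorem hasLog_of_convex {E : Type*} [NormedAddCommGroup E] [NormedSpace ℝ E] {K : Set E}
    (hc : Convex ℝ K) {F : E → ℂ} (hF : ContinuousOn F K)
    (h0 : ∀ z ∈ K, F z ≠ 0) : HasLog K F := by
  rcases K.eq_empty_or_nonempty with rfl | ⟨c, hcK⟩
  · exact ⟨0, by simp⟩
  · exact hasLog_of_starConvex (hc.starConvex hcK) hF h0

theorem no_log_sphere {a : ℂ} {r : ℝ} (hr : 0 < r) : ¬ HasLog (sphere a r) (fun z => z - a) := by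
  rintro ⟨φ, h1, h2⟩
  have hm : ∀ θ : ℝ, a + r * exp (θ * I) ∈ sphere a r := fun θ => by
    simp [norm_exp_ofReal_mul_I, abs_of_pos hr]
  have hc : ContinuousOn (fun θ : ℝ => φ (a + r * exp (θ * I))) univ :=
    h1.comp (by fun_prop) (fun θ _ => hm θ)
  obtain ⟨c, -, hc2⟩ := log_unique' (K := (univ : Set ℝ)) isPreconnected_univ hc
    (ψ := fun θ => log r + θ * I) (by fun_prop) (fun θ _ => by
      rw [h2 _ (hm θ), exp_add, exp_log (by exact_mod_cast hr.ne')]; ring)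
  have e0 := hc2 0 trivial
  have e1 := hc2 (2 * Real.pi) trivial
  have : exp ((2 * Real.pi : ℝ) * I) = exp ((0:ℝ) * I) := by
    push_cast; rw [exp_two_pi_mul_I]; simp
  simp only [this] at e1
  rw [e0] at e1
  have := congrArg Complex.im e1
  simp at this

theorem no_ext {a : ℂ} {R : ℝ} {F : ℂ → ℂ} (hF : Continuous F) (h0 : ∀ z, F z ≠ 0)
    (hR : ∀ z, R ≤ ‖z‖ → F z = z - a) : False := by
  have h1 : HasLog univ F := hasLog_of_convex convex_univ hF.continuousOn (fun z _ => h0 z)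
  have hp : 0 < |R| + ‖a‖ + 1 := by positivity
  refine no_log_sphere (a := a) hp ((h1.mono (subset_univ _)).congr fun z hz => ?_)
  refine (hR z ?_).symm
  rw [mem_sphere, dist_eq_norm] at hz
  have := norm_sub_le z a
  linarith [le_abs_self R]

theorem isPreconnected_compl_closedBall (c : ℂ) (R : ℝ) (hR : 0 ≤ R) :
    IsPreconnected (closedBall c R)ᶜ := by
  have : (closedBall c R)ᶜ = (fun p : ℝ × ℝ => c + p.1 * exp (p.2 * I)) '' (Ioi R ×ˢ univ) := by
    ext z
    simp only [mem_compl_iff, mem_closedBall, not_le, dist_eq_norm, mem_image, Prod.exists]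
    constructor
    · intro h
      exact ⟨‖z - c‖, arg (z - c), ⟨h, trivial⟩, by rw [norm_mul_exp_arg_mul_I]; ring⟩
    · rintro ⟨r, θ, ⟨hr, -⟩, rfl⟩
      simp only [mem_Ioi] at hr
      simpa [norm_exp_ofReal_mul_I, abs_of_nonneg (hR.trans hr.le)] using hr
  rw [this]
  exact (((convex_Ioi R).prod convex_univ).isPreconnected).image _ (by fun_prop)

end logs

section comps
theorem isOpen_comp {K : Set ℂ} (hK : IsClosed K) (a : ℂ) :
    IsOpen (connectedComponentIn Kᶜ a) := hK.isOpen_compl.connectedComponentIn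

theorem frontier_comp {K : Set ℂ} (hK : IsClosed K) (a : ℂ) :
    frontier (connectedComponentIn Kᶜ a) ⊆ K := by
  intro z hz
  by_contra hzK
  rw [(isOpen_comp hK a).frontier_eq] at hz
  obtain ⟨w, hw1, hw2⟩ := mem_closure_iff.1 hz.1 _ (isOpen_comp hK z) (mem_connectedComponentIn hzK)
  refine hz.2 ?_
  rw [connectedComponentIn_eq hw2, ← connectedComponentIn_eq hw1]
  exact mem_connectedComponentIn hzK

theorem same_comp_of_subset {K C : Set ℂ} (hC : IsPreconnected C) (h : C ⊆ Kᶜ) {a b : ℂ} (ha : a ∈ C)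
    (hb : b ∈ C) : b ∈ connectedComponentIn Kᶜ a :=
  hC.subset_connectedComponentIn ha h hb

theorem hasLog_of_conn {K C : Set ℂ} (hK : IsCompact K) (hC : IsPreconnected C)
    (hd : Disjoint C K) {a b : ℂ} (ha : a ∈ C) (hb : b ∈ C) :
    HasLog K (fun z => (z - a) / (z - b)) := by
  have hne : ∀ a ∈ C, ∀ z ∈ K, z - a ≠ 0 := fun a ha z hz h =>
    hd.le_bot ⟨ha, (sub_eq_zero.1 h) ▸ hz⟩
  have hP : ∀ a b : ℂ, HasLog K (fun z => (z - a) / (z - b)) →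
      HasLog K (fun z => (z - b) / (z - a)) := fun a b h => h.inv.congr fun z _ => by rw [inv_div]
  refine hC.induction₂' (fun a b => HasLog K (fun z => (z - a) / (z - b))) ?_ ?_ ha hb
  · intro x hx
    have hev : ∀ᶠ y in 𝓝 x, y ∈ Kᶜ ∧ dist y x < infDist x K / 2 ∨ K = ∅ := by
      rcases K.eq_empty_or_nonempty with rfl | hKne
      · simp
      · have hpos : 0 < infDist x K :=
          (hK.isClosed.notMem_iff_infDist_pos hKne).1 (fun h => hd.le_bot ⟨hx, h⟩)
        filter_upwards [hK.isClosed.isOpen_compl.mem_nhds (fun h => hd.le_bot ⟨hx, h⟩),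
          ball_mem_nhds x (half_pos hpos)] with y h1 h2 using Or.inl ⟨h1, h2⟩
    filter_upwards [nhdsWithin_le_nhds hev, self_mem_nhdsWithin] with y hy hyC
    rcases hy with ⟨h1, h2⟩ | h
    swap
    · subst h; exact ⟨⟨0, by simp⟩, ⟨0, by simp⟩⟩
    have : HasLog K (fun z => (z - y) / (z - x)) := by
      refine ⟨fun z => log ((z - y) / (z - x)), ?_, fun z hz =>
        exp_log (div_ne_zero (hne y hyC z hz) (hne x hx z hz))⟩
      refine ContinuousOn.clog ?_ ?_
      · exact ContinuousOn.div (by fun_prop) (by fun_prop) (fun z hz => hne x hx z hz)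
      · intro z hz
        have hzx := hne x hx z hz
        have e : (z - y) / (z - x) = 1 - (y - x) / (z - x) := by field_simp; ring
        have hlt : ‖(y - x) / (z - x)‖ < 1 := by
          rw [norm_div, div_lt_one (norm_pos_iff.2 hzx)]
          have := infDist_le_dist_of_mem (x := x) hz
          rw [dist_comm, dist_eq_norm] at this
          rw [dist_eq_norm] at h2
          have := norm_nonneg (y - x)
          linarith
        left
        rw [e, sub_re, one_re]
        have := (abs_re_le_norm ((y - x) / (z - x)))
        have := le_abs_self ((y - x) / (z - x)).re
        linarith
    exact ⟨hP _ _ this, this⟩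
  · intro x y z _ hy _ h1 h2
    refine (h1.mul h2).congr fun w hw => ?_
    have := hne y hy w hw
    field_simp

theorem eilenberg_aux {K : Set ℂ} (hK : IsCompact K) {a b : ℂ} (ha : a ∉ K) (hb : b ∉ K)
    (hbd : Bornology.IsBounded (connectedComponentIn Kᶜ a))
    (h : HasLog K (fun z => (z - a) / (z - b))) : b ∈ connectedComponentIn Kᶜ a := by
  classical
  by_contra hba
  obtain ⟨φ, h1, h2⟩ := h
  obtain ⟨Φ, hΦ⟩ := ContinuousMap.exists_restrict_eq (Y := ℂ) hK.isClosed
    ⟨K.domRestrict φ, continuousOn_iff_continuous_domRestrict.1 h1⟩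
  have hΦ' : ∀ z ∈ K, Φ z = φ z := fun z hz => congrArg (fun f => f ⟨z, hz⟩) hΦ
  set U := connectedComponentIn Kᶜ a with hU
  obtain ⟨R, hR⟩ := hbd.subset_ball 0
  refine no_ext (a := a) (R := R) (F := fun z => if z ∈ U then (z - b) * exp (Φ z) else z - a)
    ?_ ?_ ?_
  · refine Continuous.if (fun z hz => ?_) (by fun_prop) (by fun_prop)
    have hzK := frontier_comp hK.isClosed a hz
    have : z - b ≠ 0 := fun h => hb ((sub_eq_zero.1 h) ▸ hzK)
    rw [hΦ' z hzK, h2 z hzK]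
    field_simp
  · intro z
    split_ifs with hz
    · refine mul_ne_zero (fun h => hba ((sub_eq_zero.1 h) ▸ hz)) (exp_ne_zero _)
    · intro h
      exact hz ((sub_eq_zero.1 h) ▸ mem_connectedComponentIn ha)
  · intro z hz
    have : z ∉ U := fun h => by
      have := hR h
      rw [mem_ball_zero_iff] at this
      linarith
    simp [this]

theorem comp_eq_of_unbounded {K : Set ℂ} (hK : IsCompact K) {a b : ℂ}
    (ha : ¬ Bornology.IsBounded (connectedComponentIn Kᶜ a))
    (hb : ¬ Bornology.IsBounded (connectedComponentIn Kᶜ b)) :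
    connectedComponentIn Kᶜ a = connectedComponentIn Kᶜ b := by
  obtain ⟨R, hR0, hR⟩ := hK.isBounded.subset_closedBall_lt 0 0
  have key : ∀ a, ¬ Bornology.IsBounded (connectedComponentIn Kᶜ a) →
      ∃ z, z ∈ (closedBall (0:ℂ) R)ᶜ ∧ z ∈ connectedComponentIn Kᶜ a := fun a ha => by
    by_contra hcon
    push Not at hcon
    exact ha (isBounded_closedBall.subset fun z hz => by
      by_contra h; exact hcon z h hz)
  obtain ⟨z, hz1, hz2⟩ := key a ha
  obtain ⟨w, hw1, hw2⟩ := key b hb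
  rw [connectedComponentIn_eq hz2, connectedComponentIn_eq hw2]
  exact connectedComponentIn_eq (same_comp_of_subset (isPreconnected_compl_closedBall 0 R hR0.le)
    (compl_subset_compl.2 hR) hz1 hw1)

theorem eilenberg {K : Set ℂ} (hK : IsCompact K) {a b : ℂ} (ha : a ∉ K) (hb : b ∉ K)
    (h : HasLog K (fun z => (z - a) / (z - b))) : b ∈ connectedComponentIn Kᶜ a := by
  by_cases h1 : Bornology.IsBounded (connectedComponentIn Kᶜ a)
  · exact eilenberg_aux hK ha hb h1 h
  by_cases h2 : Bornology.IsBounded (connectedComponentIn Kᶜ b)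
  · have := eilenberg_aux hK hb ha h2 (h.inv.congr fun z _ => by rw [inv_div])
    rw [← connectedComponentIn_eq this]
    exact mem_connectedComponentIn hb
  · rw [comp_eq_of_unbounded hK h1 h2]
    exact mem_connectedComponentIn hb

theorem hasLog_iff_comp {K : Set ℂ} (hK : IsCompact K) {a b : ℂ} (ha : a ∉ K) (hb : b ∉ K) :
    HasLog K (fun z => (z - a) / (z - b)) ↔ b ∈ connectedComponentIn Kᶜ a :=
  ⟨eilenberg hK ha hb, fun h => hasLog_of_conn hK isPreconnected_connectedComponentIn
    (disjoint_left.2 fun _ hz => connectedComponentIn_subset _ _ hz)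
    (mem_connectedComponentIn ha) h⟩

theorem janiszewski {K L : Set ℂ} (hK : IsCompact K) (hL : IsCompact L)
    (hc : IsPreconnected (K ∩ L)) {a b : ℂ} (ha : a ∉ K ∪ L) (hb : b ∉ K ∪ L)
    (h1 : b ∈ connectedComponentIn Kᶜ a) (h2 : b ∈ connectedComponentIn Lᶜ a) :
    b ∈ connectedComponentIn (K ∪ L)ᶜ a := by
  simp only [mem_union, not_or] at ha hb
  rw [← hasLog_iff_comp hK ha.1 hb.1] at h1
  rw [← hasLog_iff_comp hL ha.2 hb.2] at h2
  exact eilenberg (hK.union hL) (by simp [ha]) (by simp [hb])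
    (h1.glue hK.isClosed hL.isClosed hc h2)
end comps

theorem HasLog.glue_open {X : Type*} [TopologicalSpace X] {K L : Set X} {F : X → ℂ} (hK : IsOpen K)
    (hL : IsOpen L) (hc : IsPreconnected (K ∩ L)) (h : HasLog K F) (h' : HasLog L F) :
    HasLog (K ∪ L) F := by
  classical
  obtain ⟨φ, h1, h2⟩ := h
  obtain ⟨ψ, h3, h4⟩ := h'
  obtain ⟨c, hc1, hc2⟩ := log_unique' hc (h1.mono inter_subset_left) (h3.mono inter_subset_right)
    (fun z hz => by rw [h2 z hz.1, h4 z hz.2])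
  have e1 : EqOn (K.piecewise φ (fun z => ψ z + c)) φ K := fun z hz => by simp [hz]
  have e2 : EqOn (K.piecewise φ (fun z => ψ z + c)) (fun z => ψ z + c) L := fun z hz => by
    by_cases hzK : z ∈ K
    · simp only [Set.piecewise_eq_of_mem _ _ _ hzK]; exact hc2 z ⟨hzK, hz⟩
    · simp [hzK]
  refine ⟨K.piecewise φ (fun z => ψ z + c), ?_, ?_⟩
  · exact (h1.congr e1).union_of_isOpen ((h3.add continuousOn_const).congr e2) hK hL
  · rintro z (hz | hz)
    · rw [e1 hz, h2 z hz]
    · rw [e2 hz, exp_add, hc1, mul_one, h4 z hz]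

theorem path_log {α : ℝ → ℂ} (hα : ContinuousOn α (Icc 0 1)) :
    HasLog (α '' Icc 0 1)ᶜ (fun z => (z - α 1) / (z - α 0)) := by
  have hne : ∀ t ∈ Icc (0:ℝ) 1, ∀ z ∈ (α '' Icc 0 1)ᶜ, z - α t ≠ 0 := fun t ht z hz h =>
    hz ⟨t, ht, (sub_eq_zero.1 h).symm⟩
  refine HasLog.homotopy (H := fun t z => (z - α t) / (z - α 0)) ?_ ?_ ?_
  · refine ContinuousOn.div ?_ ?_ ?_
    · exact ContinuousOn.sub continuousOn_snd (hα.comp continuousOn_fst (fun p hp => hp.1))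
    · exact ContinuousOn.sub continuousOn_snd continuousOn_const
    · rintro ⟨t, z⟩ ⟨_, hz⟩
      exact hne 0 (by simp) z hz
  · intro t ht z hz
    exact div_ne_zero (hne t ht z hz) (hne 0 (by simp) z hz)
  · refine (HasLog.const one_ne_zero).congr fun z hz => div_self (hne 0 (by simp) z hz)

theorem two_paths_sep {α β : ℝ → ℂ} (hα : ContinuousOn α (Icc 0 1)) (hβ : ContinuousOn β (Icc 0 1))
    (h0 : α 0 = β 0) (h1 : α 1 = β 1) (hne : α 0 ≠ α 1)
    (hd : α '' Icc 0 1 ∩ β '' Icc 0 1 ⊆ {α 0, α 1}) :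
    ¬ IsPreconnected (α '' Icc 0 1 ∪ β '' Icc 0 1)ᶜ := by
  intro hc
  have cA := (isCompact_Icc.image_of_continuousOn hα).isClosed
  have cB := (isCompact_Icc.image_of_continuousOn hβ).isClosed
  have hA := path_log hα
  have hB := path_log hβ
  rw [← h0, ← h1] at hB
  rw [compl_union] at hc
  have h := hA.glue_open cA.isOpen_compl cB.isOpen_compl hc hB
  rw [← compl_inter] at h
  set r := dist (α 0) (α 1) / 2 with hr
  have hrp : 0 < r := half_pos (dist_pos.2 hne)
  have hball : ∀ z ∈ closedBall (α 1) r, z - α 0 ≠ 0 := fun z hz h => by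
    rw [sub_eq_zero.1 h, mem_closedBall] at hz
    linarith
  refine no_log_sphere (a := α 1) hrp ?_
  have h' : HasLog (sphere (α 1) r) (fun z => z - α 0) :=
    (hasLog_of_convex (convex_closedBall (α 1) r) (by fun_prop) hball).mono sphere_subset_closedBall
  refine ((h.mono ?_).mul h').congr fun z hz => ?_
  · intro z hz hz2
    rcases hd hz2 with rfl | hz3
    · exact hball _ (sphere_subset_closedBall hz) (sub_self _)
    · rw [mem_singleton_iff] at hz3
      rw [hz3, mem_sphere, dist_self] at hz
      exact hrp.ne hz
  · rw [div_mul_cancel₀ _ (hball z (sphere_subset_closedBall hz))]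

def Inn (K : Set ℂ) : Set ℂ := {z | z ∉ K ∧ Bornology.IsBounded (connectedComponentIn Kᶜ z)}
def Out (K : Set ℂ) : Set ℂ := {z | z ∉ K ∧ ¬ Bornology.IsBounded (connectedComponentIn Kᶜ z)}

theorem inn_out (K : Set ℂ) (z : ℂ) : z ∈ K ∨ z ∈ Inn K ∨ z ∈ Out K := by
  by_cases h : z ∈ K
  · exact Or.inl h
  · by_cases h2 : Bornology.IsBounded (connectedComponentIn Kᶜ z)
    · exact Or.inr (Or.inl ⟨h, h2⟩)
    · exact Or.inr (Or.inr ⟨h, h2⟩)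

theorem disj_inn_out {K : Set ℂ} {z : ℂ} (h : z ∈ Inn K) (h' : z ∈ Out K) : False := h'.2 h.2

theorem out_eq_comp {K : Set ℂ} (hK : IsCompact K) {a : ℂ} (ha : a ∈ Out K) :
    Out K = connectedComponentIn Kᶜ a := by
  ext z
  constructor
  · intro hz
    rw [comp_eq_of_unbounded hK ha.2 hz.2]
    exact mem_connectedComponentIn hz.1
  · intro hz
    refine ⟨connectedComponentIn_subset _ _ hz, ?_⟩
    rw [← connectedComponentIn_eq hz]
    exact ha.2

theorem out_preconn {K : Set ℂ} (hK : IsCompact K) : IsPreconnected (Out K) := by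
  rcases (Out K).eq_empty_or_nonempty with h | ⟨a, ha⟩
  · rw [h]; exact isPreconnected_empty
  · rw [out_eq_comp hK ha]; exact isPreconnected_connectedComponentIn

theorem out_isOpen {K : Set ℂ} (hK : IsCompact K) : IsOpen (Out K) := by
  rcases (Out K).eq_empty_or_nonempty with h | ⟨a, ha⟩
  · rw [h]; exact isOpen_empty
  · rw [out_eq_comp hK ha]; exact isOpen_comp hK.isClosed a

theorem comp_subset_inn {K : Set ℂ} {a : ℂ} (ha : a ∈ Inn K) :
    connectedComponentIn Kᶜ a ⊆ Inn K := fun z hz =>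
  ⟨connectedComponentIn_subset _ _ hz, by rw [← connectedComponentIn_eq hz]; exact ha.2⟩

theorem inn_isOpen {K : Set ℂ} (hK : IsCompact K) : IsOpen (Inn K) := by
  rw [isOpen_iff_mem_nhds]
  intro a ha
  exact mem_of_superset ((isOpen_comp hK.isClosed a).mem_nhds (mem_connectedComponentIn ha.1))
    (comp_subset_inn ha)

theorem far_mem_out {K : Set ℂ} {R : ℝ} (hR0 : 0 ≤ R) (hR : K ⊆ closedBall 0 R) {z : ℂ}
    (hz : R < ‖z‖) : z ∈ Out K := by
  have hz' : z ∈ (closedBall (0:ℂ) R)ᶜ := by simpa using hz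
  refine ⟨fun h => hz' (hR h), fun hb => ?_⟩
  have hs := (isPreconnected_compl_closedBall 0 R hR0).subset_connectedComponentIn hz'
    (compl_subset_compl.2 hR)
  obtain ⟨S, hS⟩ := (hb.subset hs).subset_closedBall 0
  have hm : ((|R| + |S| + 1 : ℝ) : ℂ) ∈ (closedBall (0:ℂ) R)ᶜ := by
    simp only [mem_compl_iff, mem_closedBall_zero_iff, not_le, norm_real, Real.norm_eq_abs]
    exact lt_of_lt_of_le (by linarith [le_abs_self R, abs_nonneg S]) (le_abs_self _)
  have h2 := hS hm
  rw [mem_closedBall_zero_iff, norm_real, Real.norm_eq_abs] at h2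
  linarith [le_abs_self S, le_abs_self (|R| + |S| + 1), abs_nonneg R]

theorem inn_bounded {K : Set ℂ} (hK : IsCompact K) : Bornology.IsBounded (Inn K) := by
  obtain ⟨R, hR0, hR⟩ := hK.isBounded.subset_closedBall_lt 0 0
  refine isBounded_closedBall.subset (t := closedBall 0 R) fun z hz => ?_
  by_contra h
  exact disj_inn_out hz (far_mem_out hR0.le hR (by simpa using h))

theorem out_nonempty {K : Set ℂ} (hK : IsCompact K) : (Out K).Nonempty := by
  obtain ⟨R, hR0, hR⟩ := hK.isBounded.subset_closedBall_lt 0 0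
  refine ⟨((R + 1 : ℝ) : ℂ), far_mem_out hR0.le hR ?_⟩
  rw [norm_real, Real.norm_eq_abs]
  exact lt_of_lt_of_le (by linarith) (le_abs_self _)

theorem subset_out {K C : Set ℂ} (hC : IsPreconnected C) (hd : C ⊆ Kᶜ) {a : ℂ}
    (ha : a ∈ C) (h : a ∈ Out K) : C ⊆ Out K := fun z hz =>
  ⟨hd hz, by rw [connectedComponentIn_eq (same_comp_of_subset hC hd hz ha)]; exact h.2⟩

theorem subset_inn {K C : Set ℂ} (hC : IsPreconnected C) (hd : C ⊆ Kᶜ) {a : ℂ}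
    (ha : a ∈ C) (h : a ∈ Inn K) : C ⊆ Inn K := fun z hz =>
  ⟨hd hz, by rw [connectedComponentIn_eq (same_comp_of_subset hC hd hz ha)]; exact h.2⟩

theorem unbdd_subset_out {K C : Set ℂ} (hC : IsPreconnected C) (hd : C ⊆ Kᶜ)
    (h : ¬ Bornology.IsBounded C) : C ⊆ Out K := fun z hz =>
  ⟨hd hz, fun hb => h (hb.subset (hC.subset_connectedComponentIn hz hd))⟩

noncomputable def ee (t : ℝ) : ℂ := exp (t * I)
theorem ee_cont : Continuous ee := by unfold ee; fun_prop
theorem ee_mem (t : ℝ) : ee t ∈ sphere (0:ℂ) 1 := by simp [ee, norm_exp_ofReal_mul_I]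
theorem ee_surj {z : ℂ} (hz : z ∈ sphere (0:ℂ) 1) (s : ℝ) :
    ∃ t ∈ Ico s (s + 2 * Real.pi), ee t = z := by
  obtain ⟨n, hn, -⟩ := existsUnique_add_zsmul_mem_Ico Real.two_pi_pos (arg z) s
  refine ⟨_, hn, ?_⟩
  have h1 : z = exp (arg z * I) := by
    conv_lhs => rw [← norm_mul_exp_arg_mul_I z]
    rw [mem_sphere_zero_iff_norm.1 hz]; simp
  conv_rhs => rw [h1]
  rw [ee, exp_eq_exp_iff_exists_int]
  exact ⟨n, by push_cast [zsmul_eq_mul]; ring⟩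
theorem ee_inj {s t u : ℝ} (hs : s ∈ Ico u (u + 2 * Real.pi)) (ht : t ∈ Ico u (u + 2 * Real.pi))
    (h : ee s = ee t) : s = t := by
  rw [ee, ee, exp_eq_exp_iff_exists_int] at h
  obtain ⟨n, hn⟩ := h
  have h2 : s = t + n * (2 * Real.pi) := by
    have := congrArg Complex.im hn
    simpa using this
  have hp := Real.two_pi_pos
  have h3 : |(n:ℝ) * (2 * Real.pi)| < 1 * (2 * Real.pi) := by
    rw [abs_lt]; constructor <;> linarith [hs.1, hs.2, ht.1, ht.2]
  rw [abs_mul, abs_of_pos hp] at h3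
  have h4 : |(n:ℝ)| < 1 := lt_of_mul_lt_mul_right h3 hp.le
  have h5 : n = 0 := by
    rw [← Int.cast_abs] at h4
    exact Int.abs_lt_one_iff.1 (by exact_mod_cast h4)
  rw [h2, h5]; simp
theorem ee_add_two_pi (t : ℝ) : ee (t + 2 * Real.pi) = ee t := by
  rw [ee, ee, exp_eq_exp_iff_exists_int]
  exact ⟨1, by push_cast; ring⟩

structure JCurve (γ : ℂ → ℂ) : Prop where
  cont : ContinuousOn γ (sphere 0 1)
  inj : InjOn γ (sphere 0 1)

def Jor (γ : ℂ → ℂ) : Set ℂ := γ '' sphere 0 1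

namespace JCurve
variable {γ : ℂ → ℂ} (hγ : JCurve γ)
include hγ

theorem isCompact : IsCompact (Jor γ) := (isCompact_sphere _ _).image_of_continuousOn hγ.cont

theorem contp : Continuous fun t : ℝ => γ (ee t) :=
  hγ.cont.comp_continuous ee_cont ee_mem

theorem sep : ¬ IsPreconnected (Jor γ)ᶜ := by
  have hpi := Real.pi_pos
  have key := two_paths_sep (α := fun t => γ (ee (Real.pi * t)))
    (β := fun t => γ (ee (2 * Real.pi - Real.pi * t)))
    ((hγ.contp.comp (continuous_const.mul continuous_id)).continuousOn)
    ((hγ.contp.comp (continuous_const.sub (continuous_const.mul continuous_id))).continuousOn)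
    ?_ ?_ ?_ ?_
  · have e : Jor γ = (fun t => γ (ee (Real.pi * t))) '' Icc 0 1 ∪
        (fun t => γ (ee (2 * Real.pi - Real.pi * t))) '' Icc 0 1 := by
     ext z
     simp only [Jor, mem_image, mem_union]
     constructor
     · rintro ⟨w, hw, rfl⟩
       obtain ⟨t, ht, rfl⟩ := ee_surj hw 0
       rcases le_total t Real.pi with h | h
       · refine Or.inl ⟨t / Real.pi, ⟨div_nonneg ht.1 hpi.le, (div_le_one hpi).2 h⟩, ?_⟩
         congr 2; field_simp
       · refine Or.inr ⟨2 - t / Real.pi, ⟨?_, ?_⟩, ?_⟩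
         · rw [sub_nonneg, div_le_iff₀ hpi]; linarith [ht.2]
         · rw [sub_le_comm, le_div_iff₀ hpi]; linarith
         · congr 2; field_simp; ring
     · rintro (⟨t, -, rfl⟩ | ⟨t, -, rfl⟩) <;> exact ⟨_, ee_mem _, rfl⟩
    rw [e]; exact key
  · simpa using (congrArg γ (ee_add_two_pi 0)).symm
  · simp only [mul_one]; congr 2; ring
  · intro h
    have := ee_inj (u := 0) ⟨by simp, by simp [hpi]⟩ ⟨by simp [hpi.le], by simp; linarith⟩
      (hγ.inj (ee_mem _) (ee_mem _) h)
    simp at this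
    exact hpi.ne this
  · rintro _ ⟨⟨s, hs, rfl⟩, ⟨t, ht, h⟩⟩
    have h2 := hγ.inj (ee_mem _) (ee_mem _) h
    have a1 : Real.pi * s ≤ Real.pi := by nlinarith [hs.2]
    have a2 : Real.pi * t ≤ Real.pi := by nlinarith [ht.2]
    have a3 := mul_nonneg hpi.le hs.1
    have a4 := mul_nonneg hpi.le ht.1
    rcases eq_or_lt_of_le a4 with h0 | h0
    · left
      rw [← h0, sub_zero] at h2
      have : ee (2 * Real.pi) = ee 0 := by simpa using ee_add_two_pi 0
      rw [this] at h2
      simp [← h2]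
    · have h3 := ee_inj (u := 0) ⟨by linarith, by linarith⟩ ⟨a3, by linarith⟩ h2
      right
      have : Real.pi * s = Real.pi * 1 := by linarith
      simp [this]

theorem inn_nonempty : (Inn (Jor γ)).Nonempty := by
  by_contra h
  rw [not_nonempty_iff_eq_empty] at h
  refine hγ.sep ?_
  have : (Jor γ)ᶜ = Out (Jor γ) := by
    ext z
    refine ⟨fun hz => ?_, fun hz => hz.1⟩
    rcases inn_out (Jor γ) z with h1 | h1 | h1
    · exact absurd h1 hz
    · rw [h] at h1; exact absurd h1 (notMem_empty _)
    · exact h1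
  rw [this]
  exact out_preconn hγ.isCompact

theorem arc_log {s t : ℝ} (hst : t < s + 2 * Real.pi) {F : ℂ → ℂ}
    (hF : ContinuousOn F ((fun t => γ (ee t)) '' Icc s t))
    (h0 : ∀ z ∈ (fun t => γ (ee t)) '' Icc s t, F z ≠ 0) :
    HasLog ((fun t => γ (ee t)) '' Icc s t) F := by
  refine HasLog.image isCompact_Icc hγ.contp.continuousOn ?_
    (hasLog_of_convex (convex_Icc s t) ?_ ?_)
  · intro u hu v hv h
    exact ee_inj (u := s) ⟨hu.1, hu.2.trans_lt hst⟩ ⟨hv.1, hv.2.trans_lt hst⟩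
      (hγ.inj (ee_mem _) (ee_mem _) h)
  · exact hF.comp hγ.contp.continuousOn (mapsTo_image _ _)
  · exact fun z hz => h0 _ (mem_image_of_mem _ hz)

theorem arc_compl {s t : ℝ} (hst : t < s + 2 * Real.pi) :
    IsPreconnected ((fun t => γ (ee t)) '' Icc s t)ᶜ := by
  set A := (fun t => γ (ee t)) '' Icc s t
  have hA : IsCompact A := isCompact_Icc.image hγ.contp
  rcases (Aᶜ).eq_empty_or_nonempty with h | ⟨a, ha⟩
  · rw [h]; exact isPreconnected_empty
  have : Aᶜ = connectedComponentIn Aᶜ a := by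
    refine Subset.antisymm (fun b hb => ?_) (connectedComponentIn_subset _ _)
    have hne : ∀ c ∈ Aᶜ, ∀ z ∈ A, z - c ≠ 0 := fun c hc z hz h => hc ((sub_eq_zero.1 h) ▸ hz)
    refine eilenberg hA ha hb (hγ.arc_log hst ?_ fun z hz => div_ne_zero (hne a ha z hz) (hne b hb z hz))
    exact ContinuousOn.div (by fun_prop) (by fun_prop) fun z hz => hne b hb z hz
  rw [this]
  exact isPreconnected_connectedComponentIn

theorem subset_closure_comp {a b : ℂ} (ha : a ∉ Jor γ) (hb : b ∉ Jor γ)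
    (hab : b ∉ connectedComponentIn (Jor γ)ᶜ a) :
    Jor γ ⊆ closure (connectedComponentIn (Jor γ)ᶜ a) := by
  set U := connectedComponentIn (Jor γ)ᶜ a with hU
  rintro _ ⟨w, hw, rfl⟩
  by_contra hcl
  obtain ⟨u, hu, rfl⟩ := ee_surj hw 0
  have hev : ∀ᶠ t in 𝓝 u, γ (ee t) ∈ (closure U)ᶜ :=
    hγ.contp.continuousAt (isClosed_closure.isOpen_compl.mem_nhds hcl)
  obtain ⟨ε, hε, hε2⟩ := Metric.eventually_nhds_iff.1 hev
  set δ := min (ε / 2) 1 with hδ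
  have hδp : 0 < δ := lt_min (half_pos hε) one_pos
  set A := (fun t => γ (ee t)) '' Icc (u + δ) (u + 2 * Real.pi - δ) with hA
  have hAJ : A ⊆ Jor γ := by rintro _ ⟨t, -, rfl⟩; exact ⟨_, ee_mem _, rfl⟩
  have hJA : closure U ∩ Jor γ ⊆ A := by
    rintro _ ⟨hz, w, hw, rfl⟩
    obtain ⟨t, ht, rfl⟩ := ee_surj hw u
    refine ⟨t, ?_, rfl⟩
    by_contra hcon
    rw [mem_Icc, not_and_or, not_le, not_le] at hcon
    rcases hcon with h | h
    · refine hε2 (y := t) ?_ hz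
      rw [Real.dist_eq, abs_of_nonneg (by linarith [ht.1])]
      linarith [min_le_left (ε / 2) 1]
    · have := hε2 (y := t - 2 * Real.pi) ?_
      · refine this ?_
        rw [← ee_add_two_pi, sub_add_cancel]; exact hz
      · rw [Real.dist_eq, abs_of_nonpos (by linarith [ht.2])]
        linarith [min_le_left (ε / 2) 1]
  have hc := hγ.arc_compl (s := u + δ) (t := u + 2 * Real.pi - δ) (by linarith)
  have hUo := isOpen_comp hγ.isCompact.isClosed a
  have hUA : U ⊆ Aᶜ := (connectedComponentIn_subset _ _).trans (compl_subset_compl.2 hAJ)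
  have : Aᶜ ⊆ U := by
    refine hc.subset_of_closure_inter_subset hUo ⟨a, fun h => ha (hAJ h), mem_connectedComponentIn ha⟩ ?_
    rintro z ⟨hz1, hz2⟩
    by_contra hzU
    have : z ∈ frontier U := by rw [hUo.frontier_eq]; exact ⟨hz1, hzU⟩
    exact hz2 (hJA ⟨hz1, frontier_comp hγ.isCompact.isClosed a this⟩)
  exact hab (this fun h => hb (hAJ h))

theorem subset_closure_out : Jor γ ⊆ closure (Out (Jor γ)) := by
  obtain ⟨a, ha⟩ := out_nonempty hγ.isCompact
  obtain ⟨b, hb⟩ := hγ.inn_nonempty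
  rw [out_eq_comp hγ.isCompact ha]
  refine hγ.subset_closure_comp ha.1 hb.1 fun h => ?_
  rw [← out_eq_comp hγ.isCompact ha] at h
  exact disj_inn_out hb h

theorem subset_closure_inn : Jor γ ⊆ closure (Inn (Jor γ)) := by
  obtain ⟨a, ha⟩ := out_nonempty hγ.isCompact
  obtain ⟨b, hb⟩ := hγ.inn_nonempty
  refine (hγ.subset_closure_comp hb.1 ha.1 fun h => ?_).trans (closure_mono (comp_subset_inn hb))
  exact disj_inn_out (comp_subset_inn hb h) ha

theorem punctured_preconn {w : ℂ} (hw : w ∈ Jor γ) : IsPreconnected (Jor γ \ {w}) := by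
  obtain ⟨v, hv, rfl⟩ := hw
  obtain ⟨u, -, rfl⟩ := ee_surj hv 0
  have : Jor γ \ {γ (ee u)} = (fun t => γ (ee t)) '' Ioo u (u + 2 * Real.pi) := by
    ext z
    constructor
    · rintro ⟨⟨x, hx, rfl⟩, hne⟩
      obtain ⟨t, ht, rfl⟩ := ee_surj hx u
      refine ⟨t, ⟨lt_of_le_of_ne ht.1 ?_, ht.2⟩, rfl⟩
      rintro rfl; exact hne rfl
    · rintro ⟨t, ht, rfl⟩
      refine ⟨⟨_, ee_mem _, rfl⟩, fun h => ?_⟩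
      have := ee_inj (u := u) ⟨ht.1.le, ht.2⟩ ⟨le_rfl, by linarith [Real.pi_pos]⟩
        (hγ.inj (ee_mem _) (ee_mem _) h)
      exact ht.1.ne' this
  rw [this]
  exact isPreconnected_Ioo.image _ hγ.contp.continuousOn
end JCurve

theorem winding {a : ℂ} {r : ℝ} (hr : 0 < r) {F : ℂ → ℂ} (hF : ContinuousOn F (sphere a r))
    (h0 : ∀ z ∈ sphere a r, F z ≠ 0) :
    ∃ n : ℤ, HasLog (sphere a r) (fun z => F z * (z - a) ^ (-n)) := by
  have hm : ∀ θ : ℝ, a + r * ee θ ∈ sphere a r := fun θ => by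
    simp [ee, norm_exp_ofReal_mul_I, abs_of_pos hr]
  have hg : Continuous fun θ : ℝ => a + r * ee θ := by have := ee_cont; fun_prop
  obtain ⟨φ, h1, h2⟩ := hasLog_of_convex (K := (univ : Set ℝ)) convex_univ
    (F := fun θ => F (a + r * ee θ)) (hF.comp hg.continuousOn fun θ _ => hm θ)
    (fun θ _ => h0 _ (hm θ))
  have h1' : Continuous φ := continuousOn_univ.1 h1
  obtain ⟨c, hc1, hc2⟩ := log_unique' (K := (univ : Set ℝ)) isPreconnected_univ
    (φ := fun θ => φ (θ + 2 * Real.pi)) (ψ := φ) (by fun_prop) h1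
    (fun θ _ => by rw [h2 _ trivial, h2 _ trivial]; simp only [ee_add_two_pi])
  obtain ⟨n, hn⟩ := Complex.exp_eq_one_iff.1 hc1
  refine ⟨n, ?_⟩
  set ψ : ℝ → ℂ := fun θ => φ θ - n * (log r + θ * I) with hψ
  have hψc : Continuous ψ := by fun_prop
  have hper : Function.Periodic ψ (2 * Real.pi) := fun θ => by
    simp only [hψ]; rw [hc2 θ trivial, hn]; push_cast; ring
  have hper' : ∀ s t : ℝ, ee s = ee t → ψ s = ψ t := fun s t h => by
    rw [ee, ee, exp_eq_exp_iff_exists_int] at h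
    obtain ⟨n, hn⟩ := h
    have h2 : s = t + n * (2 * Real.pi) := by
      have := congrArg Complex.im hn
      simpa using this
    rw [h2]; exact hper.int_mul n t
  have hee : ∀ z ∈ sphere a r, a + r * ee (arg (z - a)) = z := fun z hz => by
    have := norm_mul_exp_arg_mul_I (z - a)
    rw [mem_sphere, dist_eq_norm] at hz
    rw [hz] at this
    rw [ee, this]; ring
  have hee2 : ∀ z ∈ sphere a r, ee (arg (-(z - a)) + Real.pi) = ee (arg (z - a)) := fun z hz => by
    have h1 := norm_mul_exp_arg_mul_I (z - a)
    have h3 := norm_mul_exp_arg_mul_I (-(z - a))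
    rw [mem_sphere, dist_eq_norm] at hz
    rw [norm_neg, hz] at h3
    rw [hz] at h1
    have hr' : (r : ℂ) ≠ 0 := by exact_mod_cast hr.ne'
    refine mul_left_cancel₀ hr' ?_
    rw [ee, ee, h1]
    push_cast
    rw [add_mul, exp_add, exp_pi_mul_I, ← mul_assoc, h3]; ring
  refine ⟨fun z => ψ (arg (z - a)), ?_, ?_⟩
  · intro z hz
    have hz0 : z - a ≠ 0 := by
      intro h; rw [mem_sphere, dist_eq_norm, h, norm_zero] at hz; exact hr.ne hz
    rcases mem_slitPlane_or_neg_mem_slitPlane (z := z - a) hz0 with h | h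
    · exact (ContinuousAt.comp (g := ψ) hψc.continuousAt
        (ContinuousAt.comp (g := arg) (f := fun z => z - a) (continuousAt_arg h) (by fun_prop))).continuousWithinAt
    · have : ContinuousWithinAt (fun z => ψ (arg (-(z - a)) + Real.pi)) (sphere a r) z :=
        (ContinuousAt.comp (g := ψ) hψc.continuousAt
          ((ContinuousAt.comp (g := arg) (f := fun z => -(z - a)) (continuousAt_arg h) (by fun_prop)).add
            continuousAt_const)).continuousWithinAt
      exact this.congr (fun y hy => hper' _ _ (hee2 y hy).symm) (hper' _ _ (hee2 z hz).symm)
  · intro z hz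
    have e := hee z hz
    have hr' : (r : ℂ) ≠ 0 := by exact_mod_cast hr.ne'
    simp only [hψ]
    rw [exp_sub, h2 _ trivial]
    simp only
    rw [e, exp_int_mul, exp_add, exp_log hr']
    have : (r:ℂ) * exp (arg (z - a) * I) = z - a := by
      rw [← ee]; linear_combination e
    rw [this, zpow_neg, div_eq_mul_inv]

theorem HasLog.zpow {X : Type*} [TopologicalSpace X] {K : Set X} {F : X → ℂ} (h : HasLog K F) (n : ℤ) :
    HasLog K (fun z => F z ^ n) := by
  obtain ⟨φ, h1, h2⟩ := h
  exact ⟨fun z => n * φ z, continuousOn_const.mul h1, fun z hz => by rw [exp_int_mul, h2 z hz]⟩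

theorem hasLog_sub {K : Set ℂ} (hK : IsCompact K) (hc : IsPreconnected Kᶜ) {a : ℂ} (ha : a ∉ K) :
    HasLog K (fun z => z - a) := by
  obtain ⟨R, hR0, hR⟩ := hK.isBounded.subset_ball_lt 0 0
  have hb : ∀ z ∈ ball (0:ℂ) R, z - (R:ℂ) ≠ 0 := fun z hz h => by
    rw [sub_eq_zero.1 h] at hz
    simp [abs_of_pos hR0] at hz
  have hRK : (R:ℂ) ∉ K := fun h => hb _ (hR h) (sub_self _)
  have h1 : HasLog K (fun z => z - (R:ℂ)) :=
    (hasLog_of_convex (convex_ball 0 R) (by fun_prop) hb).mono hR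
  have h2 := hasLog_of_conn hK hc disjoint_compl_left ha hRK
  refine (h2.mul h1).congr fun z hz => ?_
  have := hb z (hR hz)
  field_simp

theorem borsuk_aux {K : Set ℂ} (hK : IsCompact K) (hc : IsPreconnected Kᶜ) {R : ℝ}
    (hKR : K ⊆ ball 0 R) (N : ℕ) : ∀ F : ℂ → ℂ, ContinuousOn F (ball 0 R) →
    (∀ z ∈ K, F z ≠ 0) → {z ∈ ball (0:ℂ) R | F z = 0}.Finite →
    {z ∈ ball (0:ℂ) R | F z = 0}.ncard = N → HasLog K F := by
  classical
  induction N with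
  | zero =>
    intro F hF hFK hfin hN
    rw [Set.ncard_eq_zero hfin] at hN
    refine (hasLog_of_convex (convex_ball 0 R) hF fun z hz h => ?_).mono hKR
    exact (Set.eq_empty_iff_forall_notMem.1 hN z) ⟨hz, h⟩
  | succ N ih =>
    intro F hF hFK hfin hN
    obtain ⟨a, haR, haF⟩ : {z ∈ ball (0:ℂ) R | F z = 0}.Nonempty := by
      rw [← Set.ncard_pos hfin]; omega
    have haK : a ∉ K := fun h => hFK a h haF
    have hop : IsOpen (ball (0:ℂ) R ∩ Kᶜ ∩ ({z ∈ ball (0:ℂ) R | F z = 0} \ {a})ᶜ) :=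
      (isOpen_ball.inter hK.isClosed.isOpen_compl).inter
        (hfin.subset sdiff_subset).isClosed.isOpen_compl
    obtain ⟨r, hr, hrs⟩ := Metric.nhds_basis_closedBall.mem_iff.1
      (hop.mem_nhds ⟨⟨haR, haK⟩, by simp⟩)
    have hs : ∀ z ∈ sphere a r, F z ≠ 0 := fun z hz h => by
      obtain ⟨⟨h1, -⟩, h2⟩ := hrs (sphere_subset_closedBall hz)
      refine h2 ⟨⟨h1, h⟩, ?_⟩
      rintro rfl
      simp at hz; exact hr.ne hz
    obtain ⟨n, φ, h1, h2⟩ := winding hr (hF.mono fun z hz =>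
      (hrs (sphere_subset_closedBall hz)).1.1) hs
    obtain ⟨Φ, hΦ⟩ := ContinuousMap.exists_restrict_eq (Y := ℂ) (isClosed_sphere (x := a) (ε := r))
      ⟨(sphere a r).domRestrict φ, continuousOn_iff_continuous_domRestrict.1 h1⟩
    have hΦ' : ∀ z ∈ sphere a r, Φ z = φ z := fun z hz => congrArg (fun f => f ⟨z, hz⟩) hΦ
    set G : ℂ → ℂ := (closedBall a r).piecewise (fun z => exp (Φ z)) (fun z => F z * (z - a) ^ (-n))
      with hG
    have e1 : EqOn G (fun z => exp (Φ z)) (closedBall a r) := fun z hz => by simp only [hG]; rw [piecewise_eq_of_mem _ _ _ hz]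
    have e2 : EqOn G (fun z => F z * (z - a) ^ (-n)) (ball (0:ℂ) R ∩ (ball a r)ᶜ) := by
      rintro z ⟨-, hz⟩
      by_cases h : z ∈ closedBall a r
      · have hz' : z ∈ sphere a r := by
          simp only [mem_compl_iff, mem_ball, not_lt, mem_closedBall] at h hz
          exact le_antisymm h hz
        rw [e1 h]; simp only; rw [hΦ' z hz', h2 z hz']
      · simp only [hG]; rw [piecewise_eq_of_notMem _ _ _ h]
    have hne : ∀ z ∈ (ball a r)ᶜ, z - a ≠ 0 := fun z hz h => hz (by rw [sub_eq_zero.1 h]; simpa using hr)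
    have hGc : ContinuousOn G (ball 0 R) := by
      have c1 : ContinuousOn G (closedBall a r) :=
        ContinuousOn.congr (by fun_prop) e1
      have c2 : ContinuousOn G (ball (0:ℂ) R ∩ (ball a r)ᶜ) := by
        refine ContinuousOn.congr ?_ e2
        refine (hF.mono inter_subset_left).mul ?_
        exact ContinuousOn.zpow₀ (by fun_prop) _ (fun z hz => Or.inl (hne z hz.2))
      intro z hz
      by_cases h : z ∈ ball a r
      · exact (c1.continuousAt (mem_of_superset (isOpen_ball.mem_nhds h) ball_subset_closedBall)).continuousWithinAt
      · have w2 : ContinuousWithinAt G (ball (0:ℂ) R ∩ (ball a r)ᶜ) z := c2 z ⟨hz, h⟩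
        have w1 : ContinuousWithinAt G (ball (0:ℂ) R ∩ closedBall a r) z := by
          by_cases h' : z ∈ closedBall a r
          · exact (c1 z h').mono inter_subset_right
          · refine continuousWithinAt_of_notMem_closure fun h3 => h' ?_
            exact isClosed_closedBall.closure_subset_iff.2 inter_subset_right h3
        refine (w1.union w2).mono fun y hy => ?_
        by_cases h : y ∈ ball a r
        · exact Or.inl ⟨hy, ball_subset_closedBall h⟩
        · exact Or.inr ⟨hy, h⟩
    have hKb : ∀ z ∈ K, z ∈ ball (0:ℂ) R ∩ (ball a r)ᶜ := fun z hz =>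
      ⟨hKR hz, fun h => (hrs (ball_subset_closedBall h)).1.2 hz⟩
    have hz0 : {z ∈ ball (0:ℂ) R | G z = 0} = {z ∈ ball (0:ℂ) R | F z = 0} \ {a} := by
      ext z
      constructor
      · rintro ⟨h3, h4⟩
        by_cases h : z ∈ closedBall a r
        · rw [e1 h] at h4; exact absurd h4 (exp_ne_zero _)
        · have h5 : z ∈ (ball a r)ᶜ := fun h' => h (ball_subset_closedBall h')
          rw [e2 ⟨h3, h5⟩] at h4
          rcases mul_eq_zero.1 h4 with h6 | h6
          · exact ⟨⟨h3, h6⟩, fun h7 => hne z h5 (sub_eq_zero.2 h7)⟩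
          · exact absurd h6 (zpow_ne_zero _ (hne z h5))
      · rintro ⟨⟨h3, h4⟩, h5⟩
        have h : z ∉ closedBall a r := fun h => (hrs h).2 ⟨⟨h3, h4⟩, h5⟩
        refine ⟨h3, ?_⟩
        rw [e2 ⟨h3, fun h' => h (ball_subset_closedBall h')⟩]
        simp [h4]
    have hL := ih G hGc (fun z hz h => by
      rw [e2 (hKb z hz)] at h
      exact (mul_ne_zero (hFK z hz) (zpow_ne_zero _ (hne z (hKb z hz).2))) h)
      (by rw [hz0]; exact hfin.subset sdiff_subset)
      (by
        have := Set.ncard_sdiff_singleton_of_mem (s := {z ∈ ball (0:ℂ) R | F z = 0}) ⟨haR, haF⟩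
        rw [hz0, this, hN]; rfl)
    refine (hL.mul ((hasLog_sub hK hc haK).zpow n)).congr fun z hz => ?_
    rw [e2 (hKb z hz)]
    have := hne z (hKb z hz).2
    simp only [zpow_neg]
    field_simp

theorem borsuk {K : Set ℂ} (hK : IsCompact K) (hc : IsPreconnected Kᶜ) {u : ℂ → ℂ}
    (hu : ContinuousOn u K) (h0 : ∀ z ∈ K, u z ≠ 0) : HasLog K u := by
  rcases K.eq_empty_or_nonempty with rfl | hne
  · exact ⟨0, by simp⟩
  obtain ⟨R, hR0, hR⟩ := hK.isBounded.subset_ball_lt 0 0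
  obtain ⟨U, hU⟩ := ContinuousMap.exists_restrict_eq (Y := ℂ) hK.isClosed
    ⟨K.domRestrict u, continuousOn_iff_continuous_domRestrict.1 hu⟩
  have hU' : ∀ z ∈ K, U z = u z := fun z hz => congrArg (fun f => f ⟨z, hz⟩) hU
  obtain ⟨z0, hz0, hmin⟩ := hK.exists_isMinOn hne hu.norm
  set m := ‖u z0‖ with hm
  have hmp : 0 < m := norm_pos_iff.2 (h0 z0 hz0)
  obtain ⟨G, hG1, hG2, -⟩ := U.continuous.exists_contDiff_approx 1 (ε := fun _ => m / 2)
    continuous_const (fun _ => by positivity)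
  have hGd : Differentiable ℝ G := hG1.differentiable (by simp)
  have sard := MeasureTheory.addHaar_image_eq_zero_of_det_fderivWithin_eq_zero MeasureTheory.volume
    (s := {z | (fderiv ℝ G z).det = 0}) (f := G) (f' := fderiv ℝ G)
    (fun x _ => (hGd x).hasFDerivAt.hasFDerivWithinAt) (fun x hx => hx)
  obtain ⟨c, hcb, hcs⟩ : ∃ c ∈ ball (0:ℂ) (m/2), c ∉ G '' {z | (fderiv ℝ G z).det = 0} := by
    by_contra hcon
    push Not at hcon
    have := MeasureTheory.measure_mono_null (μ := MeasureTheory.volume) hcon sard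
    exact (measure_ball_pos MeasureTheory.volume (0:ℂ) (half_pos hmp)).ne' this
  have hclose : ∀ z ∈ K, ‖(G z - c) - u z‖ < ‖u z‖ := fun z hz => by
    have h1 := hG2 z
    rw [hU' z hz, dist_eq_norm] at h1
    have h2 : m ≤ ‖u z‖ := hmin hz
    rw [mem_ball_zero_iff] at hcb
    calc ‖(G z - c) - u z‖ = ‖(G z - u z) - c‖ := by ring_nf
      _ ≤ _ := norm_sub_le _ _
      _ < ‖u z‖ := by linarith
  have hfin : {z ∈ closedBall (0:ℂ) R | G z - c = 0}.Finite := by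
    have hcl : IsCompact {z ∈ closedBall (0:ℂ) R | G z - c = 0} :=
      (isCompact_closedBall 0 R).inter_right
        (isClosed_eq (hGd.continuous.sub continuous_const) continuous_const)
    refine hcl.finite (isDiscrete_iff_nhdsNE.2 fun x hx => ?_)
    have hd : (fderiv ℝ G x).det ≠ 0 := fun h => hcs ⟨x, h, sub_eq_zero.1 hx.2⟩
    have := (hGd x).hasFDerivAt.eventually_ne (c := c)
      ⟨_, by
        have := ((fderiv ℝ G x).toContinuousLinearEquivOfDetNeZero hd).antilipschitz
        exact this⟩
    rw [← disjoint_iff, disjoint_principal_right]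
    filter_upwards [this] with z hz h
    exact hz (sub_eq_zero.1 h.2)
  have hL := borsuk_aux hK hc hR _ (fun z => G z - c) (by have := hGd.continuous; fun_prop)
    (fun z hz h => by
      have := hclose z hz
      rw [h, zero_sub, norm_neg] at this
      exact lt_irrefl _ this)
    (hfin.subset fun z hz => ⟨ball_subset_closedBall hz.1, hz.2⟩) rfl
  have hratio : HasLog K (fun z => (G z - c) / u z) := by
    refine ⟨fun z => log ((G z - c) / u z), ?_, fun z hz => ?_⟩
    · refine ContinuousOn.clog (ContinuousOn.div ?_ hu h0) fun z hz => ?_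
      · have := hGd.continuous; fun_prop
      · refine ball_one_subset_slitPlane ?_
        rw [mem_ball, dist_eq_norm, div_sub_one (h0 z hz), norm_div,
          div_lt_one (norm_pos_iff.2 (h0 z hz))]
        exact hclose z hz
    · refine exp_log (div_ne_zero (fun h => ?_) (h0 z hz))
      have := hclose z hz
      rw [h, zero_sub, norm_neg] at this
      exact lt_irrefl _ this
  refine (hL.mul hratio.inv).congr fun z hz => ?_
  have h1 : G z - c ≠ 0 := fun h => by
    have := hclose z hz
    rw [h, zero_sub, norm_neg] at this
    exact lt_irrefl _ this
  have := h0 z hz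
  field_simp

theorem hasLog_domain {Ω : Set ℂ} (ho : IsOpen Ω) (hb : Bornology.IsBounded Ω)
    (hcn : IsPreconnected Ω) (hc : IsPreconnected Ωᶜ) {u : ℂ → ℂ}
    (hu : ContinuousOn u Ω) (h0 : ∀ z ∈ Ω, u z ≠ 0) : HasLog Ω u := by
  rcases Ω.eq_empty_or_nonempty with rfl | ⟨z0, hz0⟩
  · exact ⟨0, by simp⟩
  have hCne : (Ωᶜ).Nonempty := by
    by_contra h
    rw [not_nonempty_iff_eq_empty, compl_empty_iff] at h
    rw [h] at hb
    exact NormedSpace.unbounded_univ ℝ ℂ hb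
  have hCcl : IsClosed Ωᶜ := ho.isClosed_compl
  have hpos : ∀ z, z ∈ Ω ↔ 0 < infDist z Ωᶜ := fun z => by
    rw [← hCcl.notMem_iff_infDist_pos hCne]; simp
  set K : ℕ → Set ℂ := fun n => {z | 1 / ((n:ℝ) + 1) ≤ infDist z Ωᶜ} with hK
  set P : ℕ → Set ℂ := fun n => {z | 1 / ((n:ℝ) + 1) < infDist z Ωᶜ} with hP
  have hd : ∀ n : ℕ, (0:ℝ) < 1 / ((n:ℝ) + 1) := fun n => Nat.one_div_pos_of_nat
  have hKΩ : ∀ n, K n ⊆ Ω := fun n z hz => (hpos z).2 ((hd n).trans_le hz)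
  have hPo : ∀ n, IsOpen (P n) := fun n => isOpen_lt continuous_const (continuous_infDist_pt _)
  have hPK : ∀ n, P n ⊆ K n := fun n z hz => (show 1 / ((n:ℝ) + 1) < infDist z Ωᶜ from hz).le
  have hKc : ∀ n, IsCompact (K n) := fun n =>
    Metric.isCompact_of_isClosed_isBounded
      (isClosed_le continuous_const (continuous_infDist_pt _)) (hb.subset (hKΩ n))
  have hKcc : ∀ n, IsPreconnected (K n)ᶜ := fun n => by
    have : (K n)ᶜ = ⋃₀ {s | ∃ c ∈ Ωᶜ, s = Ωᶜ ∪ ball c (1 / ((n:ℝ) + 1))} := by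
      ext z
      simp only [hK, mem_compl_iff, mem_setOf_eq, not_le, mem_sUnion]
      rw [infDist_lt_iff hCne]
      constructor
      · rintro ⟨c, hc, hcz⟩
        exact ⟨_, ⟨c, hc, rfl⟩, Or.inr hcz⟩
      · rintro ⟨_, ⟨c, hc, rfl⟩, h | h⟩
        · exact ⟨z, h, by rw [dist_self]; exact hd n⟩
        · exact ⟨c, hc, h⟩
    rw [this]
    obtain ⟨c0, hc0⟩ := hCne
    refine isPreconnected_sUnion c0 _ ?_ ?_
    · rintro _ ⟨c, _, rfl⟩; exact Or.inl hc0
    · rintro _ ⟨c, hcc, rfl⟩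
      exact hc.union c hcc (mem_ball_self (hd n)) (convex_ball _ _).isPreconnected
  have hlog : ∀ n, ∃ φ : ℂ → ℂ, ContinuousOn φ (K n) ∧ (∀ z ∈ K n, exp (φ z) = u z) ∧
      φ z0 = log (u z0) := fun n => by
    obtain ⟨φ, h1, h2⟩ := borsuk (hKc n) (hKcc n) (hu.mono (hKΩ n)) (fun z hz => h0 z (hKΩ n hz))
    by_cases h : z0 ∈ K n
    · refine ⟨fun z => φ z + (log (u z0) - φ z0), h1.add continuousOn_const, fun z hz => ?_, by ring⟩
      rw [exp_add, h2 z hz, exp_sub, exp_log (h0 z0 hz0), h2 z0 h, div_self (h0 z0 hz0), mul_one]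
    · classical
      refine ⟨Function.update φ z0 (log (u z0)), h1.congr fun z hz => ?_, fun z hz => ?_, by simp⟩
      · rw [Function.update_of_ne]; rintro rfl; exact h hz
      · rw [Function.update_of_ne]
        · exact h2 z hz
        · rintro rfl; exact h hz
  choose φ hφ1 hφ2 hφ3 using hlog
  set O : ℕ → Set ℂ := fun n => connectedComponentIn (P n) z0 with hO
  have hOo : ∀ n, IsOpen (O n) := fun n => (hPo n).connectedComponentIn
  have hOP : ∀ n, O n ⊆ P n := fun n => connectedComponentIn_subset _ _
  have hmono : ∀ n m, n ≤ m → O n ⊆ O m := fun n m h => by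
    refine connectedComponentIn_mono _ fun z hz => ?_
    refine lt_of_le_of_lt ?_ (show 1 / ((n:ℝ) + 1) < infDist z Ωᶜ from hz)
    exact Nat.one_div_le_one_div h
  have hz0O : ∀ n z, z ∈ O n → z0 ∈ O n := fun n z hz =>
    mem_connectedComponentIn (connectedComponentIn_nonempty_iff.1 ⟨z, hz⟩)
  have heq : ∀ n m z, n ≤ m → z ∈ O n → φ n z = φ m z := fun n m z h hz => by
    refine log_unique (K := O n) isPreconnected_connectedComponentIn
      ((hφ1 n).mono ((hOP n).trans (hPK n)))
      ((hφ1 m).mono ((hmono n m h).trans ((hOP m).trans (hPK m)))) (fun y hy => ?_)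
      (hz0O n z hz) ?_ hz
    · rw [hφ2 n y (hPK n (hOP n hy)), hφ2 m y (hPK m (hOP m (hmono n m h hy)))]
    · rw [hφ3, hφ3]
  have heq' : ∀ n m z, z ∈ O n → z ∈ O m → φ n z = φ m z := fun n m z h h' => by
    rcases le_total n m with hnm | hnm
    · exact heq n m z hnm h
    · exact (heq m n z hnm h').symm
  have hcov : ∀ z ∈ Ω, ∃ n, z ∈ O n := fun z hz => by
    have hpc : IsPathConnected Ω := ho.isConnected_iff_isPathConnected.1 ⟨⟨z0, hz0⟩, hcn⟩
    obtain ⟨γ, hγ⟩ := hpc.joinedIn z0 hz0 z hz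
    have hcomp : IsCompact (range γ) := isCompact_range γ.continuous
    obtain ⟨y, hy, hmin⟩ := hcomp.exists_isMinOn (range_nonempty γ)
      (continuous_infDist_pt Ωᶜ).continuousOn
    obtain ⟨n, hn⟩ := exists_nat_one_div_lt ((hpos y).1 (by obtain ⟨t, rfl⟩ := hy; exact hγ t))
    refine ⟨n, ?_⟩
    refine (isPreconnected_range γ.continuous).subset_connectedComponentIn ⟨0, by simp⟩
      (fun x hx => lt_of_lt_of_le hn (hmin hx)) ⟨1, by simp⟩
  choose! N hN using hcov
  refine ⟨fun z => φ (N z) z, fun z hz => ?_, fun z hz => hφ2 _ _ (hPK _ (hOP _ (hN z hz)))⟩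
  have hev : (fun z => φ (N z) z) =ᶠ[𝓝[Ω] z] φ (N z) := by
    filter_upwards [mem_nhdsWithin_of_mem_nhds ((hOo (N z)).mem_nhds (hN z hz)), self_mem_nhdsWithin]
      with y hy hy2
    exact heq' _ _ _ (hN y hy2) hy
  refine ContinuousWithinAt.congr_of_eventuallyEq ?_ hev rfl
  exact (((hφ1 (N z)).mono ((hOP _).trans (hPK _))).continuousAt
    ((hOo _).mem_nhds (hN z hz))).continuousWithinAt

theorem log_holo {Ω : Set ℂ} (ho : IsOpen Ω) {φ g : ℂ → ℂ} (hφ : ContinuousOn φ Ω)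
    (hg : DifferentiableOn ℂ g Ω) (he : ∀ z ∈ Ω, exp (φ z) = g z) : DifferentiableOn ℂ φ Ω := by
  intro z hz
  refine DifferentiableAt.differentiableWithinAt ?_
  have hgz : g z ≠ 0 := by rw [← he z hz]; exact exp_ne_zero _
  have hc : ContinuousAt φ z := hφ.continuousAt (ho.mem_nhds hz)
  have hev : φ =ᶠ[𝓝 z] fun y => φ z + log (g y / g z) := by
    have h1 : ∀ᶠ y in 𝓝 z, ‖φ y - φ z‖ < Real.pi := by
      have := hc.eventually (Metric.ball_mem_nhds _ Real.pi_pos)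
      filter_upwards [this] with y hy
      rwa [dist_eq_norm] at hy
    filter_upwards [h1, ho.mem_nhds hz] with y hy hyΩ
    have him : |(φ y - φ z).im| < Real.pi := (abs_im_le_norm _).trans_lt hy
    rw [abs_lt] at him
    rw [← he y hyΩ, ← he z hz, ← exp_sub, log_exp him.1 him.2.le]; ring
  refine DifferentiableAt.congr_of_eventuallyEq ?_ hev
  have hgd : DifferentiableAt ℂ g z := (hg z hz).differentiableAt (ho.mem_nhds hz)
  refine (differentiableAt_const _).add (DifferentiableAt.clog (hgd.div_const _) ?_)
  rw [div_self hgz]; exact one_mem_slitPlane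

theorem inv_holo {Ω : Set ℂ} (ho : IsOpen Ω) (hcn : IsPreconnected Ω) {F f : ℂ → ℂ}
    (hF : DifferentiableOn ℂ F Ω) (hi : InjOn F Ω) (hf : ∀ z ∈ Ω, f (F z) = z) :
    IsOpen (F '' Ω) ∧ DifferentiableOn ℂ f (F '' Ω) := by
  have hA : AnalyticOnNhd ℂ F Ω := hF.analyticOnNhd ho
  have hopen : ∀ s ⊆ Ω, IsOpen s → IsOpen (F '' s) := by
    rcases hA.is_constant_or_isOpen hcn with ⟨w, hw⟩ | h
    · intro s hs hso
      rcases s.eq_empty_or_nonempty with rfl | ⟨z, hz⟩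
      · simp
      · exfalso
        have : (𝓝[≠] z).NeBot := inferInstance
        obtain ⟨y, hy, hyz⟩ : ∃ y ∈ s, y ≠ z := by
          have : s ∈ 𝓝[≠] z := mem_nhdsWithin_of_mem_nhds (hso.mem_nhds hz)
          obtain ⟨y, hy⟩ := Filter.nonempty_of_mem (inter_mem this self_mem_nhdsWithin)
          exact ⟨y, hy.1, hy.2⟩
        exact hyz (hi (hs hy) (hs hz) ((hw y (hs hy)).trans (hw z (hs hz)).symm))
    · exact h
  refine ⟨hopen Ω subset_rfl ho, ?_⟩
  have hfc : ∀ z ∈ Ω, ContinuousAt f (F z) := fun z hz => by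
    rw [ContinuousAt, hf z hz]
    intro s hs
    obtain ⟨t, hts, hto, hzt⟩ := _root_.mem_nhds_iff.1 (inter_mem hs (ho.mem_nhds hz))
    have hn : F '' t ∈ 𝓝 (F z) := (hopen t (fun y hy => (hts hy).2) hto).mem_nhds ⟨z, hzt, rfl⟩
    refine mem_map.2 (mem_of_superset hn ?_)
    rintro _ ⟨y, hy, rfl⟩
    rw [mem_preimage, hf y (hts hy).2]; exact (hts hy).1
  have hreg : ∀ z ∈ Ω, deriv F z ≠ 0 → DifferentiableAt ℂ f (F z) := fun z hz hd => by
    have hFd : HasDerivAt F (deriv F z) (f (F z)) := by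
      rw [hf z hz]; exact ((hF z hz).differentiableAt (ho.mem_nhds hz)).hasDerivAt
    refine (HasDerivAt.of_local_left_inverse (hfc z hz) hFd hd ?_).differentiableAt
    filter_upwards [(hopen Ω subset_rfl ho).mem_nhds ⟨z, hz, rfl⟩]
    rintro _ ⟨y, hy, rfl⟩
    rw [hf y hy]
  rintro _ ⟨z, hz, rfl⟩
  refine DifferentiableAt.differentiableWithinAt ?_
  have hd : AnalyticOnNhd ℂ (deriv F) Ω := hA.deriv
  rcases (hd z hz).eventually_eq_zero_or_eventually_ne_zero with h | h
  · exfalso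
    obtain ⟨r, hr, hrs⟩ := Metric.mem_nhds_iff.1 (inter_mem h (ho.mem_nhds hz))
    have key := (convex_ball z r).norm_image_sub_le_of_norm_deriv_le (f := F) (C := 0)
      (fun x hx => (hF x (hrs hx).2).differentiableAt (ho.mem_nhds (hrs hx).2))
      (fun x hx => by rw [(hrs hx).1]; simp)
      (x := z) (y := z + (r / 2 : ℝ)) (mem_ball_self hr)
      (by simp [abs_of_pos hr]; linarith)
    rw [zero_mul, norm_le_zero_iff, sub_eq_zero] at key
    have := hi (hrs (by simp [abs_of_pos hr]; linarith : z + (r / 2 : ℝ) ∈ ball z r)).2 hz key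
    simp at this
    exact hr.ne' this
  · rw [eventually_nhdsWithin_iff] at h
    obtain ⟨t, hts, hto, hzt⟩ := _root_.mem_nhds_iff.1 (inter_mem h (ho.mem_nhds hz))
    have hn : F '' t ∈ 𝓝 (F z) := (hopen t (fun y hy => (hts hy).2) hto).mem_nhds ⟨z, hzt, rfl⟩
    refine ((differentiableOn_compl_singleton_and_continuousAt_iff hn).1 ⟨?_, hfc z hz⟩).differentiableAt hn
    rintro _ ⟨⟨y, hy, rfl⟩, hne⟩
    refine (hreg y (hts hy).2 ((hts hy).1 ?_)).differentiableWithinAt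
    rintro rfl; exact hne rfl

theorem montel {Ω : Set ℂ} (ho : IsOpen Ω) {f : ℕ → ℂ → ℂ} (hd : ∀ n, DifferentiableOn ℂ (f n) Ω)
    (hb : ∀ n, ∀ z ∈ Ω, ‖f n z‖ ≤ 1) :
    ∃ F : ℂ → ℂ, TendstoLocallyUniformlyOn f F (hyperfilter ℕ : Filter ℕ) Ω := by
  have hlim : ∀ z ∈ Ω, ∃ w, Tendsto (fun n => f n z) (hyperfilter ℕ : Filter ℕ) (𝓝 w) := fun z hz => by
    have hc := isCompact_closedBall (0:ℂ) 1
    obtain ⟨w, -, hw⟩ := hc.ultrafilter_le_nhds ((hyperfilter ℕ).map fun n => f n z) (by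
      rw [le_principal_iff]
      refine mem_map.2 (Eventually.of_forall fun n => ?_)
      simpa using hb n z hz)
    exact ⟨w, hw⟩
  choose! F hF using hlim
  refine ⟨F, ?_⟩
  rw [Metric.tendstoLocallyUniformlyOn_iff]
  intro ε hε z hz
  obtain ⟨r, hr, hrs⟩ := Metric.nhds_basis_closedBall.mem_iff.1 (ho.mem_nhds hz)
  have hlip : ∀ n, ∀ y ∈ ball z (r / 2), ‖f n y - f n z‖ ≤ (2 / r) * ‖y - z‖ := fun n y hy => by
    have hsub : ∀ x ∈ ball z (r / 2), closedBall x (r / 2) ⊆ Ω := fun x hx =>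
      (closedBall_subset_closedBall' (by rw [mem_ball] at hx; linarith)).trans hrs
    refine (convex_ball z (r / 2)).norm_image_sub_le_of_norm_deriv_le
      (fun x hx => ?_) (fun x hx => ?_) (mem_ball_self (half_pos hr)) hy
    · have hx' := hsub x hx (mem_closedBall_self (half_pos hr).le)
      exact (hd n x hx').differentiableAt (ho.mem_nhds hx')
    · have := norm_deriv_le_of_forall_mem_sphere_norm_le (f := f n) (c := x) (half_pos hr)
        (((hd n).mono (hsub x hx)).diffContOnCl_ball subset_rfl)
        (C := 1) (fun y hy => hb n y (hsub x hx (sphere_subset_closedBall hy)))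
      calc _ ≤ _ := this
        _ = _ := by rw [one_div_div]
  set δ := min (r / 2) (r * ε / 8) with hδ
  have hδp : 0 < δ := lt_min (half_pos hr) (by positivity)
  have hyy : ∀ y ∈ ball z δ, (2 / r) * ‖y - z‖ ≤ ε / 4 := fun y hy => by
    rw [mem_ball, dist_eq_norm] at hy
    have : ‖y - z‖ ≤ r * ε / 8 := hy.le.trans (min_le_right _ _)
    calc (2 / r) * ‖y - z‖ ≤ (2 / r) * (r * ε / 8) := by gcongr
      _ = ε / 4 := by field_simp; ring
  refine ⟨ball z δ, mem_nhdsWithin_of_mem_nhds (ball_mem_nhds z hδp), ?_⟩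
  have h1 : ∀ᶠ n in (hyperfilter ℕ : Filter ℕ), dist (f n z) (F z) < ε / 4 :=
    (hF z hz).eventually (ball_mem_nhds _ (by positivity))
  filter_upwards [h1] with n hn y hy
  have hyb : y ∈ ball z (r / 2) := ball_subset_ball (min_le_left _ _) hy
  have hyΩ : y ∈ Ω := hrs (ball_subset_closedBall (ball_subset_ball (by linarith) hyb))
  have h2 : ‖F y - F z‖ ≤ ε / 4 := by
    refine le_of_tendsto ((hF y hyΩ).sub (hF z hz)).norm (Eventually.of_forall fun n => ?_)
    exact (hlip n y hyb).trans (hyy y hy)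
  have h3 := (hlip n y hyb).trans (hyy y hy)
  rw [dist_eq_norm] at hn ⊢
  calc ‖F y - f n y‖ = ‖(F y - F z) - (f n y - f n z) - (f n z - F z)‖ := by ring_nf
    _ ≤ ‖(F y - F z) - (f n y - f n z)‖ + ‖f n z - F z‖ := norm_sub_le _ _
    _ ≤ ‖F y - F z‖ + ‖f n y - f n z‖ + ‖f n z - F z‖ := by gcongr; exact norm_sub_le _ _
    _ < ε := by linarith

theorem hurwitz {Ω : Set ℂ} (ho : IsOpen Ω) (hcn : IsPreconnected Ω) {ι : Type*} {l : Filter ι} [l.NeBot]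
    {f : ι → ℂ → ℂ} {F : ℂ → ℂ} (hd : ∀ n, DifferentiableOn ℂ (f n) Ω) (hi : ∀ n, InjOn (f n) Ω)
    (hl : TendstoLocallyUniformlyOn f F l Ω) {z0 : ℂ} (hz0 : z0 ∈ Ω) (hF0 : deriv F z0 ≠ 0) :
    InjOn F Ω := by
  intro a ha b hb hab
  by_contra hne
  have hFd : DifferentiableOn ℂ F Ω := hl.differentiableOn (Eventually.of_forall hd) ho
  have hA : AnalyticOnNhd ℂ F Ω := hFd.analyticOnNhd ho
  have hev : ∀ᶠ z in 𝓝[≠] b, F z - F a ≠ 0 := by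
    rcases ((hA b hb).sub analyticAt_const).eventually_eq_zero_or_eventually_ne_zero (z₀ := b)
      (f := fun z => F z - F a) with h | h
    · exfalso
      have h2 : EqOn F (fun _ => F a) Ω := hA.eqOn_of_preconnected_of_eventuallyEq
        analyticOnNhd_const hcn hb (h.mono fun z hz => sub_eq_zero.1 hz)
      refine hF0 ?_
      rw [(h2.eventuallyEq_of_mem (ho.mem_nhds hz0)).deriv_eq]; simp
    · exact h
  rw [eventually_nhdsWithin_iff] at hev
  have hna : ∀ᶠ z in 𝓝 b, z ≠ a := isOpen_ne.mem_nhds (Ne.symm hne)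
  obtain ⟨r, hr, hrs⟩ := Metric.nhds_basis_closedBall.mem_iff.1
    (inter_mem (inter_mem hev hna) (ho.mem_nhds hb))
  have hrΩ : closedBall b r ⊆ Ω := fun z hz => (hrs hz).2
  obtain ⟨y, hy, hmin⟩ := (isCompact_sphere b r).exists_isMinOn
    (NormedSpace.sphere_nonempty.2 hr.le) (f := fun z => ‖F z - F a‖)
    (((hFd.continuousOn.mono hrΩ).mono sphere_subset_closedBall).sub continuousOn_const).norm
  set m := ‖F y - F a‖ with hm
  have hmp : 0 < m := norm_pos_iff.2 ((hrs (sphere_subset_closedBall hy)).1.1 (by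
    rintro rfl; simp at hy; exact hr.ne hy))
  have hu := (tendstoLocallyUniformlyOn_iff_forall_isCompact ho).1 hl (closedBall b r ∪ {a})
    (union_subset hrΩ (singleton_subset_iff.2 ha))
    ((isCompact_closedBall b r).union isCompact_singleton)
  rw [Metric.tendstoUniformlyOn_iff] at hu
  obtain ⟨n, hn⟩ := (hu (m / 8) (by positivity)).exists
  have hna' := hn a (Or.inr rfl)
  have hnb := hn b (Or.inl (mem_closedBall_self hr.le))
  rw [dist_eq_norm] at hna' hnb
  have hsp : ∀ z ∈ sphere b r, m / 2 ≤ ‖f n z - f n b‖ := fun z hz => by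
    have h1 := hn z (Or.inl (sphere_subset_closedBall hz))
    rw [dist_eq_norm] at h1
    have h2 : m ≤ ‖F z - F a‖ := hmin hz
    rw [hab] at h2
    have : ‖F z - F b‖ ≤ ‖F z - f n z‖ + ‖f n z - f n b‖ + ‖F b - f n b‖ := by
      calc ‖F z - F b‖ = ‖(F z - f n z) + (f n z - f n b) - (F b - f n b)‖ := by ring_nf
        _ ≤ ‖(F z - f n z) + (f n z - f n b)‖ + _ := norm_sub_le _ _
        _ ≤ _ := by gcongr; exact norm_add_le _ _
    linarith
  have hba := (((hd n).mono hrΩ).diffContOnCl_ball subset_rfl).ball_subset_image_closedBall hr hsp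
    (by
      have h3' : ∀ᶠ z in 𝓝[≠] b, z ∈ Ω := mem_nhdsWithin_of_mem_nhds (ho.mem_nhds hb)
      have h3 := h3'.frequently
      have h4 : ∀ᶠ z in 𝓝[≠] b, z ≠ b := self_mem_nhdsWithin
      have h5 := (h3.and_eventually h4).filter_mono nhdsWithin_le_nhds
      exact h5.mono fun z hz h => hz.2 (hi n hz.1 hb h))
  have hmem : f n a ∈ ball (f n b) (m / 2 / 2) := by
    rw [mem_ball, dist_eq_norm]
    calc ‖f n a - f n b‖ = ‖(F b - f n b) - (F a - f n a)‖ := by rw [hab]; ring_nf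
      _ ≤ _ := norm_sub_le _ _
      _ < _ := by linarith
  obtain ⟨x, hx, hxe⟩ := hba hmem
  exact (hrs hx).1.2 (hi n (hrΩ hx) ha hxe)

noncomputable def mob (w z : ℂ) : ℂ := (z - w) / (1 - (starRingEnd ℂ) w * z)

theorem mob_den {w z : ℂ} (hw : ‖w‖ < 1) (hz : ‖z‖ < 1) : 1 - (starRingEnd ℂ) w * z ≠ 0 := by
  intro h
  have h1 : ‖(starRingEnd ℂ) w * z‖ = 1 := by rw [← sub_eq_zero.1 h]; simp
  rw [norm_mul, Complex.norm_conj] at h1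
  nlinarith [norm_nonneg w, norm_nonneg z]

theorem mob_lt {w z : ℂ} (hw : ‖w‖ < 1) (hz : ‖z‖ < 1) : ‖mob w z‖ < 1 := by
  have h0 := norm_pos_iff.2 (mob_den hw hz)
  rw [mob, norm_div, div_lt_one h0]
  refine lt_of_pow_lt_pow_left₀ 2 h0.le ?_
  have e : ‖1 - (starRingEnd ℂ) w * z‖ ^ 2 - ‖z - w‖ ^ 2 = (1 - ‖z‖ ^ 2) * (1 - ‖w‖ ^ 2) := by
    simp only [Complex.sq_norm, normSq_apply]; simp; ring
  have : 0 < (1 - ‖z‖ ^ 2) * (1 - ‖w‖ ^ 2) := by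
    apply mul_pos <;> nlinarith [norm_nonneg w, norm_nonneg z]
  linarith

theorem conj_mul_ne {w : ℂ} (hw : ‖w‖ < 1) : 1 - (starRingEnd ℂ) w * w ≠ 0 := mob_den hw hw

theorem mob_inj {w z y : ℂ} (hw : ‖w‖ < 1) (hz : ‖z‖ < 1) (hy : ‖y‖ < 1) (h : mob w z = mob w y) :
    z = y := by
  rw [mob, mob, div_eq_div_iff (mob_den hw hz) (mob_den hw hy)] at h
  have : (z - y) * (1 - (starRingEnd ℂ) w * w) = 0 := by linear_combination h
  exact sub_eq_zero.1 ((mul_eq_zero.1 this).resolve_right (conj_mul_ne hw))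

theorem mob_deriv {w z : ℂ} (hw : ‖w‖ < 1) (hz : ‖z‖ < 1) :
    HasDerivAt (mob w) ((1 - (starRingEnd ℂ) w * w) / (1 - (starRingEnd ℂ) w * z) ^ 2) z := by
  have h1 : HasDerivAt (fun z : ℂ => z - w) 1 z := (hasDerivAt_id z).sub_const w
  have h2 : HasDerivAt (fun z : ℂ => 1 - (starRingEnd ℂ) w * z) (-((starRingEnd ℂ) w * 1)) z :=
    ((hasDerivAt_id z).const_mul _).const_sub 1
  have h3 := h1.div h2 (mob_den hw hz)
  have e : (1 * (1 - (starRingEnd ℂ) w * z) - (z - w) * -((starRingEnd ℂ) w * 1)) =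
    1 - (starRingEnd ℂ) w * w := by ring
  rw [e] at h3; exact h3

theorem rmt {Ω : Set ℂ} (ho : IsOpen Ω) (hb : Bornology.IsBounded Ω) (hcn : IsPreconnected Ω)
    (hc : IsPreconnected Ωᶜ) {z0 : ℂ} (hz0 : z0 ∈ Ω) :
    ∃ F f : ℂ → ℂ, DifferentiableOn ℂ F Ω ∧ DifferentiableOn ℂ f (ball 0 1) ∧
      MapsTo F Ω (ball 0 1) ∧ MapsTo f (ball 0 1) Ω ∧ (∀ z ∈ Ω, f (F z) = z) ∧
      (∀ z ∈ ball (0 : ℂ) 1, F (f z) = z) ∧ F z0 = 0 := by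
  set Fam : Set (ℂ → ℂ) := {f | DifferentiableOn ℂ f Ω ∧ InjOn f Ω ∧ MapsTo f Ω (ball 0 1) ∧ f z0 = 0}
  have hn0 : Ω ∈ 𝓝 z0 := ho.mem_nhds hz0
  obtain ⟨r, hr, hrΩ⟩ := Metric.nhds_basis_closedBall.mem_iff.1 hn0
  obtain ⟨R, hR, hRΩ⟩ := hb.subset_ball_lt 0 z0
  have hmem : (fun z => (z - z0) / R) ∈ Fam := by
    refine ⟨by fun_prop, fun x _ y _ h => ?_, fun x hx => ?_, by simp⟩
    · have hR' : (R : ℂ) ≠ 0 := by exact_mod_cast hR.ne'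
      simpa [div_left_inj' hR'] using h
    · have := hRΩ hx
      rw [mem_ball, dist_eq_norm] at this
      rw [mem_ball_zero_iff, norm_div, norm_real, Real.norm_of_nonneg hR.le, div_lt_one hR]
      exact this
  set S : Set ℝ := (fun f : ℂ → ℂ => ‖deriv f z0‖) '' Fam
  have hbd : BddAbove S := by
    refine ⟨1 / r, ?_⟩
    rintro _ ⟨f, hf, rfl⟩
    refine norm_deriv_le_of_forall_mem_sphere_norm_le hr ((hf.1.mono hrΩ).diffContOnCl_ball subset_rfl) ?_
    exact fun z hz => (mem_ball_zero_iff.1 (hf.2.2.1 (hrΩ (sphere_subset_closedBall hz)))).le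
  have hpos : 0 < sSup S := by
    refine lt_of_lt_of_le ?_ (le_csSup hbd ⟨_, hmem, rfl⟩)
    simp [hR.ne']
  obtain ⟨u, -, hu, hu2⟩ := exists_seq_tendsto_sSup ⟨_, mem_image_of_mem _ hmem⟩ hbd
  choose f hf hfu using hu2
  obtain ⟨F, hF⟩ := montel ho (fun n => (hf n).1)
    (fun n z hz => (mem_ball_zero_iff.1 ((hf n).2.2.1 hz)).le)
  have hFd : DifferentiableOn ℂ F Ω := hF.differentiableOn (Eventually.of_forall fun n => (hf n).1) ho
  have hle : (hyperfilter ℕ : Filter ℕ) ≤ atTop := by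
    rw [← Nat.cofinite_eq_atTop]; exact hyperfilter_le_cofinite
  have hder : ‖deriv F z0‖ = sSup S := by
    have h1 := ((hF.deriv (Eventually.of_forall fun n => (hf n).1) ho).tendsto_at hz0).norm
    refine tendsto_nhds_unique h1 ((hu.mono_left hle).congr fun n => (hfu n).symm)
  have hd0 : deriv F z0 ≠ 0 := by rw [← norm_pos_iff, hder]; exact hpos
  have hinj : InjOn F Ω := hurwitz ho hcn (fun n => (hf n).1) (fun n => (hf n).2.1) hF hz0 hd0
  have hF0 : F z0 = 0 := by
    refine tendsto_nhds_unique (hF.tendsto_at hz0) ?_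
    simp only [(hf _).2.2.2]; exact tendsto_const_nhds
  have hle1 : ∀ z ∈ Ω, ‖F z‖ ≤ 1 := fun z hz =>
    le_of_tendsto (hF.tendsto_at hz).norm (Eventually.of_forall fun n =>
      (mem_ball_zero_iff.1 ((hf n).2.2.1 hz)).le)
  have hopen : IsOpen (F '' Ω) :=
    (inv_holo ho hcn hFd hinj (fun z hz => hinj.leftInvOn_invFunOn hz)).1
  have hball : MapsTo F Ω (ball 0 1) := by
    intro z hz
    have : F '' Ω ⊆ interior (closedBall (0 : ℂ) 1) := interior_maximal
      (by rintro _ ⟨y, hy, rfl⟩; exact mem_closedBall_zero_iff.2 (hle1 y hy)) hopen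
    rw [interior_closedBall _ one_ne_zero] at this
    exact this ⟨z, hz, rfl⟩
  have hmax : ∀ h ∈ Fam, ‖deriv h z0‖ ≤ ‖deriv F z0‖ := fun h hh => by
    rw [hder]; exact le_csSup hbd ⟨h, hh, rfl⟩
  have hsurj : ball (0 : ℂ) 1 ⊆ F '' Ω := by
    intro w hw
    by_contra hwF
    have hw1 := mem_ball_zero_iff.1 hw
    have hFn : ∀ z ∈ Ω, ‖F z‖ < 1 := fun z hz => mem_ball_zero_iff.1 (hball hz)
    set g : ℂ → ℂ := fun z => mob w (F z) with hg
    have hgd : ∀ z ∈ Ω, HasDerivAt g ((1 - (starRingEnd ℂ) w * w) / (1 - (starRingEnd ℂ) w * F z) ^ 2 * deriv F z) z :=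
      fun z hz => (mob_deriv hw1 (hFn z hz)).comp z
        ((hFd z hz).differentiableAt (ho.mem_nhds hz)).hasDerivAt
    have hgD : DifferentiableOn ℂ g Ω := fun z hz => (hgd z hz).differentiableAt.differentiableWithinAt
    have hg0 : ∀ z ∈ Ω, g z ≠ 0 := fun z hz => by
      refine div_ne_zero (fun h => hwF ⟨z, hz, sub_eq_zero.1 h⟩) (mob_den hw1 (hFn z hz))
    obtain ⟨φ, hφ, hφe⟩ := hasLog_domain ho hb hcn hc hgD.continuousOn hg0
    have hφd := log_holo ho hφ hgD hφe
    set q : ℂ → ℂ := fun z => exp (φ z / 2) with hq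
    have hqq : ∀ z ∈ Ω, q z * q z = g z := fun z hz => by
      rw [hq, ← hφe z hz]; simp only [← exp_add]; congr 1; ring
    have hqn : ∀ z ∈ Ω, ‖q z‖ < 1 := fun z hz => by
      have h1 := mob_lt hw1 (hFn z hz)
      have h2 : ‖q z‖ * ‖q z‖ = ‖g z‖ := by rw [← norm_mul, hqq z hz]
      by_contra! h3
      have : (1 : ℝ) ≤ ‖g z‖ := by rw [← h2]; nlinarith
      exact absurd h1 (not_lt.2 this)
    have hqD : ∀ z ∈ Ω, DifferentiableAt ℂ q z := fun z hz =>
      (((hφd z hz).differentiableAt (ho.mem_nhds hz)).div_const 2).cexp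
    have hH : (fun z => mob (q z0) (q z)) ∈ Fam := by
      refine ⟨fun z hz => ?_, fun x hx y hy h => ?_, fun z hz => ?_, by simp [mob]⟩
      · exact (((mob_deriv (hqn z0 hz0) (hqn z hz)).differentiableAt).comp z
          (hqD z hz)).differentiableWithinAt
      · have h1 := mob_inj (hqn z0 hz0) (hqn x hx) (hqn y hy) h
        have h2 : g x = g y := by rw [← hqq x hx, ← hqq y hy, h1]
        exact hinj hx hy (mob_inj hw1 (hFn x hx) (hFn y hy) h2)
      · exact mem_ball_zero_iff.2 (mob_lt (hqn z0 hz0) (hqn z hz))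
    have h1 := hmax _ hH
    have h2 : HasDerivAt (fun z => mob (q z0) (q z)) _ z0 :=
      (mob_deriv (hqn z0 hz0) (hqn z0 hz0)).comp z0 (hqD z0 hz0).hasDerivAt
    rw [h2.deriv] at h1
    have h3 : HasDerivAt g (deriv q z0 * q z0 + q z0 * deriv q z0) z0 := by
      refine ((hqD z0 hz0).hasDerivAt.mul (hqD z0 hz0).hasDerivAt).congr_of_eventuallyEq ?_
      filter_upwards [hn0] with z hz using (hqq z hz).symm
    have h4 := h3.unique (hgd z0 hz0)
    have h5 := hqq z0 hz0
    simp only [hg, hF0, mob] at h5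
    have h5' : q z0 * q z0 = -w := by rw [h5]; simp
    rw [hF0] at h4
    have h4' : 2 * (q z0 * deriv q z0) = (1 - (starRingEnd ℂ) w * w) * deriv F z0 := by
      linear_combination h4
    set s := ‖q z0‖ with hs
    have hs0 : 0 < s := norm_pos_iff.2 (exp_ne_zero _)
    have hs1 : s < 1 := hqn z0 hz0
    have hws : ‖w‖ = s * s := by rw [← norm_neg, ← h5', norm_mul]
    have hcc : ∀ a : ℂ, ‖a‖ < 1 → ‖1 - (starRingEnd ℂ) a * a‖ = 1 - ‖a‖ * ‖a‖ := fun a ha => by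
      rw [← normSq_eq_conj_mul_self, Complex.normSq_eq_norm_sq, ← Complex.ofReal_one, ← Complex.ofReal_sub,
        norm_real, Real.norm_of_nonneg] <;> nlinarith [norm_nonneg a]
    have h6 := congrArg norm h4'
    rw [norm_mul, norm_mul, norm_mul, hcc w hw1, hws, ← hs] at h6
    rw [norm_mul, norm_div, norm_pow, hcc _ (hqn z0 hz0), ← hs] at h1
    have h7 : (0 : ℝ) < 1 - s * s := by nlinarith
    have h8 : (1 - s * s) / (1 - s * s) ^ 2 = (1 - s * s)⁻¹ := by field_simp
    rw [h8, inv_mul_le_iff₀ h7] at h1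
    have h9 : ‖(2 : ℂ)‖ = 2 := by simp
    rw [h9] at h6
    have h10 : 0 < ‖deriv F z0‖ := norm_pos_iff.2 hd0
    have : 2 * (s * ‖deriv q z0‖) ≤ 2 * (s * ((1 - s * s) * ‖deriv F z0‖)) := by gcongr
    rw [h6] at this
    have h11 : 0 < (1 - s * s) * ‖deriv F z0‖ := mul_pos h7 h10
    nlinarith [mul_pos h11 (pow_pos (sub_pos.2 hs1) 2)]
  have himg : F '' Ω = ball 0 1 := subset_antisymm (image_subset_iff.2 hball) hsurj
  have hli : ∀ z ∈ Ω, Function.invFunOn F Ω (F z) = z := fun z hz => hinj.leftInvOn_invFunOn hz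
  refine ⟨F, Function.invFunOn F Ω, hFd, himg ▸ (inv_holo ho hcn hFd hinj hli).2, hball, ?_, hli, ?_, hF0⟩
  · intro z hz
    exact Function.invFunOn_mem (hsurj hz)
  · intro z hz
    exact Function.invFunOn_eq (hsurj hz)

theorem log_iff_out {K : Set ℂ} (hK : IsCompact K) {a : ℂ} (ha : a ∉ K) :
    HasLog K (fun z => z - a) ↔ a ∈ Out K := by
  obtain ⟨R, hR, hKR⟩ := hK.isBounded.subset_ball_lt 0 0
  have hb : ((R + 1 : ℝ) : ℂ) ∈ Out K := far_mem_out hR.le (hKR.trans ball_subset_closedBall) (by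
    rw [norm_real, Real.norm_of_nonneg (by linarith)]; linarith)
  set b : ℂ := ((R + 1 : ℝ) : ℂ) with hbd
  have hlb : HasLog K (fun z => z - b) := by
    refine (hasLog_of_convex (convex_ball (0:ℂ) R) (by fun_prop) fun z hz h => ?_).mono hKR
    rw [sub_eq_zero.1 h, mem_ball_zero_iff, hbd, norm_real, Real.norm_of_nonneg (by linarith)] at hz
    linarith
  have hne : ∀ z ∈ K, z - b ≠ 0 := fun z hz h => hb.1 (sub_eq_zero.1 h ▸ hz)
  constructor
  · intro h
    have h1 := hasLog_iff_comp hK ha hb.1 |>.1 ((h.mul hlb.inv).congr fun z _ => div_eq_mul_inv _ _)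
    exact ⟨ha, by rw [connectedComponentIn_eq h1]; exact hb.2⟩
  · intro h
    have h1 : b ∈ connectedComponentIn Kᶜ a := by rw [← out_eq_comp hK h]; exact hb
    exact (((hasLog_iff_comp hK ha hb.1).2 h1).mul hlb).congr fun z hz =>
      (div_mul_cancel₀ _ (hne z hz)).symm

theorem koebe_aux {m : ℕ} (hm : 0 < m) {h : ℂ → ℂ} {M ε : ℝ} (hd : DifferentiableOn ℂ h (ball 0 1))
    (hM : ∀ z ∈ ball (0:ℂ) 1, ‖h z‖ ≤ M) {l : ℝ → ℂ} (hl : ContinuousOn l (Icc 0 1))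
    (hl1 : ∀ t ∈ Icc (0:ℝ) 1, exp (l t) ∈ ball (0:ℂ) 1) (hε : ∀ t ∈ Icc (0:ℝ) 1, ‖h (exp (l t))‖ ≤ ε)
    (h0 : (l 0).im = 0) (h1 : (l 1).im = Real.pi / m) :
    ‖h 0‖ ^ (2 * (m + 1)) ≤ ε * M ^ (2 * m + 1) := by
  set cj := starRingEnd ℂ
  set δ : ℂ := 2 * Real.pi * I / m with hδ
  have hm0 : (m : ℂ) ≠ 0 := by exact_mod_cast hm.ne'
  have hmδ : m * δ = 2 * Real.pi * I := by rw [hδ]; field_simp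
  have hδre : ∀ k : ℕ, ‖exp (k * δ)‖ = 1 := fun k => by
    rw [show (k : ℂ) * δ = ((k * (2 * Real.pi / m) : ℝ) : ℂ) * I by rw [hδ]; push_cast; ring]
    exact norm_exp_ofReal_mul_I _
  set A : ℕ → ℝ → ℂ := fun k t => exp (l t + k * δ) with hA
  set B : ℕ → ℝ → ℂ := fun k t => exp (cj (l t) + k * δ) with hB
  have hAc : ∀ k, ContinuousOn (A k) (Icc 0 1) := fun k => (hl.add continuousOn_const).cexp
  have hBc : ∀ k, ContinuousOn (B k) (Icc 0 1) := fun k =>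
    ((continuous_conj.comp_continuousOn hl).add continuousOn_const).cexp
  set K : Set ℂ := ⋃ k ∈ Finset.range (m + 1), (A k '' Icc 0 1 ∪ B k '' Icc 0 1) with hKd
  have hK : IsCompact K := Finset.isCompact_biUnion _ fun k _ =>
    (isCompact_Icc.image_of_continuousOn (hAc k)).union (isCompact_Icc.image_of_continuousOn (hBc k))
  have hAK : ∀ k ≤ m, ∀ t ∈ Icc (0:ℝ) 1, A k t ∈ K := fun k hk t ht =>
    mem_biUnion (by simpa [Nat.lt_succ_iff] using hk) (Or.inl ⟨t, ht, rfl⟩)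
  have hBK : ∀ k ≤ m, ∀ t ∈ Icc (0:ℝ) 1, B k t ∈ K := fun k hk t ht =>
    mem_biUnion (by simpa [Nat.lt_succ_iff] using hk) (Or.inr ⟨t, ht, rfl⟩)
  have hKe : ∀ z ∈ K, ∃ k ≤ m, ∃ t ∈ Icc (0:ℝ) 1, z = A k t ∨ z = B k t := by
    intro z hz
    simp only [hKd, mem_iUnion, Finset.mem_range, Nat.lt_succ_iff] at hz
    obtain ⟨k, hk, ⟨t, ht, rfl⟩ | ⟨t, ht, rfl⟩⟩ := hz
    exacts [⟨k, hk, t, ht, Or.inl rfl⟩, ⟨k, hk, t, ht, Or.inr rfl⟩]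
  have hAn : ∀ k t, ‖A k t‖ = ‖exp (l t)‖ := fun k t => by
    rw [hA]; simp only [exp_add, norm_mul, hδre, mul_one]
  have hBn : ∀ k t, ‖B k t‖ = ‖exp (l t)‖ := fun k t => by
    rw [hB]; simp only [exp_add, norm_mul, hδre, mul_one]
    rw [exp_conj, norm_conj]
  have hKb : K ⊆ ball 0 1 := fun z hz => by
    obtain ⟨k, -, t, ht, rfl | rfl⟩ := hKe z hz <;> rw [mem_ball_zero_iff]
    · rw [hAn]; exact mem_ball_zero_iff.1 (hl1 t ht)
    · rw [hBn]; exact mem_ball_zero_iff.1 (hl1 t ht)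
  have h0K : (0:ℂ) ∉ K := fun h => by
    obtain ⟨k, -, t, -, h | h⟩ := hKe 0 h <;> exact (exp_ne_zero _) h.symm
  have z0 : (0:ℝ) ∈ Icc (0:ℝ) 1 := by simp
  have z1 : (1:ℝ) ∈ Icc (0:ℝ) 1 := by simp
  have hinn : (0:ℂ) ∈ Inn K := by
    refine ((inn_out K 0).resolve_left h0K).resolve_right fun ho => ?_
    obtain ⟨φ, hφ, hφe⟩ := (log_iff_out hK h0K).2 ho
    simp only [sub_zero] at hφe
    have ha : ∀ k ≤ m, ∃ c : ℂ, ∀ t ∈ Icc (0:ℝ) 1, φ (A k t) = l t + k * δ + c := fun k hk => by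
      obtain ⟨c, -, hc⟩ := log_unique' isPreconnected_Icc (hφ.comp (hAc k) (hAK k hk))
        (hl.add continuousOn_const) (ψ := fun t => l t + k * δ) fun t ht => hφe _ (hAK k hk t ht)
      exact ⟨c, hc⟩
    have hb : ∀ k ≤ m, ∃ c : ℂ, ∀ t ∈ Icc (0:ℝ) 1, φ (B k t) = cj (l t) + k * δ + c := fun k hk => by
      obtain ⟨c, -, hc⟩ := log_unique' isPreconnected_Icc (hφ.comp (hBc k) (hBK k hk))
        ((continuous_conj.comp_continuousOn hl).add continuousOn_const)
        (ψ := fun t => cj (l t) + k * δ) fun t ht => hφe _ (hBK k hk t ht)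
      exact ⟨c, hc⟩
    choose! a ha using ha
    choose! b hb using hb
    have e0 : cj (l 0) = l 0 := conj_eq_iff_im.2 h0
    have e1 : cj (l 1) + δ = l 1 := by
      apply Complex.ext
      · simp [hδ, cj, div_natCast_re]
      · simp [hδ, cj, h1, div_natCast_im]; ring
    have hab : ∀ k ≤ m, a k = b k := fun k hk => by
      have h2 := ha k hk 0 z0
      have h3 := hb k hk 0 z0
      have : A k 0 = B k 0 := by rw [hA, hB]; simp only [e0]
      rw [this, h3, e0] at h2
      exact (add_left_cancel h2).symm
    have hab' : ∀ k, k + 1 ≤ m → a k = b (k + 1) := fun k hk => by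
      have h2 := ha k (by omega) 1 z1
      have h3 := hb (k + 1) hk 1 z1
      have e : cj (l 1) + ((k + 1 : ℕ) : ℂ) * δ = l 1 + k * δ := by
        push_cast; linear_combination e1
      have : A k 1 = B (k + 1) 1 := by rw [hA, hB]; simp only [e]
      rw [this, h3, e] at h2
      exact (add_left_cancel h2).symm
    have hak : ∀ k ≤ m, a k = a 0 := fun k => by
      induction k with
      | zero => simp
      | succ k ih => intro hk; rw [hab _ hk, ← hab' k hk, ih (by omega)]
    have h2 := ha 0 (by omega) 0 z0
    have h3 := ha m le_rfl 0 z0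
    have : A m 0 = A 0 0 := by
      rw [hA]; simp only [hmδ]; rw [exp_add, exp_two_pi_mul_I]; simp
    rw [this, h2, hak m le_rfl, hmδ] at h3
    have : (2 * Real.pi * I : ℂ) = 0 := by push_cast at h3; linear_combination -h3
    exact two_pi_I_ne_zero this
  set W := connectedComponentIn Kᶜ 0
  obtain ⟨r, hr1, hKr⟩ : ∃ r < 1, K ⊆ closedBall 0 r := by
    obtain ⟨z, hz, hmax⟩ := hK.exists_isMaxOn ⟨_, hAK 0 (by omega) 0 z0⟩ continuous_norm.continuousOn
    exact ⟨‖z‖, mem_ball_zero_iff.1 (hKb hz), fun y hy => mem_closedBall_zero_iff.2 (hmax hy)⟩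
  have hr0 : 0 ≤ r := (norm_nonneg _).trans (mem_closedBall_zero_iff.1 (hKr (hAK 0 (by omega) 0 z0)))
  have hWr : closure W ⊆ ball 0 1 := by
    refine (closure_minimal (fun z hz => ?_) isClosed_closedBall).trans (closedBall_subset_ball hr1)
    by_contra hz2
    exact disj_inn_out (comp_subset_inn hinn hz) (far_mem_out hr0 hKr (by simpa using hz2))
  set H : ℂ → ℂ := fun z => ∏ j ∈ Finset.range (m + 1), (h (exp (j * δ) * z) * cj (h (cj (exp (j * δ) * z))))
  have hrot : ∀ (j : ℕ) z, z ∈ ball (0:ℂ) 1 → exp (j * δ) * z ∈ ball (0:ℂ) 1 := fun j z hz => by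
    rw [mem_ball_zero_iff, norm_mul, hδre, one_mul]; exact mem_ball_zero_iff.1 hz
  have hcb : ∀ z, z ∈ ball (0:ℂ) 1 → cj z ∈ ball (0:ℂ) 1 := fun z hz => by
    rw [mem_ball_zero_iff, norm_conj]; exact mem_ball_zero_iff.1 hz
  have hcd : DifferentiableOn ℂ (cj ∘ h ∘ cj) (ball 0 1) := fun z hz => by
    have h2 := (hd.differentiableAt (isOpen_ball.mem_nhds (hcb z hz))).conj_conj
    rw [conj_conj] at h2
    exact h2.differentiableWithinAt
  have hHd : DifferentiableOn ℂ H (ball 0 1) := by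
    refine DifferentiableOn.fun_finsetProd fun j _ => ?_
    have hm : DifferentiableOn ℂ (fun z => exp (j * δ) * z) (ball 0 1) := by fun_prop
    exact (hd.comp hm (hrot j)).mul (hcd.comp hm (hrot j))
  have hHb : ∀ z ∈ K, ‖H z‖ ≤ ε * M ^ (2 * m + 1) := by
    have hM0 : 0 ≤ M := (norm_nonneg _).trans (hM 0 (by simp))
    intro z hz
    obtain ⟨k, hk, t, ht, hzk⟩ := hKe z hz
    have hε0 : 0 ≤ ε := (norm_nonneg _).trans (hε t ht)
    have hfac : ∀ j ∈ Finset.range (m + 1), ‖h (exp (j * δ) * z) * cj (h (cj (exp (j * δ) * z)))‖ ≤ M * M :=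
      fun j _ => by
        rw [norm_mul, norm_conj]
        exact mul_le_mul (hM _ (hrot _ _ (hKb hz))) (hM _ (hcb _ (hrot _ _ (hKb hz)))) (norm_nonneg _) hM0
    have hmk : ((m - k : ℕ) : ℂ) * δ + k * δ = 2 * Real.pi * I := by
      rw [Nat.cast_sub hk, ← hmδ]; ring
    have hone : ‖h (exp ((m - k : ℕ) * δ) * z) * cj (h (cj (exp ((m - k : ℕ) * δ) * z)))‖ ≤ ε * M := by
      have hzr := hrot (m - k) z (hKb hz)
      rw [norm_mul, norm_conj]
      rcases hzk with rfl | rfl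
      · refine mul_le_mul ?_ (hM _ (hcb _ hzr)) (norm_nonneg _) hε0
        have : exp ((m - k : ℕ) * δ) * A k t = exp (l t) := by
          rw [hA]; simp only
          rw [← exp_add, show ((m - k : ℕ) : ℂ) * δ + (l t + k * δ) = l t + 2 * Real.pi * I by
            rw [← hmk]; ring, exp_add, exp_two_pi_mul_I, mul_one]
        rw [this]; exact hε t ht
      · rw [mul_comm]
        refine mul_le_mul ?_ (hM _ hzr) (norm_nonneg _) hε0
        have : exp ((m - k : ℕ) * δ) * B k t = cj (exp (l t)) := by
          rw [hB]; simp only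
          rw [← exp_add, show ((m - k : ℕ) : ℂ) * δ + (cj (l t) + k * δ) = cj (l t) + 2 * Real.pi * I by
            rw [← hmk]; ring, exp_add, exp_two_pi_mul_I, mul_one, exp_conj]
        rw [this, conj_conj]; exact hε t ht
    have hmem : m - k ∈ Finset.range (m + 1) := by simp
    rw [norm_prod, ← Finset.mul_prod_erase _ _ hmem]
    calc _ ≤ (ε * M) * (M * M) ^ ((Finset.range (m + 1)).erase (m - k)).card := by
          refine mul_le_mul hone ?_ (Finset.prod_nonneg fun _ _ => norm_nonneg _) (by positivity)
          rw [← Finset.prod_const]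
          exact Finset.prod_le_prod (fun _ _ => norm_nonneg _) fun j hj => hfac j (Finset.mem_of_mem_erase hj)
      _ = _ := by rw [Finset.card_erase_of_mem hmem, Finset.card_range]; simp; ring
  have key := norm_le_of_forall_mem_frontier_norm_le (z := 0) hinn.2 (f := H)
    ⟨hHd.mono (subset_closure.trans hWr), hHd.continuousOn.mono hWr⟩
    (fun z hz => hHb z (frontier_comp hK.isClosed 0 hz))
    (subset_closure (mem_connectedComponentIn h0K))
  simpa [H, norm_prod, ← pow_two, ← pow_mul, mul_comm, cj] using key

theorem koebe {m : ℕ} (hm : 0 < m) {h : ℂ → ℂ} {M ε : ℝ} (hd : DifferentiableOn ℂ h (ball 0 1))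
    (hM : ∀ z ∈ ball (0:ℂ) 1, ‖h z‖ ≤ M) {l : ℝ → ℂ} (hl : ContinuousOn l (Icc 0 1))
    (hl1 : ∀ t ∈ Icc (0:ℝ) 1, exp (l t) ∈ ball (0:ℂ) 1) (hε : ∀ t ∈ Icc (0:ℝ) 1, ‖h (exp (l t))‖ ≤ ε)
    (h1 : Real.pi / m ≤ |(l 1).im - (l 0).im|) :
    ‖h 0‖ ^ (2 * (m + 1)) ≤ ε * M ^ (2 * m + 1) := by
  have key : ∀ s ∈ Icc (0:ℝ) 1, ∀ s' ∈ Icc (0:ℝ) 1, (l s').im = (l s).im + Real.pi / m →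
      ‖h 0‖ ^ (2 * (m + 1)) ≤ ε * M ^ (2 * m + 1) := by
    intro s hs s' hs' he
    set u := exp ((l s).im * I) with hu
    have hu1 : ‖u‖ = 1 := norm_exp_ofReal_mul_I _
    have hub : ∀ z ∈ ball (0:ℂ) 1, u * z ∈ ball (0:ℂ) 1 := fun z hz => by
      rw [mem_ball_zero_iff, norm_mul, hu1, one_mul]; exact mem_ball_zero_iff.1 hz
    have hex : ∀ x, u * exp (x - (l s).im * I) = exp x := fun x => by
      rw [hu, ← exp_add]; congr 1; ring
    have hm : ∀ t ∈ Icc (0:ℝ) 1, s + t * (s' - s) ∈ Icc (0:ℝ) 1 := fun t ht =>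
      ⟨by nlinarith [ht.1, ht.2, hs.1, hs'.1], by nlinarith [ht.1, ht.2, hs.2, hs'.2]⟩
    have := koebe_aux (h := fun z => h (u * z)) (M := M) (ε := ε) ‹_›
      (hd.comp (by fun_prop : DifferentiableOn ℂ (fun z => u * z) (ball 0 1)) hub)
      (fun z hz => hM _ (hub z hz)) (l := fun t => l (s + t * (s' - s)) - (l s).im * I)
      ((hl.comp (by fun_prop) hm).sub continuousOn_const)
      (fun t ht => ?_) (fun t ht => by rw [hex]; exact hε _ (hm t ht)) (by simp) (by simp [he])
    · simpa using this
    · rw [exp_sub, mem_ball_zero_iff, norm_div, norm_exp_ofReal_mul_I, div_one]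
      exact mem_ball_zero_iff.1 (hl1 _ (hm t ht))
  have hc : ContinuousOn (fun t => (l t).im) (Icc 0 1) := continuous_im.comp_continuousOn hl
  have z0 : (0:ℝ) ∈ Icc (0:ℝ) 1 := by simp
  have z1 : (1:ℝ) ∈ Icc (0:ℝ) 1 := by simp
  have hp : 0 ≤ Real.pi / m := by positivity
  have hiv : ∀ y ∈ uIcc (l 0).im (l 1).im, ∃ t ∈ Icc (0:ℝ) 1, (l t).im = y := fun y hy => by
    obtain ⟨t, ht, e⟩ := intermediate_value_uIcc (f := fun t => (l t).im) (a := 0) (b := 1) (by rwa [uIcc_of_le zero_le_one]) hy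
    rw [uIcc_of_le zero_le_one] at ht
    exact ⟨t, ht, e⟩
  rcases le_total (l 0).im (l 1).im with h2 | h2
  · rw [abs_of_nonneg (by linarith)] at h1
    obtain ⟨t, ht, e⟩ := hiv ((l 0).im + Real.pi / m) (by rw [uIcc_of_le h2]; constructor <;> linarith)
    exact key 0 z0 t ht e
  · rw [abs_of_nonpos (by linarith)] at h1
    obtain ⟨t, ht, e⟩ := hiv ((l 1).im + Real.pi / m) (by rw [uIcc_of_ge h2]; constructor <;> linarith)
    exact key 1 z1 t ht e

theorem ee_lip (s t : ℝ) : ‖ee s - ee t‖ ≤ |s - t| := by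
  refine le_trans (le_of_eq ?_) (Real.norm_exp_I_mul_ofReal_sub_one_le (x := s - t))
  rw [ee, ee, show exp (s * I) = exp (t * I) * exp (I * (s - t : ℝ)) by
    rw [← exp_add]; congr 1; push_cast; ring, ← mul_sub_one, norm_mul, norm_exp_ofReal_mul_I, one_mul]

namespace JCurve
variable {γ : ℂ → ℂ} (hγ : JCurve γ) {a : ℂ} (ha : a ∈ Inn (Jor γ))
include hγ

theorem jor_preconn : IsPreconnected (Jor γ) := by
  have : Jor γ = range fun t => γ (ee t) := by
    ext z; constructor
    · rintro ⟨w, hw, rfl⟩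
      obtain ⟨t, -, rfl⟩ := ee_surj hw 0
      exact ⟨t, rfl⟩
    · rintro ⟨t, rfl⟩; exact ⟨_, ee_mem t, rfl⟩
  rw [this]; exact isPreconnected_range hγ.contp

omit hγ in
theorem mem_param {w : ℂ} (hw : w ∈ Jor γ) (s : ℝ) : ∃ t ∈ Ico s (s + 2 * Real.pi), γ (ee t) = w := by
  obtain ⟨z, hz, rfl⟩ := hw
  obtain ⟨t, ht, rfl⟩ := ee_surj hz s
  exact ⟨t, ht, rfl⟩

theorem param_inj {s t u : ℝ} (hs : s ∈ Ico u (u + 2 * Real.pi)) (ht : t ∈ Ico u (u + 2 * Real.pi))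
    (h : γ (ee s) = γ (ee t)) : s = t := ee_inj hs ht (hγ.inj (ee_mem _) (ee_mem _) h)

include ha

theorem comp_closure : closure (connectedComponentIn (Jor γ)ᶜ a) = connectedComponentIn (Jor γ)ᶜ a ∪ Jor γ := by
  obtain ⟨b, hb⟩ := out_nonempty hγ.isCompact
  refine Subset.antisymm ?_ (union_subset subset_closure
    (hγ.subset_closure_comp ha.1 hb.1 fun h => disj_inn_out (comp_subset_inn ha h) hb))
  rw [closure_eq_self_union_frontier]
  exact union_subset_union_right _ (frontier_comp hγ.isCompact.isClosed a)

theorem comp_compl : IsPreconnected (connectedComponentIn (Jor γ)ᶜ a)ᶜ := by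
  set Ω := connectedComponentIn (Jor γ)ᶜ a
  have hJΩ : Jor γ ⊆ Ωᶜ := fun z hz h => connectedComponentIn_subset _ _ h hz
  have hj : γ 1 ∈ Jor γ := ⟨1, by simp, rfl⟩
  refine isPreconnected_of_forall (γ 1) fun y hy => ?_
  by_cases hyJ : y ∈ Jor γ
  · exact ⟨Jor γ, hJΩ, hj, hyJ, hγ.jor_preconn⟩
  refine ⟨connectedComponentIn (Jor γ)ᶜ y ∪ Jor γ, union_subset (fun z hz h => hy ?_) hJΩ, Or.inr hj,
    Or.inl (mem_connectedComponentIn hyJ), ?_⟩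
  · have h1 := connectedComponentIn_eq hz
    have h2 := connectedComponentIn_eq h
    show y ∈ connectedComponentIn (Jor γ)ᶜ a
    exact (h2.trans h1.symm) ▸ mem_connectedComponentIn hyJ
  · refine isPreconnected_connectedComponentIn.subset_closure subset_union_left
      (union_subset subset_closure (hγ.subset_closure_comp hyJ ha.1 fun h => hy ?_))
    show y ∈ connectedComponentIn (Jor γ)ᶜ a
    exact connectedComponentIn_eq h ▸ mem_connectedComponentIn hyJ

omit ha in
theorem loc_conn {w : ℂ} (hw : w ∈ Jor γ) {ε : ℝ} (hε : 0 < ε) : ∃ δ > 0,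
    ∀ x ∈ connectedComponentIn (Jor γ)ᶜ a ∩ ball w δ, ∀ y ∈ connectedComponentIn (Jor γ)ᶜ a ∩ ball w δ,
      JoinedIn (connectedComponentIn (Jor γ)ᶜ a ∩ ball w ε) x y := by
  obtain ⟨t0, -, rfl⟩ := mem_param hw 0
  obtain ⟨η', hη', hη2⟩ := Metric.continuousAt_iff.1 (hγ.contp.continuousAt (x := t0)) ε hε
  obtain ⟨η, hη, hηη, hηp⟩ : ∃ η > 0, η < η' ∧ η < Real.pi :=
    ⟨min η' Real.pi / 2, by have := Real.pi_pos; positivity,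
      by have := min_le_left η' Real.pi; linarith, by have := min_le_right η' Real.pi; linarith [Real.pi_pos]⟩
  set R := (fun t => γ (ee t)) '' Icc (t0 + η) (t0 + 2 * Real.pi - η) with hR
  have hRc : IsCompact R := isCompact_Icc.image hγ.contp
  have hRJ : R ⊆ Jor γ := by rintro _ ⟨t, -, rfl⟩; exact ⟨_, ee_mem t, rfl⟩
  have hwR : γ (ee t0) ∉ R := by
    rintro ⟨t, ht, e⟩
    have := hγ.param_inj (u := t0) ⟨by linarith [ht.1], by linarith [ht.2]⟩ ⟨le_rfl, by linarith [Real.pi_pos]⟩ e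
    linarith [ht.1]
  have hJR : ∀ z ∈ Jor γ, z ∈ R ∨ z ∈ ball (γ (ee t0)) ε := by
    intro z hz
    obtain ⟨t, ht, rfl⟩ := mem_param hz t0
    by_cases h1 : t < t0 + η
    · right; exact hη2 (by rw [Real.dist_eq, abs_of_nonneg (by linarith [ht.1])]; linarith)
    by_cases h2 : t0 + 2 * Real.pi - η < t
    · right
      have : γ (ee t) = γ (ee (t - 2 * Real.pi)) := by rw [← ee_add_two_pi (t - _)]; ring_nf
      rw [this]
      exact hη2 (by rw [Real.dist_eq, abs_of_nonpos (by linarith [ht.2])]; linarith)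
    · left; exact ⟨t, ⟨by linarith, by linarith⟩, rfl⟩
  obtain ⟨δ', hδ', hδR⟩ := Metric.isOpen_iff.1 hRc.isClosed.isOpen_compl _ hwR
  set w := γ (ee t0)
  have hmn : min δ' ε ≤ ε := min_le_right _ _
  refine ⟨min δ' ε, lt_min hδ' hε, fun x hx y hy => ?_⟩
  set Y := sphere w ε ∪ R
  have hY : IsCompact Y := (isCompact_sphere _ _).union hRc
  have hXY : Jor γ ∩ Y = R := by
    refine Subset.antisymm ?_ fun z hz => ⟨hRJ hz, Or.inr hz⟩
    rintro z ⟨hz, h | h⟩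
    · exact (hJR z hz).resolve_right fun h' => (mem_ball.1 h').ne (mem_sphere.1 h)
    · exact h
  have hBY : ball w (min δ' ε) ⊆ Yᶜ := by
    rintro z hz (h | h)
    · exact absurd (mem_sphere.1 h) ((mem_ball.1 hz).trans_le hmn).ne
    · exact hδR (ball_subset_ball (min_le_left _ _) hz) h
  have hnot : ∀ z ∈ connectedComponentIn (Jor γ)ᶜ a ∩ ball w (min δ' ε), z ∉ Jor γ ∪ Y := by
    rintro z ⟨h1, h2⟩ (h | h)
    · exact connectedComponentIn_subset _ _ h1 h
    · exact hBY h2 h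
  have hJ := janiszewski hγ.isCompact hY (hXY ▸ isPreconnected_Icc.image _ hγ.contp.continuousOn)
    (hnot x hx) (hnot y hy) (by rw [← connectedComponentIn_eq hx.1]; exact hy.1)
    (same_comp_of_subset (convex_ball _ _).isPreconnected hBY hx.2 hy.2)
  have hxm : x ∈ connectedComponentIn (Jor γ ∪ Y)ᶜ x := mem_connectedComponentIn (hnot x hx)
  have ho := isOpen_comp (hγ.isCompact.union hY).isClosed x
  have hpc : IsPathConnected (connectedComponentIn (Jor γ ∪ Y)ᶜ x) :=
    (ho.isConnected_iff_isPathConnected).1 ⟨⟨x, hxm⟩, isPreconnected_connectedComponentIn⟩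
  refine (hpc.joinedIn x hxm y hJ).mono fun z hz => ⟨?_, ?_⟩
  · rw [connectedComponentIn_eq hx.1]
    exact connectedComponentIn_mono _ (compl_subset_compl.2 subset_union_left) hz
  · have h1 : connectedComponentIn (Jor γ ∪ Y)ᶜ x ⊆ ball w ε ∪ (closedBall w ε)ᶜ := fun z hz => by
      have h2 := connectedComponentIn_subset _ _ hz
      rcases lt_trichotomy (dist z w) ε with h | h | h
      · exact Or.inl h
      · exact absurd (Or.inr (Or.inl h)) h2
      · exact Or.inr (by simpa using h)
    refine isPreconnected_connectedComponentIn.subset_left_of_subset_union isOpen_ball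
      isClosed_closedBall.isOpen_compl ?_ h1 ⟨x, hxm, ball_subset_ball hmn hx.2⟩ hz
    exact disjoint_compl_right.mono_left ball_subset_closedBall

theorem ext_limit {φ f : ℂ → ℂ} (hφ : ContinuousOn φ (connectedComponentIn (Jor γ)ᶜ a))
    (hf : DifferentiableOn ℂ f (ball 0 1)) (hφb : MapsTo φ (connectedComponentIn (Jor γ)ᶜ a) (ball 0 1))
    (hfb : MapsTo f (ball 0 1) (connectedComponentIn (Jor γ)ᶜ a))
    (hfφ : ∀ z ∈ connectedComponentIn (Jor γ)ᶜ a, f (φ z) = z)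
    {w : ℂ} (hw : w ∈ Jor γ) :
    ∃ ζ ∈ sphere (0:ℂ) 1, Tendsto φ (𝓝[connectedComponentIn (Jor γ)ᶜ a] w) (𝓝 ζ) := by
  set Ω := connectedComponentIn (Jor γ)ᶜ a with hΩ
  have hwcl : w ∈ closure Ω := by rw [hγ.comp_closure ha]; exact Or.inr hw
  have hΩJ : ∀ z ∈ Ω, z ∉ Jor γ := fun z hz => connectedComponentIn_subset _ _ hz
  have hne : (𝓝[Ω] w).NeBot := mem_closure_iff_nhdsWithin_neBot.1 hwcl
  have hev : ∀ᶠ z in 𝓝[Ω] w, z ∈ Ω := self_mem_nhdsWithin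
  have hcb : closedBall (0:ℂ) 1 ∈ map φ (𝓝[Ω] w) := mem_map.2 (by
    filter_upwards [hev] with z hz using ball_subset_closedBall (hφb hz))
  have hsph : ∀ ζ ∈ closedBall (0:ℂ) 1, MapClusterPt ζ (𝓝[Ω] w) φ → ζ ∈ sphere (0:ℂ) 1 := by
    intro ζ hζ hcl
    rw [mem_sphere_zero_iff_norm]
    refine (mem_closedBall_zero_iff.1 hζ).eq_of_not_lt fun hlt => ?_
    have hζb : ζ ∈ ball (0:ℂ) 1 := mem_ball_zero_iff.2 hlt
    have hnw : f ζ ≠ w := fun h => hΩJ _ (hfb hζb) (h ▸ hw)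
    obtain ⟨U, V, hU, hV, hfU, hwV, hd⟩ := t2_separation hnw
    have hc := (hf.differentiableAt (isOpen_ball.mem_nhds hζb)).continuousAt.preimage_mem_nhds (hU.mem_nhds hfU)
    have hV' : ∀ᶠ z in 𝓝[Ω] w, z ∈ V := mem_nhdsWithin_of_mem_nhds (hV.mem_nhds hwV)
    obtain ⟨z, hz, hzV, hzΩ⟩ := ((mapClusterPt_iff_frequently.1 hcl _ hc).and_eventually (hV'.and hev)).exists
    refine disjoint_left.1 hd ?_ hzV
    have := mem_preimage.1 hz
    rwa [hfφ z hzΩ] at this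
  have huniq : ∀ ζ ∈ sphere (0:ℂ) 1, ∀ ζ' ∈ sphere (0:ℂ) 1, MapClusterPt ζ (𝓝[Ω] w) φ →
      MapClusterPt ζ' (𝓝[Ω] w) φ → ζ = ζ' := by
    intro ζ hζ ζ' hζ' hc hc'
    by_contra hn
    have hd : 0 < ‖ζ - ζ'‖ := norm_pos_iff.2 (sub_ne_zero.2 hn)
    rw [mem_sphere_zero_iff_norm] at hζ hζ'
    have hz0 : ζ ≠ 0 := norm_pos_iff.1 (by rw [hζ]; norm_num)
    have hz0' : ζ' ≠ 0 := norm_pos_iff.1 (by rw [hζ']; norm_num)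
    have hcont : ContinuousAt (fun p : ℂ × ℂ => ‖p.1 / ‖p.1‖ - p.2 / ‖p.2‖‖) (ζ, ζ') := by
      have e1 : ((‖ζ‖ : ℝ) : ℂ) ≠ 0 := by simpa using hz0
      have e2 : ((‖ζ'‖ : ℝ) : ℂ) ≠ 0 := by simpa using hz0'
      fun_prop (disch := assumption)
    have hnear := hcont.eventually (lt_mem_nhds (b := ‖ζ / ‖ζ‖ - ζ' / ‖ζ'‖‖) (a := ‖ζ - ζ'‖ / 2)
      (by rw [hζ, hζ']; simp; exact sub_ne_zero.2 hn))
    rw [nhds_prod_eq, eventually_prod_iff] at hnear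
    obtain ⟨P, hP, Q, hQ, hPQ⟩ := hnear
    obtain ⟨m, hm⟩ := exists_nat_gt (Real.pi / (‖ζ - ζ'‖ / 2))
    have hm0 : 0 < m := by
      have : 0 < (m : ℝ) := lt_trans (by positivity) hm
      exact_mod_cast this
    rw [div_lt_iff₀ (by positivity), mul_comm, ← div_lt_iff₀ (by exact_mod_cast hm0)] at hm
    obtain ⟨M, hM0, hMΩ⟩ := ha.2.subset_ball_lt 0 w
    have hMf : ∀ z ∈ ball (0:ℂ) 1, ‖f z - w‖ ≤ M := fun z hz => by
      rw [← dist_eq_norm]; exact (mem_ball.1 (hMΩ (hfb hz))).le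
    have h0b : (0:ℂ) ∈ ball (0:ℂ) 1 := by simp
    have hh0 : 0 < ‖f 0 - w‖ := norm_pos_iff.2 (sub_ne_zero.2 fun h => hΩJ _ (hfb h0b) (h ▸ hw))
    obtain ⟨ε, hε, hε1, hε2⟩ : ∃ ε > 0, ε < ‖f 0 - w‖ ∧ ε * M ^ (2 * m + 1) < ‖f 0 - w‖ ^ (2 * (m + 1)) := by
      have h1 : ∀ᶠ ε in 𝓝[>] (0:ℝ), ε < ‖f 0 - w‖ := mem_nhdsWithin_of_mem_nhds (gt_mem_nhds hh0)
      have h2 : Tendsto (fun ε : ℝ => ε * M ^ (2 * m + 1)) (𝓝[>] 0) (𝓝 (0 * M ^ (2 * m + 1))) :=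
        ((continuous_mul_const _).tendsto _).mono_left nhdsWithin_le_nhds
      rw [zero_mul] at h2
      obtain ⟨ε, h⟩ := (h1.and ((h2.eventually (gt_mem_nhds (pow_pos hh0 (2 * (m + 1))))).and
        self_mem_nhdsWithin)).exists
      exact ⟨ε, h.2.2, h.1, h.2.1⟩
    obtain ⟨δ, hδ, hδJ⟩ := hγ.loc_conn (a := a) hw hε
    have hball : ∀ᶠ z in 𝓝[Ω] w, z ∈ ball w δ := mem_nhdsWithin_of_mem_nhds (ball_mem_nhds _ hδ)
    obtain ⟨x, hx1, hx2, hx3⟩ := ((mapClusterPt_iff_frequently.1 hc _ hP).and_eventually (hball.and hev)).exists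
    obtain ⟨y, hy1, hy2, hy3⟩ := ((mapClusterPt_iff_frequently.1 hc' _ hQ).and_eventually (hball.and hev)).exists
    have hj := hδJ x ⟨hx3, hx2⟩ y ⟨hy3, hy2⟩
    set p := hj.somePath
    have hp : ∀ t, p.extend t ∈ Ω ∩ ball w ε := fun t => hj.somePath_mem _
    have hcc : Continuous fun t => φ (p.extend t) :=
      hφ.comp_continuous p.continuous_extend fun t => (hp t).1
    have hc0 : ∀ t, φ (p.extend t) ≠ 0 := fun t h => by
      have h1 := hfφ _ (hp t).1
      rw [h] at h1
      have h2 := mem_ball.1 (hp t).2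
      rw [← h1, dist_eq_norm] at h2
      linarith
    obtain ⟨l, hl, hle⟩ := hasLog_of_convex (convex_Icc (0:ℝ) 1) hcc.continuousOn fun t _ => hc0 t
    simp only at hle
    have key := koebe (m := m) (ε := ε) hm0 (hf.sub_const w) hMf hl
      (fun t ht => by rw [hle t ht]; exact hφb (hp t).1)
      (fun t ht => by
        rw [hle t ht]; simp only [hfφ _ (hp t).1]
        rw [← dist_eq_norm]; exact (mem_ball.1 (hp t).2).le) ?_
    · linarith
    have hu : ∀ t ∈ Icc (0:ℝ) 1, φ (p.extend t) / ‖φ (p.extend t)‖ = exp ((l t).im * I) := fun t ht => by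
      have : ((‖φ (p.extend t)‖ : ℝ) : ℂ) ≠ 0 := by simpa using hc0 t
      rw [div_eq_iff this, ← hle t ht, norm_exp, mul_comm, ofReal_exp, ← exp_add, re_add_im]
    have h1 := hPQ hx1 hy1
    have e0 := hu 0 (by simp)
    have e1 := hu 1 (by simp)
    rw [Path.extend_zero] at e0
    rw [Path.extend_one] at e1
    simp only [e0, e1] at h1
    refine hm.le.trans (h1.le.trans ?_)
    rw [abs_sub_comm]; exact ee_lip _ _
  obtain ⟨ζ, hζ, hcl⟩ := (isCompact_closedBall (0:ℂ) 1).exists_clusterPt (f := map φ (𝓝[Ω] w))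
    (le_principal_iff.2 hcb)
  have hζs := hsph ζ hζ hcl
  refine ⟨ζ, hζs, (isCompact_closedBall (0:ℂ) 1).le_nhds_of_unique_clusterPt hcb fun x hx hxc => ?_⟩
  exact huniq x (hsph x hx hxc) ζ hζs hxc hcl

end JCurve

namespace JCurve
variable {γ : ℂ → ℂ} (hγ : JCurve γ)
include hγ

theorem no_arc {a : ℂ} (ha : a ∈ Inn (Jor γ)) {Ψ : ℂ → ℂ}
    (hc : ContinuousOn Ψ (closure (connectedComponentIn (Jor γ)ᶜ a)))
    (hd : DifferentiableOn ℂ Ψ (connectedComponentIn (Jor γ)ᶜ a)) {ζ : ℂ}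
    (hne : ∀ z ∈ connectedComponentIn (Jor γ)ᶜ a, Ψ z ≠ ζ) {s t : ℝ} (hst : s < t) (hts : t ≤ s + 2 * Real.pi)
    (h : ∀ u ∈ Icc s t, Ψ (γ (ee u)) = ζ) : False := by
  classical
  set Ω := connectedComponentIn (Jor γ)ᶜ a with hΩ
  have hcl := hγ.comp_closure ha
  have hΩo : IsOpen Ω := isOpen_comp hγ.isCompact.isClosed a
  set m := (s + t) / 2
  set w := γ (ee m) with hw
  have hwJ : w ∈ Jor γ := ⟨_, ee_mem m, rfl⟩
  set R := (fun t => γ (ee t)) '' Icc t (s + 2 * Real.pi)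
  have hRc : IsCompact R := isCompact_Icc.image hγ.contp
  have hwR : w ∉ R := by
    rintro ⟨u, hu, e⟩
    have hm1 : s < m := by simp only [m]; linarith
    have hm2 : m < t := by simp only [m]; linarith
    have := hγ.param_inj (u := m) ⟨by linarith [hu.1], by linarith [hu.2]⟩ ⟨le_rfl, by linarith [Real.pi_pos]⟩ e
    linarith [hu.1]
  obtain ⟨r, hr, hrR⟩ := Metric.isOpen_iff.1 hRc.isClosed.isOpen_compl _ hwR
  have hJ : ∀ z ∈ ball w r, z ∈ Jor γ → Ψ z = ζ := by
    intro z hz hzJ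
    obtain ⟨u, hu, rfl⟩ := mem_param hzJ s
    rcases le_total u t with hut | hut
    · exact h u ⟨hu.1, hut⟩
    · exact absurd ⟨u, ⟨hut, hu.2.le⟩, rfl⟩ (hrR hz)
  set k : ℂ → ℂ := fun z => if z ∈ Ω then Ψ z - ζ else 0 with hk
  have hkc : ∀ z ∈ ball w r, ContinuousAt k z := by
    intro z hz
    by_cases h1 : z ∈ closure Ω
    · by_cases h2 : z ∈ Ω
      · have : k =ᶠ[𝓝 z] fun z => Ψ z - ζ := by
          filter_upwards [hΩo.mem_nhds h2] with y hy; simp [hk, hy]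
        refine ContinuousAt.congr ?_ this.symm
        exact (hc.continuousAt (mem_of_superset (hΩo.mem_nhds h2) subset_closure)).sub continuousAt_const
      · have h3 : Ψ z = ζ := hJ z hz ((hcl ▸ h1).resolve_left h2)
        have h4 := hc z h1
        rw [Metric.continuousAt_iff]
        rw [Metric.continuousWithinAt_iff] at h4
        intro ε hε
        obtain ⟨δ, hδ, h5⟩ := h4 ε hε
        refine ⟨δ, hδ, fun y hy => ?_⟩
        simp only [hk, h2, if_false]
        split_ifs with h6
        · rw [dist_zero_right, ← h3, ← dist_eq_norm]; exact h5 (subset_closure h6) hy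
        · simpa using hε
    · have : k =ᶠ[𝓝 z] fun z => 0 := by
        filter_upwards [isClosed_closure.isOpen_compl.mem_nhds h1] with y hy
        simp only [hk]; rw [if_neg fun h => hy (subset_closure h)]
      exact ContinuousAt.congr continuousAt_const this.symm
  obtain ⟨c, hcΩ, hcw⟩ := Metric.mem_closure_iff.1 (hcl ▸ Or.inr hwJ : w ∈ closure Ω) (r / 4) (by positivity)
  obtain ⟨e, heO, hew⟩ := Metric.mem_closure_iff.1 (hγ.subset_closure_out hwJ) (r / 4) (by positivity)
  have heO' : Disjoint (Out (Jor γ)) Ω := disjoint_left.2 fun z hz hz' => disj_inn_out (comp_subset_inn ha hz') hz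
  obtain ⟨η, hη, hηO⟩ := Metric.isOpen_iff.1 (out_isOpen hγ.isCompact) _ heO
  set ρ := ‖e - c‖ with hρ
  have hρ0 : 0 < ρ := norm_pos_iff.2 (sub_ne_zero.2 fun h => disjoint_left.1 heO' heO (h ▸ hcΩ))
  have hρr : ρ < r / 2 := by
    have := dist_triangle e w c
    rw [dist_comm e w] at this
    rw [hρ, ← dist_eq_norm]; linarith
  obtain ⟨N, hN⟩ := exists_nat_gt (ρ * (2 * Real.pi) / η)
  have hN0 : 0 < (N : ℝ) := lt_trans (by have := Real.pi_pos; positivity) hN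
  rw [div_lt_iff₀ hη] at hN
  have hee1 : ∀ t, ‖ee t‖ = 1 := fun t => mem_sphere_zero_iff_norm.1 (ee_mem t)
  set q : ℕ → ℂ → ℂ := fun j z => c + ee (2 * Real.pi * j / N) * (z - c) with hq
  have hqn : ∀ j z, dist (q j z) c = dist z c := fun j z => by
    rw [dist_eq_norm, dist_eq_norm, hq]; simp [hee1]
  have hqw : ∀ j, ∀ z ∈ closedBall c ρ, q j z ∈ ball w r := fun j z hz => by
    have := dist_triangle (q j z) c w
    rw [hqn, dist_comm c w] at this
    rw [mem_closedBall] at hz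
    rw [mem_ball]; linarith
  set P : ℂ → ℂ := fun z => ∏ j ∈ Finset.range N, k (q j z) with hP
  have hqc : ∀ j, Continuous (q j) := fun j => by simp only [hq]; fun_prop
  have hPc : ContinuousOn P (closedBall c ρ) := fun z hz => by
    refine ContinuousAt.continuousWithinAt (tendsto_finsetProd _ fun j _ => ?_)
    exact ContinuousAt.comp (f := q j) (hkc _ (hqw j z hz)) (hqc j).continuousAt
  have hPs : ∀ z ∈ sphere c ρ, P z = 0 := by
    intro z hz
    have hz1 : ‖z - c‖ = ρ := by rw [← dist_eq_norm]; exact hz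
    have hz0 : z - c ≠ 0 := norm_pos_iff.1 (by rw [hz1]; exact hρ0)
    obtain ⟨θ, hθ, hθe⟩ := ee_surj (z := (e - c) / (z - c)) (by
      rw [mem_sphere_zero_iff_norm, norm_div, hz1, div_self hρ0.ne']) 0
    rw [eq_div_iff hz0] at hθe
    have h2p := Real.two_pi_pos
    set j := ⌊θ * N / (2 * Real.pi)⌋₊ with hj
    have hj1 : (j : ℝ) ≤ θ * N / (2 * Real.pi) := Nat.floor_le (by have := hθ.1; positivity)
    have hj2 : θ * N / (2 * Real.pi) < j + 1 := Nat.lt_floor_add_one _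
    rw [le_div_iff₀ h2p] at hj1
    rw [div_lt_iff₀ h2p] at hj2
    have hjN : j < N := by
      have : (j : ℝ) < N := by
        have := hθ.2
        by_contra! hcon
        nlinarith
      exact_mod_cast this
    refine Finset.prod_eq_zero (Finset.mem_range.2 hjN) ?_
    have hmem : q j z ∈ ball e η := by
      rw [mem_ball, dist_eq_norm, hq]
      simp only
      rw [show c + ee (2 * Real.pi * j / N) * (z - c) - e = (ee (2 * Real.pi * j / N) - ee θ) * (z - c) by
        rw [sub_mul, hθe]; ring, norm_mul, hz1]
      have h3 := ee_lip (2 * Real.pi * j / N) θ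
      have h4 : |2 * Real.pi * j / N - θ| ≤ 2 * Real.pi / N := by
        rw [abs_le, neg_le_sub_iff_le_add, sub_le_iff_le_add]
        constructor
        · rw [← add_div, le_div_iff₀ hN0]; linarith
        · rw [div_le_iff₀ hN0, add_mul, div_mul_cancel₀ _ hN0.ne']; nlinarith
      calc _ ≤ 2 * Real.pi / N * ρ := by gcongr; exact h3.trans h4
        _ < η := by rw [div_mul_eq_mul_div, div_lt_iff₀ hN0]; linarith
    simp only [hk]
    rw [if_neg fun h => disjoint_left.1 heO' (hηO hmem) h]
  have hkne : ∀ z, k z ≠ 0 → z ∈ Ω := fun z hz => by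
    by_contra h; simp [hk, h] at hz
  have hkd : ∀ z ∈ Ω, DifferentiableAt ℂ k z := fun z hz => by
    refine ((hd.differentiableAt (hΩo.mem_nhds hz)).sub_const ζ).congr_of_eventuallyEq ?_
    filter_upwards [hΩo.mem_nhds hz] with y hy; simp [hk, hy]
  set W := {z | z ∈ ball c ρ ∧ P z ≠ 0} with hW
  have hWo : IsOpen W := by
    have := (hPc.mono ball_subset_closedBall).isOpen_inter_preimage isOpen_ball (isOpen_compl_singleton (x := (0:ℂ)))
    exact this
  have hWc : closure W ⊆ closedBall c ρ := closure_minimal (fun z hz => ball_subset_closedBall hz.1) isClosed_closedBall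
  have hPd : DifferentiableOn ℂ P W := fun z hz => by
    refine (DifferentiableAt.fun_finsetProd fun j hj => ?_).differentiableWithinAt
    have : k (q j z) ≠ 0 := Finset.prod_ne_zero_iff.1 hz.2 j hj
    exact (hkd _ (hkne _ this)).comp z (by simp only [hq]; fun_prop)
  have hcW : c ∈ W := by
    refine ⟨mem_ball_self hρ0, Finset.prod_ne_zero_iff.2 fun j _ => ?_⟩
    have : q j c = c := by simp [hq]
    rw [this]; simp only [hk]; rw [if_pos hcΩ]
    exact sub_ne_zero.2 (hne c hcΩ)
  have := norm_le_of_forall_mem_frontier_norm_le (C := 0) (isBounded_ball.subset fun z (hz : z ∈ W) => hz.1)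
    ⟨hPd, hPc.mono hWc⟩ (fun z hz => ?_) (subset_closure hcW)
  · exact hcW.2 (norm_le_zero_iff.1 this)
  · rw [hWo.frontier_eq] at hz
    have hz1 := hWc hz.1
    by_cases hb : z ∈ ball c ρ
    · have : P z = 0 := by by_contra h0; exact hz.2 ⟨hb, h0⟩
      simp [this]
    · rw [hPs z (le_antisymm hz1 (not_lt.1 hb))]; simp
end JCurve

theorem radial_ext {β : ℂ → ℂ} (hc : ContinuousOn β (sphere 0 1)) (hi : InjOn β (sphere 0 1))
    (hs : β '' sphere 0 1 = sphere 0 1) : ∃ B : ℂ → ℂ, Continuous B ∧ Function.Injective B ∧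
      EqOn B β (sphere 0 1) ∧ (∀ z, ‖B z‖ = ‖z‖) ∧ Function.Surjective B := by
  have hm : ∀ z ∈ sphere (0:ℂ) 1, ‖β z‖ = 1 := fun z hz => by
    have := hs ▸ mem_image_of_mem β hz; simpa using this
  have hu : ∀ z : ℂ, z ≠ 0 → z / ‖z‖ ∈ sphere (0:ℂ) 1 := fun z hz => by simp [hz]
  set B : ℂ → ℂ := fun z => ‖z‖ * β (z / ‖z‖) with hB
  have hn : ∀ z, ‖B z‖ = ‖z‖ := fun z => by
    rcases eq_or_ne z 0 with rfl | hz
    · simp [hB]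
    · simp only [hB]; rw [norm_mul, hm _ (hu z hz)]; simp
  refine ⟨B, ?_, ?_, ?_, hn, ?_⟩
  · rw [continuous_iff_continuousAt]
    intro z
    rcases eq_or_ne z 0 with rfl | hz
    · have h0 : B 0 = 0 := by simp [hB]
      rw [ContinuousAt, h0, tendsto_zero_iff_norm_tendsto_zero]
      simp_rw [hn]
      simpa using (continuous_norm (E := ℂ)).tendsto 0
    · have h1 : ContinuousOn B {0}ᶜ := by
        refine (continuous_ofReal.comp continuous_norm).continuousOn.mul (hc.comp ?_ fun z hz => hu z hz)
        exact continuousOn_id.div (continuous_ofReal.comp continuous_norm).continuousOn fun z hz => by simpa using hz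
      exact h1.continuousAt (isOpen_compl_singleton.mem_nhds hz)
  · intro z w h
    have h1 : ‖z‖ = ‖w‖ := by rw [← hn, h, hn]
    rcases eq_or_ne z 0 with rfl | hz
    · simpa [eq_comm] using h1
    have hw : w ≠ 0 := fun e => hz (by simpa [e] using h1)
    simp only [hB] at h
    have h0 : (‖w‖ : ℂ) ≠ 0 := by simpa using hw
    rw [h1] at h
    have := hi (h1 ▸ hu z hz) (hu w hw) (mul_left_cancel₀ h0 h)
    rwa [div_left_inj' h0] at this
  · intro z hz
    have : ‖z‖ = 1 := by simpa using hz
    simp [hB, this]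
  · intro w
    rcases eq_or_ne w 0 with rfl | hw
    · exact ⟨0, by simp [hB]⟩
    obtain ⟨u, hu1, hu2⟩ : w / ‖w‖ ∈ β '' sphere 0 1 := by rw [hs]; exact hu w hw
    have h0 : (‖w‖ : ℂ) ≠ 0 := by simpa using hw
    have h1 : ‖u‖ = 1 := by simpa using hu1
    refine ⟨‖w‖ * u, ?_⟩
    simp only [hB, norm_mul, h1, norm_real, norm_norm, mul_one]
    rw [mul_div_cancel_left₀ _ h0, hu2, mul_div_cancel₀ _ h0]

namespace JCurve
variable {γ : ℂ → ℂ} (hγ : JCurve γ)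
include hγ

theorem comp_disc {a : ℂ} (ha : a ∈ Inn (Jor γ)) : ∃ Φ : ℂ → ℂ, ContinuousOn Φ (closedBall 0 1) ∧
    InjOn Φ (closedBall 0 1) ∧ EqOn Φ γ (sphere 0 1) ∧
    Φ '' ball 0 1 = connectedComponentIn (Jor γ)ᶜ a := by
  have hcl := hγ.comp_closure ha
  have hcc := hγ.comp_compl ha
  have hex := @ext_limit γ hγ a ha
  have hna := @no_arc γ hγ a ha
  have hΩo : IsOpen (connectedComponentIn (Jor γ)ᶜ a) := isOpen_comp hγ.isCompact.isClosed a
  have hΩc : IsPreconnected (connectedComponentIn (Jor γ)ᶜ a) := isPreconnected_connectedComponentIn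
  have haΩ : a ∈ connectedComponentIn (Jor γ)ᶜ a := mem_connectedComponentIn ha.1
  have hΩb : Bornology.IsBounded (connectedComponentIn (Jor γ)ᶜ a) := ha.2
  have hΩJ : connectedComponentIn (Jor γ)ᶜ a ⊆ (Jor γ)ᶜ := connectedComponentIn_subset _ _
  generalize connectedComponentIn (Jor γ)ᶜ a = Ω at *
  obtain ⟨φ, f, hφd, hfd, hφb, hfb, hfφ, hφf, -⟩ := rmt hΩo hΩb hΩc hcc haΩ
  have hlim := @hex φ f hφd.continuousOn hfd hφb hfb hfφ
  have hJcl : Jor γ ⊆ closure Ω := hcl ▸ subset_union_right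
  set Ψ := extendFrom Ω φ with hΨ
  have hΨφ : ∀ z ∈ Ω, Ψ z = φ z := fun z hz =>
    extendFrom_eq (subset_closure hz) (hφd.continuousOn z hz)
  have hΨc : ContinuousOn Ψ (closure Ω) := continuousOn_extendFrom subset_rfl fun z hz => by
    rw [hcl] at hz
    rcases hz with hz | hz
    · exact ⟨_, hφd.continuousOn z hz⟩
    · obtain ⟨ζ, -, h⟩ := hlim hz; exact ⟨ζ, h⟩
  have hΨJ : ∀ z ∈ Jor γ, Ψ z ∈ sphere (0:ℂ) 1 := fun z hz => by
    obtain ⟨ζ, h1, h⟩ := hlim hz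
    rw [hΨ, extendFrom_eq (hJcl hz) h]; exact h1
  have hΨΩ : ∀ z ∈ Ω, Ψ z ∈ ball (0:ℂ) 1 := fun z hz => by rw [hΨφ z hz]; exact hφb hz
  have hdisj : ∀ {x : ℂ}, x ∈ ball (0:ℂ) 1 → x ∈ sphere (0:ℂ) 1 → False := fun h1 h2 => by
    rw [mem_ball] at h1; rw [mem_sphere] at h2; linarith
  have hΨd : DifferentiableOn ℂ Ψ Ω := hφd.congr hΨφ
  have hclc : IsCompact (closure Ω) := hΩb.isCompact_closure
  have himg : Ψ '' closure Ω = closedBall 0 1 := by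
    apply Subset.antisymm
    · rintro _ ⟨z, hz, rfl⟩
      rw [hcl] at hz
      rcases hz with hz | hz
      · exact ball_subset_closedBall (hΨΩ z hz)
      · exact sphere_subset_closedBall (hΨJ z hz)
    · rw [← closure_ball (0:ℂ) one_ne_zero]
      refine closure_minimal (fun z hz => ?_) (hclc.image_of_continuousOn hΨc).isClosed
      exact ⟨f z, subset_closure (hfb hz), by rw [hΨφ _ (hfb hz), hφf z hz]⟩
  have hsurj : ∀ ζ ∈ sphere (0:ℂ) 1, ∃ w ∈ Jor γ, Ψ w = ζ := fun ζ hζ => by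
    obtain ⟨w, hw, e⟩ := himg.symm ▸ sphere_subset_closedBall hζ
    rw [hcl] at hw
    rcases hw with hw | hw
    · exact (hdisj (hΨΩ w hw) (e ▸ hζ)).elim
    · exact ⟨w, hw, e⟩
  have hJK := hγ.isCompact
  have hcJ : ContinuousOn Ψ (Jor γ) := hΨc.mono hJcl
  have hfib : ∀ ζ ∈ sphere (0:ℂ) 1, IsPreconnected {w | w ∈ Jor γ ∧ Ψ w = ζ} := by
    intro ζ hζ
    have hFc : IsClosed {w | w ∈ Jor γ ∧ Ψ w = ζ} :=
      hcJ.preimage_isClosed_of_isClosed hJK.isClosed isClosed_singleton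
    rw [isPreconnected_iff_subset_of_fully_disjoint_closed hFc]
    intro u v hu hv huv hd
    obtain ⟨U, V, hU, hV, huU, hvV, hUV⟩ := normal_separation hu hv hd
    have hK : IsCompact (Ψ '' (closure Ω \ (U ∪ V))) :=
      (hclc.diff (hU.union hV)).image_of_continuousOn (hΨc.mono sdiff_subset)
    have hζK : ζ ∉ Ψ '' (closure Ω \ (U ∪ V)) := by
      rintro ⟨w, ⟨hw, hw2⟩, e⟩
      rw [hcl] at hw
      rcases hw with hw | hw
      · exact hdisj (hΨΩ w hw) (e ▸ hζ)
      · exact hw2 ((huv ⟨hw, e⟩).imp (fun h => huU h) fun h => hvV h)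
    obtain ⟨r, hr, hrK⟩ := Metric.isOpen_iff.1 hK.isClosed.isOpen_compl _ hζK
    have hS : IsPreconnected (f '' (ball 0 1 ∩ ball ζ r)) :=
      ((convex_ball _ _).inter (convex_ball _ _)).isPreconnected.image _
        (hfd.continuousOn.mono inter_subset_left)
    have hSs : f '' (ball 0 1 ∩ ball ζ r) ⊆ U ∪ V := by
      rintro _ ⟨z, hz, rfl⟩
      by_contra h
      exact hrK hz.2 ⟨f z, ⟨subset_closure (hfb hz.1), h⟩, by rw [hΨφ _ (hfb hz.1), hφf z hz.1]⟩
    have hnear : ∀ w ∈ Jor γ, Ψ w = ζ → ∀ W, IsOpen W → w ∈ W →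
        (f '' (ball 0 1 ∩ ball ζ r) ∩ W).Nonempty := by
      intro w hw e W hW hwW
      have h1 : ∀ᶠ z in 𝓝[Ω] w, Ψ z ∈ ball ζ r :=
        ((hΨc w (hJcl hw)).mono subset_closure).eventually (isOpen_ball.mem_nhds (e ▸ mem_ball_self hr))
      have h2 : ∀ᶠ z in 𝓝[Ω] w, z ∈ W := mem_nhdsWithin_of_mem_nhds (hW.mem_nhds hwW)
      have h3 : ∀ᶠ z in 𝓝[Ω] w, z ∈ Ω := self_mem_nhdsWithin
      have := mem_closure_iff_nhdsWithin_neBot.1 (hJcl hw)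
      obtain ⟨z, ⟨h1, h2⟩, h3⟩ := ((h1.and h2).and h3).exists
      exact ⟨z, ⟨φ z, ⟨hφb h3, by rw [← hΨφ z h3]; exact h1⟩, hfφ z h3⟩, h2⟩
    rcases hS.subset_or_subset hU hV hUV hSs with h | h
    · left; intro w hw
      refine (huv hw).resolve_right fun hwv => ?_
      obtain ⟨z, hz1, hz2⟩ := hnear w hw.1 hw.2 V hV (hvV hwv)
      exact disjoint_left.1 hUV (h hz1) hz2
    · right; intro w hw
      refine (huv hw).resolve_left fun hwv => ?_
      obtain ⟨z, hz1, hz2⟩ := hnear w hw.1 hw.2 U hU (huU hwv)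
      exact disjoint_left.1 hUV hz2 (h hz1)
  have hinjJ : InjOn Ψ (Jor γ) := by
    intro w1 hw1 w2 hw2 he
    by_contra hne
    set ζ := Ψ w2 with hζ
    have hζs : ζ ∈ sphere (0:ℂ) 1 := hΨJ w2 hw2
    obtain ⟨x, hx, hxe⟩ := hsurj (-ζ) (by simpa using hζs)
    have hxζ : Ψ x ≠ ζ := fun e => by
      have h0 : ζ = 0 := self_eq_neg.1 (e ▸ hxe)
      rw [h0] at hζs; simp at hζs
    obtain ⟨s, -, rfl⟩ := mem_param hx 0
    obtain ⟨t1, ht1, rfl⟩ := mem_param hw1 s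
    obtain ⟨t2, ht2, e2⟩ := mem_param hw2 s
    have key : ∀ a b : ℝ, a ∈ Ico s (s + 2 * Real.pi) → b ∈ Ico s (s + 2 * Real.pi) → a < b →
        Ψ (γ (ee a)) = ζ → Ψ (γ (ee b)) = ζ → False := by
      intro t1 t2 ht1 ht2 h12 e1 e2
      refine hna hΨc hΨd (fun z hz e => hdisj (hΨΩ z hz) (e ▸ hζs)) h12 (by linarith [ht1.1, ht2.2]) fun u hu => ?_
      by_contra hune
      have hP := isPreconnected_closed_iff.1 (hfib ζ hζs)
        ((fun t => γ (ee t)) '' Icc s u) ((fun t => γ (ee t)) '' Icc u (s + 2 * Real.pi))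
        (isCompact_Icc.image hγ.contp).isClosed (isCompact_Icc.image hγ.contp).isClosed
        (fun w hw => by
          obtain ⟨t, ht, rfl⟩ := mem_param hw.1 s
          rcases le_total t u with h | h
          · exact Or.inl ⟨t, ⟨ht.1, h⟩, rfl⟩
          · exact Or.inr ⟨t, ⟨h, ht.2.le⟩, rfl⟩)
        ⟨_, ⟨⟨_, ee_mem _, rfl⟩, e1⟩, ⟨t1, ⟨ht1.1, hu.1⟩, rfl⟩⟩
        ⟨_, ⟨⟨_, ee_mem _, rfl⟩, e2⟩, ⟨t2, ⟨hu.2, ht2.2.le⟩, rfl⟩⟩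
      obtain ⟨_, ⟨-, e⟩, ⟨v, hv, rfl⟩, ⟨v', hv', hvv⟩⟩ := hP
      simp only at hvv e
      have hu2 : u < s + 2 * Real.pi := by linarith [hu.2, ht2.2]
      rcases eq_or_lt_of_le hv'.2 with h | h
      · rw [h, ee_add_two_pi] at hvv
        rw [← hvv] at e; exact hxζ e
      · have := hγ.param_inj (u := s) ⟨hv.1, by linarith [hv.2]⟩ ⟨by linarith [hv'.1, hv.1, hv.2], h⟩ hvv.symm
        have : v = u := le_antisymm hv.2 (this ▸ hv'.1)
        exact hune (this ▸ e)
    rcases lt_trichotomy t1 t2 with h | h | h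
    · exact key t1 t2 ht1 ht2 h he (by rw [e2])
    · exact hne (by rw [h, e2])
    · exact key t2 t1 ht2 ht1 h (by rw [e2]) he
  have hinj : InjOn Ψ (closure Ω) := by
    intro z hz w hw e
    rw [hcl] at hz hw
    rcases hz with hz | hz <;> rcases hw with hw | hw
    · rw [hΨφ z hz, hΨφ w hw] at e; rw [← hfφ z hz, e, hfφ w hw]
    · exact (hdisj (hΨΩ z hz) (e ▸ hΨJ w hw)).elim
    · exact (hdisj (hΨΩ w hw) (e ▸ hΨJ z hz)).elim
    · exact hinjJ hz hw e
  have hΘ := contOn_invFunOn hclc hΨc hinj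
  rw [himg] at hΘ
  set Θ := Function.invFunOn Ψ (closure Ω)
  have hΘΨ : ∀ z ∈ closure Ω, Θ (Ψ z) = z := fun z hz => hinj.leftInvOn_invFunOn hz
  have hΨΘ : ∀ z ∈ closedBall (0:ℂ) 1, Ψ (Θ z) = z := fun z hz => by
    rw [← himg] at hz; exact Function.invFunOn_eq hz
  have hγJ : ∀ z ∈ sphere (0:ℂ) 1, γ z ∈ Jor γ := fun z hz => ⟨z, hz, rfl⟩
  obtain ⟨B, hBc, hBi, hBe, hBn, hBs⟩ := radial_ext (β := fun z => Ψ (γ z)) (hcJ.comp hγ.cont hγJ)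
    (fun z hz w hw e => hγ.inj hz hw (hinjJ (hγJ z hz) (hγJ w hw) e)) (by
      apply Subset.antisymm
      · rintro _ ⟨z, hz, rfl⟩; exact hΨJ _ (hγJ z hz)
      · intro ζ hζ
        obtain ⟨_, ⟨z, hz, rfl⟩, e⟩ := hsurj ζ hζ
        exact ⟨z, hz, e⟩)
  have hB1 : MapsTo B (closedBall 0 1) (closedBall 0 1) := fun z hz => by
    simpa [hBn] using hz
  refine ⟨fun z => Θ (B z), hΘ.comp hBc.continuousOn hB1, fun z hz w hw e => hBi ?_, fun z hz => ?_, ?_⟩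
  · rw [← hΨΘ _ (hB1 hz), ← hΨΘ _ (hB1 hw)]; exact congrArg Ψ e
  · simp only [hBe hz]; exact hΘΨ _ (hJcl (hγJ z hz))
  · apply Subset.antisymm
    · rintro _ ⟨z, hz, rfl⟩
      have h1 : B z ∈ ball (0:ℂ) 1 := by simpa [hBn] using hz
      have : Θ (B z) = f (B z) := by
        rw [← hΘΨ (f (B z)) (subset_closure (hfb h1)), hΨφ _ (hfb h1), hφf _ h1]
      simp only [this]; exact hfb h1
    · intro w hw
      obtain ⟨z, hz⟩ := hBs (Ψ w)
      refine ⟨z, ?_, ?_⟩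
      · have := hΨΩ w hw; rw [← hz] at this; simpa [hBn] using this
      · simp only [hz]; exact hΘΨ w (subset_closure hw)

theorem inn_eq {a : ℂ} (ha : a ∈ Inn (Jor γ)) : Inn (Jor γ) = connectedComponentIn (Jor γ)ᶜ a := by
  refine Subset.antisymm (fun b hb => ?_) (comp_subset_inn ha)
  by_contra hab
  obtain ⟨Φ, hc, hi, he, himg⟩ := hγ.comp_disc ha
  refine disj_inn_out hb ((log_iff_out hγ.isCompact hb.1).1 ?_)
  have : HasLog (Φ '' closedBall 0 1) (fun z => z - b) := by
    refine HasLog.image (isCompact_closedBall _ _) hc hi (hasLog_of_convex (convex_closedBall _ _)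
      (hc.sub continuousOn_const) fun z hz h => ?_)
    rw [sub_eq_zero] at h
    rcases (mem_closedBall.1 hz).lt_or_eq with h1 | h1
    · exact hab (himg ▸ ⟨z, h1, h⟩)
    · exact hb.1 ⟨z, h1, by rw [← he h1, h]⟩
  refine this.mono ?_
  rintro _ ⟨z, hz, rfl⟩
  exact ⟨z, sphere_subset_closedBall hz, he hz⟩

theorem schoenflies : ∃ Φ : ℂ → ℂ, ContinuousOn Φ (closedBall 0 1) ∧
    InjOn Φ (closedBall 0 1) ∧ EqOn Φ γ (sphere 0 1) ∧ Φ '' ball 0 1 = Inn (Jor γ) := by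
  obtain ⟨a, ha⟩ := hγ.inn_nonempty
  rw [hγ.inn_eq ha]; exact hγ.comp_disc ha

theorem inn_preconn : IsPreconnected (Inn (Jor γ)) := by
  obtain ⟨a, ha⟩ := hγ.inn_nonempty
  rw [hγ.inn_eq ha]; exact isPreconnected_connectedComponentIn
end JCurve

def Iv (a : ℂ) (K : Set ℂ) : Set ℂ := insert 0 ((fun z => (z - a)⁻¹) '' K)

theorem inv_inv_a (a z : ℂ) : a + ((z - a)⁻¹)⁻¹ = z := by rw [inv_inv]; ring

theorem iv_mem {a z : ℂ} {K : Set ℂ} (h : z ≠ a) : (z - a)⁻¹ ∈ Iv a K ↔ z ∈ K := by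
  have h0 : (z - a)⁻¹ ≠ 0 := inv_ne_zero (sub_ne_zero.2 h)
  constructor
  · rintro (h1 | ⟨w, hw, e⟩)
    · exact absurd h1 h0
    · rwa [← sub_left_inj.1 (inv_injective e)]
  · exact fun hz => Or.inr ⟨z, hz, rfl⟩

theorem iv_mem' {a w : ℂ} {K : Set ℂ} (h : w ≠ 0) : w ∈ Iv a K ↔ a + w⁻¹ ∈ K := by
  have := iv_mem (a := a) (z := a + w⁻¹) (K := K) (by simpa using h)
  simpa using this

theorem iv_compact {a : ℂ} {K : Set ℂ} (hK : IsClosed K) (ha : a ∉ K) : IsCompact (Iv a K) := by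
  have hc : ContinuousOn (fun w : ℂ => a + w⁻¹) {0}ᶜ :=
    continuousOn_const.add (continuousOn_inv₀.mono fun w hw => by simpa using hw)
  refine isCompact_of_isClosed_isBounded ⟨?_⟩ ?_
  · have : (Iv a K)ᶜ = {0}ᶜ ∩ (fun w : ℂ => a + w⁻¹) ⁻¹' Kᶜ := by
      ext w
      rcases eq_or_ne w 0 with rfl | h
      · simp [Iv]
      · simp [iv_mem' h, h]
    rw [this]; exact hc.isOpen_inter_preimage isOpen_compl_singleton hK.isOpen_compl
  · obtain ⟨r, hr, hrK⟩ := Metric.isOpen_iff.1 hK.isOpen_compl a ha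
    refine isBounded_closedBall.subset (t := closedBall 0 r⁻¹) ?_
    rintro _ (rfl | ⟨z, hz, rfl⟩)
    · simp [hr.le]
    · have : r ≤ ‖z - a‖ := by
        by_contra h
        exact hrK (mem_ball_iff_norm.2 (not_le.1 h)) hz
      simpa using inv_anti₀ hr this

theorem out_iff {a z : ℂ} {K : Set ℂ} (hK : IsClosed K) (ha : a ∉ K) (hz : z ≠ a) :
    (z - a)⁻¹ ∈ Out (Iv a K) ↔ z ∈ connectedComponentIn Kᶜ a := by
  have hc := iv_compact hK ha
  have h0 : ∀ w, w ∈ Out (Iv a K) → w ≠ 0 := fun w hw e => hw.1 (e ▸ mem_insert _ _)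
  have hci : ContinuousOn (fun z => (z - a)⁻¹) {a}ᶜ :=
    (continuousOn_id.sub continuousOn_const).inv₀ fun z hz => sub_ne_zero.2 hz
  have hco : ContinuousOn (fun w : ℂ => a + w⁻¹) (Out (Iv a K)) :=
    continuousOn_const.add (continuousOn_inv₀.mono fun w hw => by simpa using h0 w hw)
  obtain ⟨R, hR0, hR⟩ := hc.isBounded.subset_closedBall_lt 0 0
  have hnear : ∀ z ∈ ball a R⁻¹, z ≠ a → (z - a)⁻¹ ∈ Out (Iv a K) := fun z hz hne => by
    refine far_mem_out hR0.le hR ?_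
    rw [norm_inv]
    exact (lt_inv_comm₀ (norm_pos_iff.2 (sub_ne_zero.2 hne)) hR0).1 (mem_ball_iff_norm.1 hz)
  set N := insert a ((fun w : ℂ => a + w⁻¹) '' Out (Iv a K)) with hN
  have hNm : ∀ z, z ≠ a → (z ∈ N ↔ (z - a)⁻¹ ∈ Out (Iv a K)) := fun z hne => by
    constructor
    · rintro (h | ⟨w, hw, rfl⟩)
      · exact absurd h hne
      · simpa using hw
    · exact fun h => Or.inr ⟨_, h, inv_inv_a a z⟩
  have hNp : IsPreconnected N := by
    refine ((out_preconn hc).image _ hco).subset_closure (subset_insert _ _) ?_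
    refine insert_subset (Metric.mem_closure_iff.2 fun ε hε => ?_) subset_closure
    have hm : 0 < min ε R⁻¹ / 2 := by positivity
    have hm2 := half_lt_self (show 0 < min ε R⁻¹ by positivity)
    have e : ‖((min ε R⁻¹ / 2 : ℝ) : ℂ)‖ = min ε R⁻¹ / 2 := by rw [norm_real, Real.norm_of_nonneg hm.le]
    refine ⟨a + ((min ε R⁻¹ / 2 : ℝ) : ℂ), ⟨_, hnear _ ?_ ?_, inv_inv_a a _⟩, ?_⟩
    · rw [mem_ball_iff_norm, add_sub_cancel_left, e]; exact hm2.trans_le (min_le_right _ _)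
    · simpa using ne_of_gt (by positivity : 0 < min ε R⁻¹)
    · rw [dist_comm, dist_eq_norm, add_sub_cancel_left, e]; exact hm2.trans_le (min_le_left _ _)
  have hNs : N ⊆ Kᶜ := by
    intro z hzN
    rcases eq_or_ne z a with rfl | hne
    · exact ha
    · exact fun hzK => ((hNm z hne).1 hzN).1 ((iv_mem hne).2 hzK)
  rw [← hNm z hz]
  constructor
  · exact fun h => same_comp_of_subset hNp hNs (mem_insert _ _) h
  · intro h
    have hNo : IsOpen N := by
      have : N = ball a R⁻¹ ∪ {a}ᶜ ∩ (fun z => (z - a)⁻¹) ⁻¹' Out (Iv a K) := by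
        ext z
        rcases eq_or_ne z a with rfl | hne
        · simp [hN, hR0]
        · rw [hNm z hne]
          exact ⟨fun h => Or.inr ⟨hne, h⟩, fun h => h.elim (fun h => hnear z h hne) fun h => h.2⟩
      rw [this]; exact isOpen_ball.union (hci.isOpen_inter_preimage isOpen_compl_singleton (out_isOpen hc))
    have hFo : IsOpen ({a}ᶜ ∩ (fun z => (z - a)⁻¹) ⁻¹' Inn (Iv a K)) :=
      hci.isOpen_inter_preimage isOpen_compl_singleton (inn_isOpen hc)
    refine (isPreconnected_connectedComponentIn (F := Kᶜ) (x := a)).subset_left_of_subset_union hNo hFo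
      (disjoint_left.2 fun z h1 h2 => disj_inn_out h2.2 ((hNm z h2.1).1 h1)) (fun z hz => ?_)
      ⟨a, mem_connectedComponentIn ha, mem_insert _ _⟩ h
    rcases eq_or_ne z a with rfl | hne
    · exact Or.inl (mem_insert _ _)
    · rcases inn_out (Iv a K) (z - a)⁻¹ with h | h | h
      · exact absurd ((iv_mem hne).1 h) (connectedComponentIn_subset _ _ hz)
      · exact Or.inr ⟨hne, h⟩
      · exact Or.inl ((hNm z hne).2 h)

theorem iv_preconn {a : ℂ} {K : Set ℂ} (ha : a ∉ K) (hK : IsPreconnected K)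
    (hu : ¬ Bornology.IsBounded K) : IsPreconnected (Iv a K) := by
  have hci : ContinuousOn (fun z => (z - a)⁻¹) K :=
    (continuousOn_id.sub continuousOn_const).inv₀ fun z hz => sub_ne_zero.2 fun e =>
      ha ((show z = a from e) ▸ hz)
  refine (hK.image _ hci).subset_closure (subset_insert _ _) (insert_subset ?_ subset_closure)
  refine Metric.mem_closure_iff.2 fun ε hε => ?_
  by_contra! h
  refine hu (isBounded_closedBall.subset (t := closedBall a ε⁻¹) fun z hz => ?_)
  have := h _ ⟨z, hz, rfl⟩
  rw [dist_zero_left, norm_inv] at this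
  have hp : 0 < ‖z - a‖ := norm_pos_iff.2 (sub_ne_zero.2 fun e => ha (e ▸ hz))
  exact mem_closedBall_iff_norm.2 ((le_inv_comm₀ hε hp).1 this)

theorem jan_inf {a z : ℂ} {K L : Set ℂ} (hK : IsClosed K) (hL : IsClosed L) (hc : IsPreconnected (K ∩ L))
    (hu : ¬ Bornology.IsBounded (K ∩ L)) (haK : a ∉ K) (haL : a ∉ L)
    (h1 : z ∈ connectedComponentIn Kᶜ a) (h2 : z ∈ connectedComponentIn Lᶜ a) :
    z ∈ connectedComponentIn (K ∪ L)ᶜ a := by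
  have haKL : a ∉ K ∪ L := fun h => h.elim haK haL
  rcases eq_or_ne z a with rfl | hne
  · exact mem_connectedComponentIn haKL
  rw [← out_iff (hK.union hL) haKL hne]
  rw [← out_iff hK haK hne] at h1
  rw [← out_iff hL haL hne] at h2
  have e1 : Iv a (K ∪ L) = Iv a K ∪ Iv a L := by simp [Iv, image_union, insert_union_distrib]
  have e2 : Iv a K ∩ Iv a L = Iv a (K ∩ L) := by
    ext w
    rcases eq_or_ne w 0 with rfl | h
    · simp [Iv]
    · simp [iv_mem' h]
  have c1 := iv_compact hK haK
  have c2 := iv_compact hL haL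
  have c3 := c1.union c2
  obtain ⟨R, hR0, hR⟩ := c3.isBounded.subset_closedBall_lt 0 0
  have hb : R < ‖((R + 1 : ℝ) : ℂ)‖ := by rw [norm_real, Real.norm_of_nonneg (by linarith)]; linarith
  have hbo := far_mem_out hR0.le hR hb
  have hb1 := far_mem_out hR0.le (subset_union_left.trans hR) hb
  have hb2 := far_mem_out hR0.le (subset_union_right.trans hR) hb
  rw [e1, out_eq_comp c3 hbo]
  refine janiszewski c1 c2 (e2 ▸ iv_preconn (fun h => haK h.1) hc hu) hbo.1 (fun h => h.elim h1.1 h2.1) ?_ ?_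
  · rwa [← out_eq_comp c1 hb1]
  · rwa [← out_eq_comp c2 hb2]

structure PLine (ℓ : ℝ → ℂ) : Prop where
  cont : Continuous ℓ
  inj : Function.Injective ℓ
  proper : Tendsto ℓ (cocompact ℝ) (cocompact ℂ)

def Far (ℓ : ℝ → ℂ) (a : ℂ) : Set ℂ := (range ℓ ∪ connectedComponentIn (range ℓ)ᶜ a)ᶜ

namespace PLine
variable {ℓ : ℝ → ℂ} (hℓ : PLine ℓ) {a : ℂ} (ha : a ∉ range ℓ)
include hℓ

theorem closed : IsClosed (range ℓ) :=
  ((isProperMap_iff_tendsto_cocompact).2 ⟨hℓ.cont, hℓ.proper⟩).isClosedMap.isClosed_range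

include ha

theorem toJ : ∃ γ, JCurve γ ∧ Jor γ = Iv a (range ℓ) ∧ γ (-1) = 0 ∧
    ∀ y : ℝ, (1 - y * I) / (1 + y * I) ∈ sphere (0:ℂ) 1 ∧
      γ ((1 - y * I) / (1 + y * I)) = (ℓ y - a)⁻¹ := by
  classical
  set T : ℂ → ℝ := fun w => ((1 - w) / (1 + w)).im
  set e : ℝ → ℂ := fun y => (1 - y * I) / (1 + y * I) with he
  have hd : ∀ y : ℝ, (1 + y * I : ℂ) ≠ 0 := fun y h => by simpa using congrArg re h
  have hes : ∀ y, e y ∈ sphere (0:ℂ) 1 := fun y => by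
    have : (1 - y * I : ℂ) = (starRingEnd ℂ) (1 + y * I) := by simp [sub_eq_add_neg]
    have h2 : ‖(1 + y * I : ℂ)‖ ≠ 0 := norm_ne_zero_iff.2 (hd y)
    simp only [he, mem_sphere_zero_iff_norm, norm_div, this, norm_conj, div_self h2]
  have hTe : ∀ y, T (e y) = y := fun y => by
    have h1 := hd y
    have : (1 - e y) / (1 + e y) = y * I := by
      simp only [he]; field_simp; ring
    simp only [T, this]; simp
  have he1 : ∀ y, e y ≠ -1 := fun y h => by
    have h1 := hd y
    simp only [he] at h
    rw [div_eq_iff h1] at h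
    have := congrArg re h; norm_num at this
  have heT : ∀ w ∈ sphere (0:ℂ) 1, w ≠ -1 → e (T w) = w ∧ ((T w : ℝ) : ℂ) * I = (1 - w) / (1 + w) := by
    intro w hw hne
    have h1 : (1 + w : ℂ) ≠ 0 := fun h => hne (by linear_combination h)
    have hre : ((1 - w) / (1 + w)).re = 0 := by
      have hn : w.re * w.re + w.im * w.im = 1 := by
        have := normSq_eq_norm_sq w
        rw [mem_sphere_zero_iff_norm.1 hw, normSq_apply] at this; simpa using this
      rw [div_re, ← add_div]
      simp only [sub_re, one_re, add_re, sub_im, one_im, add_im]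
      rw [div_eq_zero_iff]; left; linear_combination -hn
    have h2 : ((T w : ℝ) : ℂ) * I = (1 - w) / (1 + w) := by
      apply Complex.ext <;> simp [T, hre]
    refine ⟨?_, h2⟩
    simp only [he]; rw [h2]; field_simp; ring
  set γ : ℂ → ℂ := fun w => if w = -1 then 0 else (ℓ (T w) - a)⁻¹ with hγ
  have hane : ∀ y, ℓ y - a ≠ 0 := fun y h => ha ⟨y, sub_eq_zero.1 h⟩
  have hγe : ∀ y, γ (e y) = (ℓ y - a)⁻¹ := fun y => by simp only [hγ]; rw [if_neg (he1 y), hTe]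
  have h1s : (-1 : ℂ) ∈ sphere (0:ℂ) 1 := by simp
  refine ⟨γ, ⟨?_, ?_⟩, ?_, by simp [hγ], fun y => ⟨hes y, hγe y⟩⟩
  · intro w hw
    rcases eq_or_ne w (-1) with rfl | hne
    · have ht : Tendsto T (𝓝[sphere 0 1 \ {-1}] (-1)) (cocompact ℝ) := by
        rw [← cobounded_eq_cocompact, ← tendsto_norm_atTop_iff_cobounded]
        have h1 : Tendsto (fun w : ℂ => ‖1 - w‖ * ‖1 + w‖⁻¹) (𝓝[sphere 0 1 \ {-1}] (-1)) atTop := by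
          refine Tendsto.pos_mul_atTop (C := 2) (by norm_num) ?_ ?_
          · have : ContinuousAt (fun w : ℂ => ‖1 - w‖) (-1) := by fun_prop
            have h2 := this.tendsto.mono_left (nhdsWithin_le_nhds (s := sphere 0 1 \ {-1}))
            norm_num at h2; exact h2
          · refine tendsto_inv_nhdsGT_zero.comp (tendsto_nhdsWithin_iff.2 ⟨?_, ?_⟩)
            · have : ContinuousAt (fun w : ℂ => ‖1 + w‖) (-1) := by fun_prop
              have h2 := this.tendsto.mono_left (nhdsWithin_le_nhds (s := sphere 0 1 \ {-1}))
              norm_num at h2; exact h2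
            · filter_upwards [self_mem_nhdsWithin] with w hw
              exact norm_pos_iff.2 fun h => hw.2 (show w = -1 by linear_combination h)
        refine h1.congr' ?_
        filter_upwards [self_mem_nhdsWithin] with w hw
        have := congrArg norm (heT w hw.1 hw.2).2
        rw [norm_mul, norm_I, mul_one, norm_real, norm_div] at this
        rw [this, div_eq_mul_inv]
      have hlim : Tendsto γ (𝓝[sphere 0 1 \ {-1}] (-1)) (𝓝 0) := by
        have h3 : Tendsto (fun z : ℂ => (z - a)⁻¹) (cocompact ℂ) (𝓝 0) :=
          tendsto_inv₀_cobounded.comp (by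
            rw [← cobounded_eq_cocompact]
            simpa [sub_eq_add_neg] using tendsto_add_const_cobounded (-a))
        refine (h3.comp (hℓ.proper.comp ht)).congr' ?_
        filter_upwards [self_mem_nhdsWithin] with w hw
        simp [hγ, show w ≠ -1 from hw.2]
      rw [ContinuousWithinAt, ← insert_sdiff_self_of_mem h1s, nhdsWithin_insert, tendsto_sup]
      have e0 : γ (-1) = 0 := by simp [hγ]
      exact ⟨tendsto_pure_nhds _ _, by rw [e0]; exact hlim⟩
    · have h1 : (1 + w : ℂ) ≠ 0 := fun h => hne (by linear_combination h)
      have hT : ContinuousAt T w := by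
        have : ContinuousAt (fun w : ℂ => (1 - w) / (1 + w)) w := by fun_prop (disch := exact h1)
        exact continuous_im.continuousAt.comp this
      have : ContinuousAt (fun w => (ℓ (T w) - a)⁻¹) w :=
        ((hℓ.cont.continuousAt.comp hT).sub continuousAt_const).inv₀ (hane _)
      refine (this.congr ?_).continuousWithinAt
      filter_upwards [isOpen_compl_singleton.mem_nhds hne] with z hz
      simp [hγ, show z ≠ -1 from hz]
  · intro w hw w' hw' h
    by_cases h1 : w = -1 <;> by_cases h2 : w' = -1
    · rw [h1, h2]
    · simp only [hγ, h1, h2, if_true, if_false] at h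
      exact absurd h.symm (inv_ne_zero (hane _))
    · simp only [hγ, h1, h2, if_true, if_false] at h
      exact absurd h (inv_ne_zero (hane _))
    · simp only [hγ, h1, h2, if_false] at h
      rw [← (heT w hw h1).1, ← (heT w' hw' h2).1, hℓ.inj (sub_left_inj.1 (inv_injective h))]
  · apply Subset.antisymm
    · rintro _ ⟨w, hw, rfl⟩
      by_cases h1 : w = -1
      · left; simp [hγ, h1]
      · right; exact ⟨_, ⟨T w, rfl⟩, by simp [hγ, h1]⟩
    · rintro _ (rfl | ⟨_, ⟨y, rfl⟩, rfl⟩)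
      · exact ⟨-1, h1s, by simp [hγ]⟩
      · exact ⟨e y, hes y, hγe y⟩

theorem far_iff {z : ℂ} : z ∈ Far ℓ a ↔ z ≠ a ∧ (z - a)⁻¹ ∈ Inn (Iv a (range ℓ)) := by
  rcases eq_or_ne z a with rfl | hne
  · have h : z ∈ connectedComponentIn (range ℓ)ᶜ z := mem_connectedComponentIn (show z ∈ (range ℓ)ᶜ from ha)
    simp [Far, h]
  · have h1 := out_iff hℓ.closed ha hne
    have h2 := iv_mem (K := range ℓ) hne
    have h3 := inn_out (Iv a (range ℓ)) (z - a)⁻¹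
    simp only [Far, mem_compl_iff, mem_union, ← h1, ← h2, not_or]
    constructor
    · rintro ⟨h, h'⟩; exact ⟨hne, by tauto⟩
    · rintro ⟨-, h⟩; exact ⟨h.1, disj_inn_out h⟩

theorem far_eq : Far ℓ a = (fun w : ℂ => a + w⁻¹) '' Inn (Iv a (range ℓ)) := by
  ext z
  rw [hℓ.far_iff ha]
  constructor
  · rintro ⟨-, h⟩; exact ⟨_, h, inv_inv_a a z⟩
  · rintro ⟨w, hw, rfl⟩
    have : w ≠ 0 := fun e => hw.1 (e ▸ mem_insert _ _)
    simp [this, hw]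

theorem cont_a {K : Set ℂ} (h : (0:ℂ) ∉ K) : ContinuousOn (fun w : ℂ => a + w⁻¹) K :=
  continuousOn_const.add (continuousOn_inv₀.mono fun w hw => by
    simpa using fun e : w = 0 => h (e ▸ hw))

theorem far_preconn : IsPreconnected (Far ℓ a) := by
  obtain ⟨γ, hγ, hJ, -⟩ := hℓ.toJ ha
  rw [hℓ.far_eq ha]
  exact (hJ ▸ hγ.inn_preconn).image _ (hℓ.cont_a ha fun h => h.1 (mem_insert _ _))

theorem far_nonempty : (Far ℓ a).Nonempty := by
  obtain ⟨γ, hγ, hJ, -⟩ := hℓ.toJ ha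
  rw [hℓ.far_eq ha]
  exact (hJ ▸ hγ.inn_nonempty).image _

theorem far_open : IsOpen (Far ℓ a) := by
  have : Far ℓ a = {a}ᶜ ∩ (fun z => (z - a)⁻¹) ⁻¹' Inn (Iv a (range ℓ)) := by
    ext z; exact hℓ.far_iff ha
  rw [this]
  exact ((continuousOn_id.sub continuousOn_const).inv₀ fun z hz => sub_ne_zero.2 hz).isOpen_inter_preimage
    isOpen_compl_singleton (inn_isOpen (iv_compact hℓ.closed ha))

theorem closure_aux {A : Set ℂ} (h : Iv a (range ℓ) ⊆ closure A) (h0 : (0:ℂ) ∉ A) :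
    range ℓ ⊆ closure ((fun w : ℂ => a + w⁻¹) '' A) := by
  intro z hz
  have hne : z ≠ a := fun e => ha (e ▸ hz)
  have h1 : (z - a)⁻¹ ∈ closure A := h ((iv_mem hne).2 hz)
  have hc : ContinuousAt (fun w : ℂ => a + w⁻¹) (z - a)⁻¹ :=
    continuousAt_const.add (continuousAt_inv₀ (inv_ne_zero (sub_ne_zero.2 hne)))
  have := hc.continuousWithinAt.mem_closure_image h1
  rwa [inv_inv_a] at this

theorem sub_cl_far : range ℓ ⊆ closure (Far ℓ a) := by
  obtain ⟨γ, hγ, hJ, -⟩ := hℓ.toJ ha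
  rw [hℓ.far_eq ha]
  exact hℓ.closure_aux ha (hJ ▸ hγ.subset_closure_inn) fun h => h.1 (mem_insert _ _)

theorem sub_cl_comp : range ℓ ⊆ closure (connectedComponentIn (range ℓ)ᶜ a) := by
  obtain ⟨γ, hγ, hJ, -⟩ := hℓ.toJ ha
  refine (hℓ.closure_aux ha (hJ ▸ hγ.subset_closure_out) fun h => h.1 (mem_insert _ _)).trans
    (closure_mono ?_)
  rintro _ ⟨w, hw, rfl⟩
  have : w ≠ 0 := fun e => hw.1 (e ▸ mem_insert _ _)
  rw [← out_iff hℓ.closed ha (by simpa using this)]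
  simpa using hw

theorem far_eq_comp {b : ℂ} (hb : b ∈ Far ℓ a) : Far ℓ a = connectedComponentIn (range ℓ)ᶜ b := by
  refine Subset.antisymm (fun z hz => same_comp_of_subset (hℓ.far_preconn ha)
    (fun z hz h => hz (Or.inl h)) hb hz) fun z hz => ?_
  rintro (h | h)
  · exact connectedComponentIn_subset _ _ hz h
  · exact hb (Or.inr (by rw [connectedComponentIn_eq h, ← connectedComponentIn_eq hz]; exact mem_connectedComponentIn fun e => hb (Or.inl e)))

omit ha in
theorem far_far {b : ℂ} (ha : a ∉ range ℓ) (hb : b ∈ Far ℓ a) : Far ℓ b = connectedComponentIn (range ℓ)ᶜ a := by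
  rw [Far, ← hℓ.far_eq_comp ha hb]
  ext z
  simp only [Far, mem_compl_iff, mem_union, not_or, not_not]
  constructor
  · tauto
  · exact fun h => ⟨connectedComponentIn_subset _ _ h, fun h' => h'.2 h⟩

def SD (ℓ : ℝ → ℂ) (a : ℂ) (Φ : ℂ → ℂ) : Prop :=
  ContinuousOn Φ (closedBall 0 1) ∧ InjOn Φ (closedBall 0 1) ∧ Φ (-1) = 0 ∧
    (∀ y : ℝ, Φ ((1 - y * I) / (1 + y * I)) = (ℓ y - a)⁻¹) ∧
    (∀ z, (z ∈ range ℓ ∪ Far ℓ a) ↔ z ≠ a ∧ (z - a)⁻¹ ∈ Φ '' closedBall 0 1)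

theorem side : ∃ Φ : ℂ → ℂ, SD ℓ a Φ := by
  obtain ⟨γ, hγ, hJ, h1, h2⟩ := hℓ.toJ ha
  obtain ⟨Φ, hc, hi, he, him⟩ := hγ.schoenflies
  refine ⟨Φ, hc, hi, by rw [he (by simp), h1], fun y => by rw [he (h2 y).1, (h2 y).2], fun z => ?_⟩
  have : Φ '' closedBall 0 1 = Jor γ ∪ Inn (Jor γ) := by
    rw [← him, ← ball_union_sphere, image_union, union_comm, he.image_eq]; rfl
  rw [this, hJ, mem_union, mem_union, hℓ.far_iff ha]
  rcases eq_or_ne z a with rfl | hne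
  · simpa using ha
  · simp [hne, iv_mem hne]

noncomputable def Gm (Φ Ψ : ℂ → ℂ) (a a' z : ℂ) : ℂ :=
  a' + (Ψ (Function.invFunOn Φ (closedBall 0 1) (z - a)⁻¹))⁻¹

theorem line_map {ℓ' : ℝ → ℂ} {a' : ℂ} {Φ Ψ : ℂ → ℂ} (hΦ : SD ℓ a Φ) (hΨ : SD ℓ' a' Ψ) :
    ContinuousOn (Gm Φ Ψ a a') (range ℓ ∪ Far ℓ a) ∧
    MapsTo (Gm Φ Ψ a a') (range ℓ ∪ Far ℓ a) (range ℓ' ∪ Far ℓ' a') ∧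
    LeftInvOn (Gm Ψ Φ a' a) (Gm Φ Ψ a a') (range ℓ ∪ Far ℓ a) ∧ ∀ y, Gm Φ Ψ a a' (ℓ y) = ℓ' y := by
  obtain ⟨hc, hi, h1, hl, hm⟩ := hΦ
  obtain ⟨hc', hi', h1', hl', hm'⟩ := hΨ
  unfold Gm
  have hinv := contOn_invFunOn (isCompact_closedBall _ _) hc hi
  set Θ := Function.invFunOn Φ (closedBall 0 1)
  have hΘ : ∀ w ∈ Φ '' closedBall 0 1, Θ w ∈ closedBall (0:ℂ) 1 ∧ Φ (Θ w) = w := fun w hw =>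
    ⟨Function.invFunOn_mem hw, Function.invFunOn_eq hw⟩
  have hm1 : (-1 : ℂ) ∈ closedBall (0:ℂ) 1 := by simp
  have hne : ∀ z ∈ range ℓ ∪ Far ℓ a, Θ (z - a)⁻¹ ∈ closedBall (0:ℂ) 1 ∧ Ψ (Θ (z - a)⁻¹) ≠ 0 := by
    intro z hz
    obtain ⟨hza, hz2⟩ := (hm z).1 hz
    refine ⟨(hΘ _ hz2).1, fun h => ?_⟩
    have := hi' (hΘ _ hz2).1 hm1 (h.trans h1'.symm)
    have h3 := (hΘ _ hz2).2
    rw [this, h1] at h3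
    exact inv_ne_zero (sub_ne_zero.2 hza) h3.symm
  refine ⟨?_, ?_, ?_, ?_⟩
  · refine continuousOn_const.add (ContinuousOn.inv₀ ?_ fun z hz => (hne z hz).2)
    refine hc'.comp (hinv.comp ?_ fun z hz => ((hm z).1 hz).2) fun z hz => (hne z hz).1
    exact (continuousOn_id.sub continuousOn_const).inv₀ fun z hz => sub_ne_zero.2 ((hm z).1 hz).1
  · intro z hz
    rw [hm']
    refine ⟨by simpa using (hne z hz).2, ?_⟩
    simp only [add_sub_cancel_left, inv_inv]
    exact mem_image_of_mem _ (hne z hz).1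
  · intro z hz
    simp only [add_sub_cancel_left, inv_inv]
    rw [hi'.leftInvOn_invFunOn (hne z hz).1, (hΘ _ ((hm z).1 hz).2).2, inv_inv]; ring
  · intro y
    have hs : (1 - y * I : ℂ) / (1 + y * I) ∈ closedBall (0:ℂ) 1 := by
      obtain ⟨_, _, _, _, h2⟩ := hℓ.toJ ha
      exact sphere_subset_closedBall (h2 y).1
    have hT : Θ (Φ ((1 - y * I) / (1 + y * I))) = (1 - y * I) / (1 + y * I) := hi.leftInvOn_invFunOn hs
    rw [← hl y, hT, hl' y, inv_inv]; ring

omit ha in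
theorem line_iso (ha : a ∉ range ℓ) {ℓ' : ℝ → ℂ} (hℓ' : PLine ℓ') {a' : ℂ} (ha' : a' ∉ range ℓ') : ∃ G G' : ℂ → ℂ,
    ContinuousOn G (range ℓ ∪ Far ℓ a) ∧ MapsTo G (range ℓ ∪ Far ℓ a) (range ℓ' ∪ Far ℓ' a') ∧
    ContinuousOn G' (range ℓ' ∪ Far ℓ' a') ∧ MapsTo G' (range ℓ' ∪ Far ℓ' a') (range ℓ ∪ Far ℓ a) ∧
    LeftInvOn G' G (range ℓ ∪ Far ℓ a) ∧ LeftInvOn G G' (range ℓ' ∪ Far ℓ' a') ∧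
    (∀ y, G (ℓ y) = ℓ' y) ∧ ∀ y, G' (ℓ' y) = ℓ y := by
  obtain ⟨Φ, hΦ⟩ := hℓ.side ha
  obtain ⟨Ψ, hΨ⟩ := hℓ'.side ha'
  obtain ⟨a1, a2, a3, a4⟩ := hℓ.line_map ha hΦ hΨ
  obtain ⟨b1, b2, b3, b4⟩ := hℓ'.line_map ha' hΨ hΦ
  exact ⟨_, _, a1, a2, b1, b2, a3, b3, a4, b4⟩
end PLine

theorem PLine.comp_homeo {ℓ : ℝ → ℂ} (hℓ : PLine ℓ) (h : ℝ ≃ₜ ℝ) : PLine (fun y => ℓ (h y)) :=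
  ⟨hℓ.cont.comp h.continuous, hℓ.inj.comp h.injective,
    hℓ.proper.comp h.isClosedEmbedding.tendsto_cocompact⟩

theorem PLine.map {ℓ : ℝ → ℂ} (hℓ : PLine ℓ) (h : ℂ ≃ₜ ℂ) : PLine (fun y => h (ℓ y)) :=
  ⟨h.continuous.comp hℓ.cont, h.injective.comp hℓ.inj,
    h.isClosedEmbedding.tendsto_cocompact.comp hℓ.proper⟩

theorem PLine.neg {ℓ : ℝ → ℂ} (hℓ : PLine ℓ) : PLine (fun y => ℓ (-y)) :=
  hℓ.comp_homeo (Homeomorph.neg ℝ)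

theorem rng_neg (ℓ : ℝ → ℂ) : range (fun y => ℓ (-y)) = range ℓ :=
  (neg_surjective (G := ℝ)).range_comp ℓ

noncomputable def cc (A α B : ℝ → ℂ) (y : ℝ) : ℂ :=
  if y ≤ 0 then A (-y) else if y ≤ 1 then α y else B (y - 1)

theorem cc_neg {A α B : ℝ → ℂ} {y : ℝ} (h : y ≤ 0) : cc A α B y = A (-y) := if_pos h

theorem cc_arc {A α B : ℝ → ℂ} (h0 : A 0 = α 0) {y : ℝ} (h : y ∈ Icc (0:ℝ) 1) : cc A α B y = α y := by
  rcases h.1.eq_or_lt with rfl | h'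
  · simp [cc, h0]
  · simp [cc, not_le.2 h', h.2]

theorem cc_pos {A α B : ℝ → ℂ} (h1 : α 1 = B 0) {y : ℝ} (h : 1 ≤ y) : cc A α B y = B (y - 1) := by
  rcases h.eq_or_lt with rfl | h'
  · simp [cc, h1]
  · simp [cc, not_le.2 h', not_le.2 (zero_lt_one.trans h')]

theorem mem_cc {A α B : ℝ → ℂ} (h0 : A 0 = α 0) (h1 : α 1 = B 0) {z : ℂ} : z ∈ range (cc A α B) ↔
    (∃ s, 0 ≤ s ∧ A s = z) ∨ (∃ t ∈ Icc (0:ℝ) 1, α t = z) ∨ ∃ s, 0 ≤ s ∧ B s = z := by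
  constructor
  · rintro ⟨y, rfl⟩
    rcases le_total y 0 with h | h
    · exact Or.inl ⟨-y, by linarith, (cc_neg h).symm⟩
    rcases le_total y 1 with h' | h'
    · exact Or.inr (Or.inl ⟨y, ⟨h, h'⟩, (cc_arc h0 ⟨h, h'⟩).symm⟩)
    · exact Or.inr (Or.inr ⟨y - 1, by linarith, (cc_pos h1 h').symm⟩)
  · rintro (⟨s, hs, rfl⟩ | ⟨s, hs, rfl⟩ | ⟨s, hs, rfl⟩)
    · exact ⟨-s, by rw [cc_neg (by linarith), neg_neg]⟩
    · exact ⟨s, cc_arc h0 hs⟩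
    · exact ⟨s + 1, by rw [cc_pos h1 (by linarith), add_sub_cancel_right]⟩

theorem cc_pline {A α B : ℝ → ℂ} (hA : PLine A) (hB : PLine B) (hα : Continuous α)
    (hi : InjOn α (Icc 0 1)) (h0 : A 0 = α 0) (h1 : α 1 = B 0) (hAB : ∀ s t, A s ≠ B t)
    (hαA : ∀ t ∈ Icc (0:ℝ) 1, ∀ s, α t = A s → t = 0)
    (hαB : ∀ t ∈ Icc (0:ℝ) 1, ∀ s, α t = B s → t = 1) : PLine (cc A α B) := by
  refine ⟨?_, ?_, ?_⟩
  · refine Continuous.if_le (hA.cont.comp continuous_neg)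
      (Continuous.if_le hα (hB.cont.comp (continuous_id.sub continuous_const)) continuous_id
        continuous_const fun x hx => ?_) continuous_id continuous_const fun x hx => ?_
    · simp [show x = 1 from hx, h1]
    · simp [show x = 0 from hx, h0]
  · have key : ∀ x y, x < y → cc A α B x ≠ cc A α B y := by
      intro x y hxy e
      rcases le_or_gt x 0 with hx | hx
      · rw [cc_neg hx] at e
        rcases le_or_gt y 0 with hy | hy
        · rw [cc_neg hy] at e; linarith [hA.inj e]
        rcases le_or_gt y 1 with hy' | hy'
        · rw [cc_arc h0 ⟨hy.le, hy'⟩] at e; exact hy.ne' (hαA y ⟨hy.le, hy'⟩ _ e.symm)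
        · rw [cc_pos h1 hy'.le] at e; exact hAB _ _ e
      rcases le_or_gt x 1 with hx' | hx'
      · rw [cc_arc h0 ⟨hx.le, hx'⟩] at e
        rcases le_or_gt y 1 with hy' | hy'
        · rw [cc_arc h0 ⟨(hx.trans hxy).le, hy'⟩] at e
          exact hxy.ne (hi ⟨hx.le, hx'⟩ ⟨(hx.trans hxy).le, hy'⟩ e)
        · rw [cc_pos h1 hy'.le] at e
          have h2 := hαB x ⟨hx.le, hx'⟩ _ e
          subst h2; rw [h1] at e; linarith [hB.inj e]
      · rw [cc_pos h1 hx'.le, cc_pos h1 (hx'.trans hxy).le] at e; linarith [hB.inj e]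
    intro x y e
    by_contra h
    rcases lt_or_gt_of_ne h with h | h
    · exact key _ _ h e
    · exact key _ _ h e.symm
  · rw [cocompact_eq_atBot_atTop, tendsto_sup]
    have hA' := hA.proper; have hB' := hB.proper
    rw [cocompact_eq_atBot_atTop, tendsto_sup] at hA' hB'
    constructor
    · refine (hA'.2.comp tendsto_neg_atBot_atTop).congr' ?_
      filter_upwards [eventually_le_atBot 0] with y hy using (cc_neg hy).symm
    · refine (hB'.2.comp (tendsto_atTop_add_const_right _ (-1) tendsto_id)).congr' ?_
      filter_upwards [eventually_ge_atTop 1] with y hy using (cc_pos h1 hy).symm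

theorem ray_arc {A α : ℝ → ℂ} (hA : PLine A) (hα : Continuous α) {c : ℝ} (hc : c ∈ Icc (0:ℝ) 1)
    (h : A 0 = α c) : IsPreconnected (A '' Ici 0 ∪ α '' Icc 0 1) ∧
      ¬ Bornology.IsBounded (A '' Ici 0 ∪ α '' Icc 0 1) := by
  constructor
  · exact IsPreconnected.union (A 0) ⟨0, self_mem_Ici, rfl⟩ (h ▸ ⟨c, hc, rfl⟩)
      (isPreconnected_Ici.image _ hA.cont.continuousOn) (isPreconnected_Icc.image _ hα.continuousOn)
  · intro hb
    have hK := (hb.subset subset_union_left).isCompact_closure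
    have h1 := hA.proper
    rw [cocompact_eq_atBot_atTop, tendsto_sup] at h1
    obtain ⟨y, hy, hy0⟩ := ((h1.2.eventually hK.compl_mem_cocompact).and (eventually_ge_atTop 0)).exists
    exact hy (subset_closure ⟨y, hy0, rfl⟩)

structure Sys (L M α : ℝ → ℂ) (a b : ℂ) : Prop where
  hL : PLine L
  hM : PLine M
  αc : Continuous α
  αi : InjOn α (Icc 0 1)
  α0 : L 0 = α 0
  α1 : α 1 = M 0
  LM : ∀ s t, L s ≠ M t
  αL : ∀ t ∈ Icc (0:ℝ) 1, ∀ s, α t = L s → t = 0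
  αM : ∀ t ∈ Icc (0:ℝ) 1, ∀ s, α t = M s → t = 1
  ha : a ∉ range L
  hb : b ∉ range M
  VW : Disjoint (connectedComponentIn (range L)ᶜ a) (connectedComponentIn (range M)ᶜ b)
  V' : ∀ z ∈ connectedComponentIn (range L)ᶜ a, z ∉ range M ∪ α '' Icc 0 1
  W' : ∀ z ∈ connectedComponentIn (range M)ᶜ b, z ∉ range L ∪ α '' Icc 0 1

namespace Sys
variable {L M α : ℝ → ℂ} {a b : ℂ} (h : Sys L M α a b)
include h

theorem neg : Sys L (fun y => M (-y)) α a b :=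
  ⟨h.hL, h.hM.neg, h.αc, h.αi, h.α0, by simpa using h.α1, fun s t => h.LM s _, h.αL,
    fun t ht s e => h.αM t ht _ e, h.ha, by rw [rng_neg]; exact h.hb, by rw [rng_neg]; exact h.VW,
    by rw [rng_neg]; exact h.V', by rw [rng_neg]; exact h.W'⟩

theorem swap : Sys (fun y => M (-y)) (fun y => L (-y)) (fun t => α (1 - t)) b a := by
  have hr : ∀ t ∈ Icc (0:ℝ) 1, 1 - t ∈ Icc (0:ℝ) 1 := fun t ht => ⟨by linarith [ht.2], by linarith [ht.1]⟩
  have hi : (fun t => α (1 - t)) '' Icc 0 1 ⊆ α '' Icc 0 1 := by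
    rintro _ ⟨t, ht, rfl⟩; exact ⟨_, hr t ht, rfl⟩
  refine ⟨h.hM.neg, h.hL.neg, h.αc.comp (continuous_const.sub continuous_id), ?_, by simpa using h.α1.symm,
    by simpa using h.α0.symm, fun s t => (h.LM _ _).symm, fun t ht s e => ?_, fun t ht s e => ?_, ?_, ?_,
    ?_, ?_, ?_⟩
  · intro t ht u hu e; linarith [h.αi (hr t ht) (hr u hu) e]
  · linarith [h.αM _ (hr t ht) _ e]
  · linarith [h.αL _ (hr t ht) _ e]
  · rw [rng_neg]; exact h.hb
  · rw [rng_neg]; exact h.ha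
  · rw [rng_neg, rng_neg]; exact h.VW.symm
  · rw [rng_neg, rng_neg]; exact fun z hz hz' => h.W' z hz (hz'.imp_right (hi ·))
  · rw [rng_neg, rng_neg]; exact fun z hz hz' => h.V' z hz (hz'.imp_right (hi ·))

def _root_.BSep (L M α : ℝ → ℂ) (a b : ℂ) : Prop :=
  b ∉ connectedComponentIn (range (cc L α fun y => M (-y)))ᶜ a

theorem ccp : PLine (cc L α M) :=
  cc_pline h.hL h.hM h.αc h.αi h.α0 h.α1 h.LM h.αL h.αM

theorem negL : Sys (fun y => L (-y)) M α a b :=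
  ⟨h.hL.neg, h.hM, h.αc, h.αi, by simpa using h.α0, h.α1, fun s t => h.LM _ _,
    fun t ht s e => h.αL t ht _ e, h.αM, by rw [rng_neg]; exact h.ha, h.hb, by rw [rng_neg]; exact h.VW,
    by rw [rng_neg]; exact h.V', by rw [rng_neg]; exact h.W'⟩

theorem av {z : ℂ} (hz : z ∈ connectedComponentIn (range L)ᶜ a) : z ∉ range (cc L α M) := by
  rw [mem_cc h.α0 h.α1]
  rintro (⟨s, _, e⟩ | ⟨s, hs, e⟩ | ⟨s, _, e⟩)
  · exact connectedComponentIn_subset _ _ hz ⟨s, e⟩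
  · exact h.V' z hz (Or.inr ⟨s, hs, e⟩)
  · exact h.V' z hz (Or.inl ⟨s, e⟩)

theorem aw {z : ℂ} (hz : z ∈ connectedComponentIn (range M)ᶜ b) : z ∉ range (cc L α M) := by
  rw [mem_cc h.α0 h.α1]
  rintro (⟨s, _, e⟩ | ⟨s, hs, e⟩ | ⟨s, _, e⟩)
  · exact h.W' z hz (Or.inl ⟨s, e⟩)
  · exact h.W' z hz (Or.inr ⟨s, hs, e⟩)
  · exact connectedComponentIn_subset _ _ hz ⟨s, e⟩

theorem aV : a ∈ connectedComponentIn (range L)ᶜ a := mem_connectedComponentIn h.ha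
theorem bW : b ∈ connectedComponentIn (range M)ᶜ b := mem_connectedComponentIn h.hb

theorem interM : range (cc L α fun y => M (-y)) ∩ range (cc L α M) = L '' Ici 0 ∪ α '' Icc 0 1 := by
  ext z
  rw [mem_inter_iff, mem_cc h.α0 h.α1, mem_cc h.α0 h.neg.α1]
  constructor
  · rintro ⟨h1, h2⟩
    rcases h1 with ⟨s, hs, e⟩ | ⟨s, hs, e⟩ | ⟨s, hs, e⟩
    · exact Or.inl ⟨s, hs, e⟩
    · exact Or.inr ⟨s, hs, e⟩
    rcases h2 with ⟨t, ht, e'⟩ | ⟨t, ht, e'⟩ | ⟨t, ht, e'⟩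
    · exact Or.inl ⟨t, ht, e'⟩
    · exact Or.inr ⟨t, ht, e'⟩
    have := h.hM.inj (e.trans e'.symm)
    have : t = 0 := by linarith
    subst this
    exact Or.inr ⟨1, ⟨zero_le_one, le_rfl⟩, h.α1.trans e'⟩
  · rintro (⟨s, hs, e⟩ | ⟨s, hs, e⟩)
    · exact ⟨Or.inl ⟨s, hs, e⟩, Or.inl ⟨s, hs, e⟩⟩
    · exact ⟨Or.inr (Or.inl ⟨s, hs, e⟩), Or.inr (Or.inl ⟨s, hs, e⟩)⟩

theorem subM : range M ⊆ range (cc L α fun y => M (-y)) ∪ range (cc L α M) := by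
  rintro _ ⟨y, rfl⟩
  rcases le_total y 0 with hy | hy
  · exact Or.inl ((mem_cc h.α0 h.neg.α1).2 (Or.inr (Or.inr ⟨-y, by linarith, by simp⟩)))
  · exact Or.inr ((mem_cc h.α0 h.α1).2 (Or.inr (Or.inr ⟨y, hy, rfl⟩)))

theorem janM {z w : ℂ} (hw : w ∉ range (cc L α fun y => M (-y))) (hw' : w ∉ range (cc L α M))
    (h1 : z ∈ connectedComponentIn (range (cc L α fun y => M (-y)))ᶜ w)
    (h2 : z ∈ connectedComponentIn (range (cc L α M))ᶜ w) : z ∈ connectedComponentIn (range M)ᶜ w := by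
  have hr := ray_arc h.hL h.αc (c := 0) (by simp) h.α0
  have := jan_inf h.neg.ccp.closed h.ccp.closed (by rw [h.interM]; exact hr.1)
    (by rw [h.interM]; exact hr.2) hw hw' h1 h2
  exact connectedComponentIn_mono _ (compl_subset_compl.2 h.subM) this

theorem sep : BSep L M α a b ∨ BSep L (fun y => M (-y)) α a b := by
  unfold BSep
  simp only [neg_neg]
  by_contra! hc
  have := h.janM (h.neg.av h.aV) (h.av h.aV) hc.1 hc.2
  have h1 : a ∈ connectedComponentIn (range M)ᶜ b := by
    rw [← connectedComponentIn_eq this]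
    exact mem_connectedComponentIn fun e => h.V' a h.aV (Or.inl e)
  exact disjoint_left.1 h.VW h.aV h1

omit h in
theorem _root_.cc_rev {A α B : ℝ → ℂ} (h0 : A 0 = α 0) (h1 : α 1 = B 0) :
    range (cc B (fun t => α (1 - t)) A) = range (cc A α B) := by
  ext z
  rw [mem_cc h0 h1, mem_cc (by simp [h1]) (by simp [h0])]
  have : (∃ t ∈ Icc (0:ℝ) 1, α (1 - t) = z) ↔ ∃ t ∈ Icc (0:ℝ) 1, α t = z := by
    constructor
    · rintro ⟨t, ht, e⟩; exact ⟨1 - t, ⟨by linarith [ht.2], by linarith [ht.1]⟩, e⟩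
    · rintro ⟨t, ht, e⟩; exact ⟨1 - t, ⟨by linarith [ht.2], by linarith [ht.1]⟩, by simpa using e⟩
  rw [this]
  exact ⟨fun h => h.elim (Or.inr ∘ Or.inr) fun h => h.elim (Or.inr ∘ Or.inl) Or.inl,
    fun h => h.elim (Or.inr ∘ Or.inr) fun h => h.elim (Or.inr ∘ Or.inl) Or.inl⟩

theorem swap' : Sys M L (fun t => α (1 - t)) b a := by
  have := h.neg.negL.swap
  simpa only [neg_neg] using this

theorem janL {z w : ℂ} (hw : w ∉ range (cc (fun y => L (-y)) α M)) (hw' : w ∉ range (cc L α M))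
    (h1 : z ∈ connectedComponentIn (range (cc (fun y => L (-y)) α M))ᶜ w)
    (h2 : z ∈ connectedComponentIn (range (cc L α M))ᶜ w) : z ∈ connectedComponentIn (range L)ᶜ w := by
  rw [← cc_rev h.α0 h.α1] at hw' h2
  rw [← cc_rev h.negL.α0 h.α1] at hw h1
  exact h.swap'.janM hw hw' h1 h2

theorem half (hB : b ∉ connectedComponentIn (range (cc L α M))ᶜ a) :
    (∀ s < 0, L s ∈ connectedComponentIn (range (cc L α M))ᶜ a) ∧
    Far (cc (fun y => L (-y)) α M) a ⊆ connectedComponentIn (range (cc L α M))ᶜ a ∧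
    (∀ z ∈ connectedComponentIn (range (cc L α M))ᶜ a, z ∈ connectedComponentIn (range L)ᶜ a ∨
      z ∈ range (cc (fun y => L (-y)) α M) ∪ Far (cc (fun y => L (-y)) α M) a) ∧
    connectedComponentIn (range L)ᶜ a ⊆ connectedComponentIn (range (cc (fun y => L (-y)) α M))ᶜ a ∧
    connectedComponentIn (range M)ᶜ b ⊆ connectedComponentIn (range (cc (fun y => L (-y)) α M))ᶜ a := by
  have hV := h.hL.sub_cl_comp h.ha
  set V := connectedComponentIn (range L)ᶜ a with hVd
  have hVp : IsPreconnected V := isPreconnected_connectedComponentIn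
  set B := range (cc L α M) with hBd
  set C := range (cc (fun y => L (-y)) α M) with hCd
  have memB : ∀ {z}, z ∈ B ↔ _ := mem_cc h.α0 h.α1
  have memC : ∀ {z}, z ∈ C ↔ _ := mem_cc h.negL.α0 h.α1
  have haB : a ∉ B := h.av h.aV
  have hVC : ∀ z ∈ V, z ∉ C := fun z hz => h.negL.av (by rw [rng_neg]; exact hz)
  have hbB : b ∉ B := h.aw h.bW
  have ext : ∀ I : Set ℝ, IsPreconnected (V ∪ L '' I) := fun I =>
    hVp.subset_closure subset_union_left (union_subset subset_closure ((image_subset_range _ _).trans hV))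
  have c1 : ∀ s < 0, L s ∈ connectedComponentIn Bᶜ a := by
    intro s hs
    refine same_comp_of_subset (ext (Iio 0)) ?_ (Or.inl h.aV) (Or.inr ⟨s, hs, rfl⟩)
    rintro z (hz | ⟨t, ht, rfl⟩)
    · exact h.av hz
    · rw [mem_compl_iff, memB]
      rintro (⟨s, hs, e⟩ | ⟨s, hs, e⟩ | ⟨s, hs, e⟩)
      · rw [h.hL.inj e] at hs; exact absurd hs (not_le.2 ht)
      · have := h.αL s hs _ e
        rw [this, ← h.α0] at e
        exact ht.ne (h.hL.inj e).symm
      · exact h.LM _ _ e.symm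
  have hbF : b ∈ Far (cc L α M) a := fun hb => hb.elim hbB hB
  have hF := h.ccp.far_eq_comp haB hbF
  have c4 : V ∪ L '' Ioi 0 ⊆ connectedComponentIn Cᶜ a := by
    refine (ext (Ioi 0)).subset_connectedComponentIn (Or.inl h.aV) ?_
    rintro z (hz | ⟨t, ht, rfl⟩)
    · exact hVC z hz
    · rw [mem_compl_iff, memC]
      rintro (⟨s, hs, e⟩ | ⟨s, hs, e⟩ | ⟨s, hs, e⟩)
      · have := h.hL.inj e; have : 0 < t := ht; linarith
      · have := h.αL s hs _ e
        rw [this, ← h.α0] at e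
        exact (ne_of_gt ht) (h.hL.inj e).symm
      · exact h.LM _ _ e.symm
  have c5 : Far (cc L α M) a ⊆ connectedComponentIn Cᶜ a := by
    have h1 : L 1 ∈ connectedComponentIn Cᶜ a := c4 (Or.inr ⟨1, mem_Ioi.2 zero_lt_one, rfl⟩)
    have h2 : L 1 ∈ closure (Far (cc L α M) a) :=
      h.ccp.sub_cl_far haB (memB.2 (Or.inl ⟨1, zero_le_one, rfl⟩))
    have h3 : IsPreconnected (insert (L 1) (Far (cc L α M) a)) :=
      (h.ccp.far_preconn haB).subset_closure (subset_insert _ _) (insert_subset h2 subset_closure)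
    rw [connectedComponentIn_eq h1]
    refine (subset_insert _ _).trans (h3.subset_connectedComponentIn (mem_insert _ _) ?_)
    rintro z (rfl | hz)
    · exact connectedComponentIn_subset _ _ h1
    · rw [mem_compl_iff, memC]
      rintro (⟨s, hs, e⟩ | ⟨s, hs, e⟩ | ⟨s, hs, e⟩)
      · rcases hs.eq_or_lt with rfl | hs
        · exact hz (Or.inl (memB.2 (Or.inl ⟨0, le_rfl, by simpa using e⟩)))
        · exact hz (Or.inr (e ▸ c1 (-s) (by linarith)))
      · exact hz (Or.inl (memB.2 (Or.inr (Or.inl ⟨s, hs, e⟩))))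
      · exact hz (Or.inl (memB.2 (Or.inr (Or.inr ⟨s, hs, e⟩))))
  refine ⟨c1, fun z hz => ?_, fun z hz => ?_, subset_union_left.trans c4, ?_⟩
  · by_contra hzB
    by_cases hz1 : z ∈ B
    · rcases memB.1 hz1 with ⟨s, hs, e⟩ | h2 | h2
      · rcases hs.eq_or_lt with rfl | hs
        · exact hz (Or.inl (memC.2 (Or.inl ⟨0, le_rfl, by simpa using e⟩)))
        · exact hz (Or.inr (c4 (Or.inr ⟨s, hs, e⟩)))
      · exact hz (Or.inl (memC.2 (Or.inr (Or.inl h2))))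
      · exact hz (Or.inl (memC.2 (Or.inr (Or.inr h2))))
    · exact hz (Or.inr (c5 fun hh => hh.elim hz1 hzB))
  · by_contra! hc
    have h1 : z ∈ connectedComponentIn Cᶜ a := by
      by_contra h2; exact hc.2 (Or.inr fun hh => hh.elim (fun h3 => hc.2 (Or.inl h3)) h2)
    exact hc.1 (h.janL (hVC a h.aV) haB h1 hz)
  · refine Subset.trans ?_ c5
    rw [hF]
    exact isPreconnected_connectedComponentIn.subset_connectedComponentIn h.bW fun z hz => h.aw hz

theorem split (hB : BSep L M α a b) :
    (range (cc (fun y => L (-y)) α fun y => M (-y)) ∪ Far (cc (fun y => L (-y)) α fun y => M (-y)) a) ∪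
      (range (cc L α M) ∪ Far (cc L α M) b) =
      (connectedComponentIn (range L)ᶜ a ∪ connectedComponentIn (range M)ᶜ b)ᶜ ∧
    (range (cc (fun y => L (-y)) α fun y => M (-y)) ∪ Far (cc (fun y => L (-y)) α fun y => M (-y)) a) ∩
      (range (cc L α M) ∪ Far (cc L α M) b) ⊆ α '' Icc 0 1 := by
  unfold BSep at hB
  obtain ⟨p1, p2, p3, p4, p5⟩ := h.neg.half hB
  have hab : a ∉ connectedComponentIn (range (cc L α fun y => M (-y)))ᶜ b := fun hh => hB (by
    rw [← connectedComponentIn_eq hh]; exact mem_connectedComponentIn (h.neg.aw h.neg.bW))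
  have hdis : ∀ z, z ∈ connectedComponentIn (range (cc L α fun y => M (-y)))ᶜ a →
      z ∉ connectedComponentIn (range (cc L α fun y => M (-y)))ᶜ b := fun z hz hz' => hab (by
    rw [connectedComponentIn_eq hz', ← connectedComponentIn_eq hz]
    exact mem_connectedComponentIn (h.neg.av h.aV))
  have hs := h.neg.swap'
  have hh := hs.half (by rw [cc_rev h.α0 h.neg.α1]; exact hab)
  simp only [neg_neg, Far] at hh
  rw [cc_rev h.α0 h.neg.α1, cc_rev h.α0 h.α1] at hh
  rw [rng_neg] at hh p5
  obtain ⟨q1, q2, q3, q4, q5⟩ := hh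
  have memB : ∀ {z}, z ∈ range (cc L α fun y => M (-y)) ↔ _ := mem_cc h.α0 h.neg.α1
  have memC : ∀ {z}, z ∈ range (cc (fun y => L (-y)) α fun y => M (-y)) ↔ _ := mem_cc h.negL.α0 h.neg.α1
  have memD : ∀ {z}, z ∈ range (cc L α M) ↔ _ := mem_cc h.α0 h.α1
  constructor
  · ext z
    constructor
    · rintro (hz | hz) (hv | hw)
      · exact hz.elim (h.neg.negL.av (by rw [rng_neg]; exact hv)) fun hz => hz (Or.inr (p4 hv))
      · exact hz.elim (h.neg.negL.aw (by rw [rng_neg]; exact hw)) fun hz => hz (Or.inr (p5 hw))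
      · exact hz.elim (h.av hv) fun hz => hz (Or.inr (q5 hv))
      · exact hz.elim (h.aw hw) fun hz => hz (Or.inr (q4 hw))
    · intro hz
      by_cases hzB : z ∈ range (cc L α fun y => M (-y))
      · rcases memB.1 hzB with h2 | h2 | h2
        · exact Or.inr (Or.inl (memD.2 (Or.inl h2)))
        · exact Or.inr (Or.inl (memD.2 (Or.inr (Or.inl h2))))
        · exact Or.inl (Or.inl (memC.2 (Or.inr (Or.inr h2))))
      · by_cases hza : z ∈ connectedComponentIn (range (cc L α fun y => M (-y)))ᶜ a
        · exact Or.inl ((p3 z hza).resolve_left fun hh => hz (Or.inl hh))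
        · have hbF : b ∈ Far (cc L α fun y => M (-y)) a := fun hb => hb.elim (h.neg.aw h.neg.bW) hB
          have hzF : z ∈ Far (cc L α fun y => M (-y)) a := fun hb => hb.elim hzB hza
          rw [h.neg.ccp.far_eq_comp (h.neg.av h.aV) hbF] at hzF
          exact Or.inr ((q3 z hzF).resolve_left fun hh => hz (Or.inr hh))
  · rintro z ⟨hz | hz, hz' | hz'⟩
    · rcases memC.1 hz with ⟨s, hs, e⟩ | h2 | ⟨s, hs, e⟩
      · rcases memD.1 hz' with ⟨t, ht, e'⟩ | h2 | ⟨t, ht, e'⟩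
        · have := h.hL.inj (e.trans e'.symm)
          exact ⟨0, by simp, by rw [← h.α0, ← e', show t = 0 by linarith]⟩
        · exact h2
        · exact absurd (e.trans e'.symm) (h.LM _ _)
      · exact h2
      · rcases memD.1 hz' with ⟨t, ht, e'⟩ | h2 | ⟨t, ht, e'⟩
        · exact absurd (e'.trans e.symm) (h.LM _ _)
        · exact h2
        · have := h.hM.inj (e.trans e'.symm)
          exact ⟨1, by simp, by rw [h.α1, ← e', show t = 0 by linarith]⟩
    · have h3 := q2 hz'
      rcases memC.1 hz with ⟨s, hs, e⟩ | h2 | h2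
      · rcases hs.eq_or_lt with rfl | hs
        · exact absurd (memB.2 (Or.inl ⟨0, le_rfl, by simpa using e⟩)) (connectedComponentIn_subset _ _ h3)
        · exact absurd h3 (hdis z (e ▸ p1 (-s) (by linarith)))
      · exact absurd (memB.2 (Or.inr (Or.inl h2))) (connectedComponentIn_subset _ _ h3)
      · exact absurd (memB.2 (Or.inr (Or.inr h2))) (connectedComponentIn_subset _ _ h3)
    · have h3 := p2 hz
      rcases memD.1 hz' with h2 | h2 | ⟨s, hs, e⟩
      · exact absurd (memB.2 (Or.inl h2)) (connectedComponentIn_subset _ _ h3)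
      · exact absurd (memB.2 (Or.inr (Or.inl h2))) (connectedComponentIn_subset _ _ h3)
      · rcases hs.eq_or_lt with rfl | hs
        · exact absurd (memB.2 (Or.inr (Or.inr ⟨0, le_rfl, by simpa using e⟩))) (connectedComponentIn_subset _ _ h3)
        · exact absurd (e ▸ (by simpa using q1 (-s) (by linarith))) (hdis z h3)
    · exact absurd (q2 hz') (hdis z (p2 hz))

end Sys

theorem glue_maps {X Y : Set ℂ} {G H : ℂ → ℂ} (hX : IsClosed X) (hY : IsClosed Y)
    (hG : ContinuousOn G X) (hH : ContinuousOn H Y) (e : ∀ z ∈ X ∩ Y, G z = H z) :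
    ∃ F : ℂ → ℂ, ContinuousOn F (X ∪ Y) ∧ EqOn F G X ∧ EqOn F H Y := by
  classical
  have h1 : EqOn (fun z => if z ∈ X then G z else H z) G X := fun z hz => if_pos hz
  have h2 : EqOn (fun z => if z ∈ X then G z else H z) H Y := fun z hz => by
    by_cases h : z ∈ X
    · simp only [h, if_true]; exact e z ⟨h, hz⟩
    · simp [h]
  exact ⟨_, (hG.congr h1).union_of_isClosed (hH.congr h2) hX hY, h1, h2⟩

theorem Sys.iso {L M α L' M' α' : ℝ → ℂ} {a b a' b' : ℂ} (h : Sys L M α a b) (hB : BSep L M α a b)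
    (h' : Sys L' M' α' a' b') (hB' : BSep L' M' α' a' b') : ∃ F F' : ℂ → ℂ,
    ContinuousOn F (connectedComponentIn (range L)ᶜ a ∪ connectedComponentIn (range M)ᶜ b)ᶜ ∧
    ContinuousOn F' (connectedComponentIn (range L')ᶜ a' ∪ connectedComponentIn (range M')ᶜ b')ᶜ ∧
    MapsTo F (connectedComponentIn (range L)ᶜ a ∪ connectedComponentIn (range M)ᶜ b)ᶜ
      (connectedComponentIn (range L')ᶜ a' ∪ connectedComponentIn (range M')ᶜ b')ᶜ ∧
    MapsTo F' (connectedComponentIn (range L')ᶜ a' ∪ connectedComponentIn (range M')ᶜ b')ᶜ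
      (connectedComponentIn (range L)ᶜ a ∪ connectedComponentIn (range M)ᶜ b)ᶜ ∧
    LeftInvOn F' F (connectedComponentIn (range L)ᶜ a ∪ connectedComponentIn (range M)ᶜ b)ᶜ ∧
    LeftInvOn F F' (connectedComponentIn (range L')ᶜ a' ∪ connectedComponentIn (range M')ᶜ b')ᶜ ∧
    (∀ y, F (L y) = L' y) ∧ (∀ y, F (M y) = M' y) ∧ (∀ y, F' (L' y) = L y) ∧ (∀ y, F' (M' y) = M y) := by
  obtain ⟨s1, s2⟩ := h.split hB
  obtain ⟨s1', s2'⟩ := h'.split hB'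
  rw [← s1, ← s1']
  have hn := h.neg.negL
  have hn' := h'.neg.negL
  have haC : a ∉ range (cc (fun y => L (-y)) α fun y => M (-y)) := hn.av hn.aV
  have haC' : a' ∉ range (cc (fun y => L' (-y)) α' fun y => M' (-y)) := hn'.av hn'.aV
  have hbD : b ∉ range (cc L α M) := h.aw h.bW
  have hbD' : b' ∉ range (cc L' α' M') := h'.aw h'.bW
  obtain ⟨G, G', g1, g2, g3, g4, g5, g6, g7, g8⟩ := hn.ccp.line_iso haC hn'.ccp haC'
  obtain ⟨H, H', k1, k2, k3, k4, k5, k6, k7, k8⟩ := h.ccp.line_iso hbD h'.ccp hbD'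
  have hcl : ∀ {ℓ : ℝ → ℂ} {c : ℂ}, PLine ℓ → c ∉ range ℓ → IsClosed (range ℓ ∪ Far ℓ c) := by
    intro ℓ c hℓ hc
    have : range ℓ ∪ Far ℓ c = (connectedComponentIn (range ℓ)ᶜ c)ᶜ := by
      ext z
      simp only [Far, mem_union, mem_compl_iff, not_or]
      constructor
      · rintro (h | h) h'
        · exact connectedComponentIn_subset _ _ h' h
        · exact h.2 h'
      · intro h; by_cases h2 : z ∈ range ℓ
        · exact Or.inl h2
        · exact Or.inr ⟨h2, h⟩
    rw [this]; exact (isOpen_comp hℓ.closed c).isClosed_compl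
  have lnC : ∀ y ≤ 0, cc (fun y => L (-y)) α (fun y => M (-y)) y = L y := fun y hy => by rw [cc_neg hy]; simp
  have lnC' : ∀ y ≤ 0, cc (fun y => L' (-y)) α' (fun y => M' (-y)) y = L' y := fun y hy => by rw [cc_neg hy]; simp
  have mnC : ∀ y ≤ 0, cc (fun y => L (-y)) α (fun y => M (-y)) (1 - y) = M y := fun y hy => by
    rw [cc_pos hn.α1 (by linarith)]; simp
  have mnC' : ∀ y ≤ 0, cc (fun y => L' (-y)) α' (fun y => M' (-y)) (1 - y) = M' y := fun y hy => by
    rw [cc_pos hn'.α1 (by linarith)]; simp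
  have lpD : ∀ y, 0 ≤ y → cc L α M (-y) = L y := fun y hy => by rw [cc_neg (by linarith)]; simp
  have lpD' : ∀ y, 0 ≤ y → cc L' α' M' (-y) = L' y := fun y hy => by rw [cc_neg (by linarith)]; simp
  have mpD : ∀ y, 0 ≤ y → cc L α M (y + 1) = M y := fun y hy => by rw [cc_pos h.α1 (by linarith)]; simp
  have mpD' : ∀ y, 0 ≤ y → cc L' α' M' (y + 1) = M' y := fun y hy => by rw [cc_pos h'.α1 (by linarith)]; simp
  set C := cc (fun y => L (-y)) α fun y => M (-y)
  set C' := cc (fun y => L' (-y)) α' fun y => M' (-y)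
  set D := cc L α M
  set D' := cc L' α' M'
  have arcC : ∀ t ∈ Icc (0:ℝ) 1, C t = α t := fun t ht => cc_arc hn.α0 ht
  have arcC' : ∀ t ∈ Icc (0:ℝ) 1, C' t = α' t := fun t ht => cc_arc hn'.α0 ht
  have arcD : ∀ t ∈ Icc (0:ℝ) 1, D t = α t := fun t ht => cc_arc h.α0 ht
  have arcD' : ∀ t ∈ Icc (0:ℝ) 1, D' t = α' t := fun t ht => cc_arc h'.α0 ht
  have e : ∀ z ∈ (range C ∪ Far C a) ∩ (range D ∪ Far D b), G z = H z := by
    intro z hz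
    obtain ⟨t, ht, rfl⟩ := s2 hz
    rw [← arcC t ht, g7, arcC' t ht, arcC t ht, ← arcD t ht, k7, arcD' t ht]
  have e' : ∀ z ∈ (range C' ∪ Far C' a') ∩ (range D' ∪ Far D' b'), G' z = H' z := by
    intro z hz
    obtain ⟨t, ht, rfl⟩ := s2' hz
    rw [← arcC' t ht, g8, arcC t ht, arcC' t ht, ← arcD' t ht, k8, arcD t ht]
  obtain ⟨F, f1, f2, f3⟩ := glue_maps (hcl hn.ccp haC) (hcl h.ccp hbD) g1 k1 e
  obtain ⟨F', f1', f2', f3'⟩ := glue_maps (hcl hn'.ccp haC') (hcl h'.ccp hbD') g3 k3 e'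
  refine ⟨F, F', f1, f1', ?_, ?_, ?_, ?_, ?_, ?_, ?_, ?_⟩
  · rintro z (hz | hz)
    · rw [f2 hz]; exact Or.inl (g2 hz)
    · rw [f3 hz]; exact Or.inr (k2 hz)
  · rintro z (hz | hz)
    · rw [f2' hz]; exact Or.inl (g4 hz)
    · rw [f3' hz]; exact Or.inr (k4 hz)
  · rintro z (hz | hz)
    · rw [f2 hz, f2' (g2 hz), g5 hz]
    · rw [f3 hz, f3' (k2 hz), k5 hz]
  · rintro z (hz | hz)
    · rw [f2' hz, f2 (g4 hz), g6 hz]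
    · rw [f3' hz, f3 (k4 hz), k6 hz]
  · intro y; rcases le_total y 0 with hy | hy
    · rw [← lnC y hy, f2 (Or.inl ⟨y, rfl⟩), g7, lnC' y hy]
    · rw [← lpD y hy, f3 (Or.inl ⟨-y, rfl⟩), k7, lpD' y hy]
  · intro y; rcases le_total y 0 with hy | hy
    · rw [← mnC y hy, f2 (Or.inl ⟨_, rfl⟩), g7, mnC' y hy]
    · rw [← mpD y hy, f3 (Or.inl ⟨_, rfl⟩), k7, mpD' y hy]
  · intro y; rcases le_total y 0 with hy | hy
    · rw [← lnC' y hy, f2' (Or.inl ⟨y, rfl⟩), g8, lnC y hy]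
    · rw [← lpD' y hy, f3' (Or.inl ⟨-y, rfl⟩), k8, lpD y hy]
  · intro y; rcases le_total y 0 with hy | hy
    · rw [← mnC' y hy, f2' (Or.inl ⟨_, rfl⟩), g8, mnC y hy]
    · rw [← mpD' y hy, f3' (Or.inl ⟨_, rfl⟩), k8, mpD y hy]

structure Brk (g : ℂ ≃ₜ ℂ) (A U : Set ℂ) : Prop where
  cA : IsClosed A
  oU : IsOpen U
  UA : U ⊆ A
  gA : ∀ z ∈ A, g z ∈ U
  up : ∀ z, ∃ n : ℤ, (g ^ n) z ∈ A
  dn : ∀ z, ∃ n : ℤ, (g ^ n) z ∉ A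

def SS (g : ℂ ≃ₜ ℂ) (A U : Set ℂ) : Set ℂ := {z | z ∈ A ∧ g⁻¹ z ∉ U}

theorem zp_add (g : ℂ ≃ₜ ℂ) (m n : ℤ) (z : ℂ) : (g ^ (m + n)) z = (g ^ m) ((g ^ n) z) := by
  rw [zpow_add]; rfl

theorem zp_succ (g : ℂ ≃ₜ ℂ) (n : ℤ) (z : ℂ) : (g ^ (n + 1)) z = g ((g ^ n) z) := by
  rw [add_comm, zp_add, zpow_one]

theorem zp_pred (g : ℂ ≃ₜ ℂ) (n : ℤ) (z : ℂ) : (g ^ (n - 1)) z = g⁻¹ ((g ^ n) z) := by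
  rw [sub_eq_neg_add, zp_add, zpow_neg_one]

namespace Brk
variable {τ : ℂ ≃ₜ ℂ} {A U : Set ℂ} (hτ : Brk τ A U)
include hτ

theorem mono {z : ℂ} {m n : ℤ} (hm : (τ ^ m) z ∈ A) (h : m < n) : (τ ^ n) z ∈ U := by
  obtain ⟨k, rfl⟩ : ∃ k : ℕ, n = m + 1 + k := ⟨(n - m - 1).toNat, by omega⟩
  clear h
  induction k with
  | zero => simpa [zp_succ] using hτ.gA _ hm
  | succ k ih =>
    have : m + 1 + ((k + 1 : ℕ) : ℤ) = (m + 1 + k) + 1 := by push_cast; ring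
    rw [this, zp_succ]; exact hτ.gA _ (hτ.UA ih)

theorem least (z : ℂ) : ∃ k : ℤ, (τ ^ k) z ∈ A ∧ (τ ^ (k - 1)) z ∉ A := by
  obtain ⟨b, hb⟩ := hτ.dn z
  obtain ⟨k, hk, hk'⟩ := Int.exists_least_of_bdd (P := fun n => (τ ^ n) z ∈ A)
    ⟨b, fun n hn => by by_contra h; exact hb (hτ.UA (hτ.mono hn (not_le.1 h)))⟩ (hτ.up z)
  exact ⟨k, hk, fun h => by have := hk' _ h; omega⟩

theorem clS : IsClosed (SS τ A U) :=
  hτ.cA.inter ((hτ.oU.preimage (τ⁻¹ : ℂ ≃ₜ ℂ).continuous).isClosed_compl)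

theorem ext {g : ℂ ≃ₜ ℂ} {F : ℂ → ℂ} (hF : ContinuousOn F (SS τ A U))
    (he : ∀ z ∈ A, z ∉ U → F (τ z) = g (F z)) : ∃ h : ℂ → ℂ, Continuous h ∧
      ∀ z (n : ℤ), (τ ^ n) z ∈ SS τ A U → h z = (g ^ (-n)) (F ((τ ^ n) z)) := by
  choose N hN hN' using hτ.least
  have key : ∀ z (n : ℤ), (τ ^ n) z ∈ SS τ A U →
      (g ^ (-N z)) (F ((τ ^ (N z)) z)) = (g ^ (-n)) (F ((τ ^ n) z)) := by
    intro z n ⟨h1, h2⟩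
    rw [← zp_pred] at h2
    have a1 : N z ≤ n := by
      by_contra h
      rcases (show n < N z - 1 ∨ n = N z - 1 by omega) with h3 | h3
      · exact hN' z (hτ.UA (hτ.mono h1 h3))
      · exact hN' z (h3 ▸ h1)
    have a2 : n ≤ N z + 1 := by
      by_contra h; exact h2 (hτ.mono (hN z) (by omega))
    rcases (show n = N z ∨ n = N z + 1 by omega) with h3 | h3
    · rw [h3]
    · subst h3
      rw [add_sub_cancel_right] at h2
      rw [zp_succ, he _ (hN z) h2, neg_add, zp_add, zpow_neg_one]
      congr 1
      exact (g.symm_apply_apply _).symm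
  refine ⟨fun z => (g ^ (-N z)) (F ((τ ^ (N z)) z)), ?_, key⟩
  refine LocallyFinite.continuous (f := fun n : ℤ => (τ ^ n) ⁻¹' SS τ A U) ?_ ?_
    (fun n => hτ.clS.preimage (τ ^ n).continuous) fun n => ?_
  · intro z
    obtain ⟨m, hm⟩ := hτ.dn z
    obtain ⟨k, hk⟩ := hτ.up z
    have hk := hτ.mono hk (lt_add_one k)
    refine ⟨(τ ^ m) ⁻¹' Aᶜ ∩ (τ ^ (k + 1)) ⁻¹' U, inter_mem
      ((hτ.cA.isOpen_compl.preimage (τ ^ m).continuous).mem_nhds hm)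
      ((hτ.oU.preimage (τ ^ (k + 1)).continuous).mem_nhds hk), (finite_Icc m (k + 2)).subset ?_⟩
    rintro n ⟨w, ⟨hw1, hw2⟩, hw3, hw4⟩
    rw [← zp_pred] at hw2
    constructor
    · by_contra h; exact hw3 (hτ.UA (hτ.mono hw1 (not_le.1 h)))
    · by_contra h; exact hw2 (hτ.mono (hτ.UA hw4) (by omega))
  · refine eq_univ_of_forall fun z => mem_iUnion.2 ⟨N z, hN z, fun h => hN' z ?_⟩
    rw [zp_pred]; exact hτ.UA h
  · refine ContinuousOn.congr (f := fun z => (g ^ (-n)) (F ((τ ^ n) z))) ?_ fun z hz => key z n hz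
    exact (g ^ (-n)).continuous.comp_continuousOn
      (hF.comp (τ ^ n).continuous.continuousOn fun z hz => hz)

theorem inS (z : ℂ) : ∃ n : ℤ, (τ ^ n) z ∈ SS τ A U := by
  obtain ⟨k, h1, h2⟩ := hτ.least z
  exact ⟨k, h1, fun h => h2 (by rw [zp_pred]; exact hτ.UA h)⟩

theorem conj {g : ℂ ≃ₜ ℂ} {A' U' : Set ℂ} (hg : Brk g A' U') {F F' : ℂ → ℂ}
    (hF : ContinuousOn F (SS τ A U)) (hF' : ContinuousOn F' (SS g A' U'))
    (he : ∀ z ∈ A, z ∉ U → F (τ z) = g (F z)) (he' : ∀ z ∈ A', z ∉ U' → F' (g z) = τ (F' z))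
    (m : MapsTo F (SS τ A U) (SS g A' U')) (m' : MapsTo F' (SS g A' U') (SS τ A U))
    (i : LeftInvOn F' F (SS τ A U)) (i' : LeftInvOn F F' (SS g A' U')) :
    ∃ h : ℂ ≃ₜ ℂ, ∀ z, h (τ z) = g (h z) := by
  obtain ⟨h, hc, hh⟩ := hτ.ext hF he
  obtain ⟨k, kc, hk⟩ := hg.ext hF' he'
  refine ⟨⟨⟨h, k, fun z => ?_, fun z => ?_⟩, hc, kc⟩, fun z => ?_⟩
  · obtain ⟨n, hn⟩ := hτ.inS z
    have e : (g ^ n) (h z) = F ((τ ^ n) z) := by rw [hh z n hn, ← zp_add]; simp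
    rw [hk (h z) n (by rw [e]; exact m hn), e, i hn, ← zp_add]; simp
  · obtain ⟨n, hn⟩ := hg.inS z
    have e : (τ ^ n) (k z) = F' ((g ^ n) z) := by rw [hk z n hn, ← zp_add]; simp
    rw [hh (k z) n (by rw [e]; exact m' hn), e, i' hn, ← zp_add]; simp
  · obtain ⟨n, hn⟩ := hτ.inS z
    show h (τ z) = g (h z)
    have e : (τ ^ (n - 1)) (τ z) = (τ ^ n) z := by
      have := zp_add τ (n - 1) 1 z
      rw [zpow_one, sub_add_cancel] at this
      exact this.symm
    rw [hh z n hn, hh (τ z) (n - 1) (by rwa [e]), e, ← zp_succ]; congr 2; ring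
end Brk

theorem cross {X Y : Set ℂ} (hX : IsClosed X) (hY : IsClosed Y) (hXn : X.Nonempty) (hYn : Y.Nonempty)
    (hd : ∀ z ∈ X, z ∉ Y) : ∃ α : ℝ → ℂ, Continuous α ∧ InjOn α (Icc 0 1) ∧ α 0 ∈ X ∧ α 1 ∈ Y ∧
      (∀ t ∈ Icc (0:ℝ) 1, α t ∈ X → t = 0) ∧ ∀ t ∈ Icc (0:ℝ) 1, α t ∈ Y → t = 1 := by
  obtain ⟨P, hP⟩ := hXn
  obtain ⟨Q, hQ⟩ := hYn
  have hPQ : Q - P ≠ 0 := fun e => hd P hP (by rwa [← sub_eq_zero.1 e])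
  set σ : ℝ → ℂ := fun t => P + t * (Q - P) with hσ
  have hσc : Continuous σ := by fun_prop
  have hσi : Function.Injective σ := fun t u e => by
    have := mul_right_cancel₀ hPQ (add_left_cancel e); exact_mod_cast this
  obtain ⟨t1, ⟨h1, h1X⟩, hm1⟩ := (isCompact_Icc.inter_right (hX.preimage hσc)).exists_isGreatest
    (s := Icc (0:ℝ) 1 ∩ σ ⁻¹' X) ⟨0, by simp, by simpa [hσ] using hP⟩
  obtain ⟨t2, ⟨h2, h2Y⟩, hm2⟩ := (isCompact_Icc.inter_right (hY.preimage hσc)).exists_isLeast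
    (s := Icc t1 1 ∩ σ ⁻¹' Y) ⟨1, ⟨h1.2, le_rfl⟩, by simpa [hσ] using hQ⟩
  have hlt : t1 < t2 := h2.1.lt_of_ne fun e => hd _ h1X (by rw [e]; exact h2Y)
  have hb : ∀ t ∈ Icc (0:ℝ) 1, t1 ≤ t1 + t * (t2 - t1) ∧ t1 + t * (t2 - t1) ≤ t2 := fun t ht =>
    ⟨by nlinarith [ht.1], by nlinarith [ht.2]⟩
  refine ⟨fun t => σ (t1 + t * (t2 - t1)), hσc.comp (by fun_prop), fun t _ u _ e => ?_, by simpa using h1X,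
    by simpa using h2Y, fun t ht h => ?_, fun t ht h => ?_⟩
  · have := hσi e
    exact mul_right_cancel₀ (sub_pos.2 hlt).ne' (add_left_cancel this)
  · have := hm1 ⟨⟨h1.1.trans (hb t ht).1, (hb t ht).2.trans h2.2⟩, h⟩
    nlinarith [ht.1]
  · have := hm2 ⟨⟨(hb t ht).1, (hb t ht).2.trans h2.2⟩, h⟩
    nlinarith [ht.2]

theorem far_sub {L : ℝ → ℂ} {a z : ℂ} (hz : z ∈ Far L a) : z ∉ connectedComponentIn (range L)ᶜ a :=
  fun h => hz (Or.inr h)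

theorem sys_of_brk {g : ℂ ≃ₜ ℂ} {L : ℝ → ℂ} (hL : PLine L) {a : ℂ} (ha : a ∉ range L)
    (hB : Brk g (connectedComponentIn (range L)ᶜ a)ᶜ (Far L a)) : ∃ (s0 s1 : ℝ) (α : ℝ → ℂ) (b : ℂ),
      Sys (fun y => L (s0 + y)) (fun y => g (L (s1 + y))) α a b ∧
      connectedComponentIn (range fun y => g (L (s1 + y)))ᶜ b = g '' Far L a := by
  obtain ⟨c, hc⟩ := hL.far_nonempty ha
  have hLV : ∀ y, L y ∉ connectedComponentIn (range L)ᶜ a := fun y h =>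
    connectedComponentIn_subset _ _ h ⟨y, rfl⟩
  have hgL : ∀ y, g (L y) ∈ Far L a := fun y => hB.gA _ (hLV y)
  have hW : connectedComponentIn (range fun y => g (L y))ᶜ (g c) = g '' Far L a := by
    have : (range fun y => g (L y))ᶜ = g '' (range L)ᶜ := by
      rw [image_compl_eq g.bijective, ← range_comp]; rfl
    rw [hL.far_eq_comp ha hc, this, g.image_connectedComponentIn
      (show c ∈ (range L)ᶜ from fun h => hc (Or.inl h))]
  have hgU : ∀ z ∈ g '' Far L a, z ∈ Far L a := by
    rintro _ ⟨z, hz, rfl⟩; exact hB.gA _ (far_sub hz)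
  obtain ⟨α, hαc, hαi, ⟨s0, h0⟩, ⟨s1, h1⟩, hα0, hα1⟩ := cross hL.closed (hL.map g).closed ⟨_, 0, rfl⟩ ⟨_, 0, rfl⟩
    (by rintro _ ⟨y, rfl⟩ ⟨y', e⟩; exact hgL y' (Or.inl ⟨y, e.symm⟩))
  have r0 : range (fun y => L (s0 + y)) = range L := (Homeomorph.addLeft s0).surjective.range_comp L
  have r1 : range (fun y => g (L (s1 + y))) = range fun y => g (L y) :=
    (Homeomorph.addLeft s1).surjective.range_comp fun y => g (L y)
  refine ⟨s0, s1, α, g c, ⟨hL.comp_homeo (Homeomorph.addLeft s0),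
    (hL.map g).comp_homeo (Homeomorph.addLeft s1), hαc, hαi, by simpa using h0, by simpa using h1.symm,
    fun s t e => hgL (s1 + t) (Or.inl ⟨s0 + s, e⟩), fun t ht s e => hα0 t ht ⟨_, e.symm⟩,
    fun t ht s e => hα1 t ht ⟨_, e.symm⟩, by rwa [r0], ?_, ?_, ?_, ?_⟩, by rw [r1, hW]⟩
  · rintro ⟨y, e⟩; exact hc (Or.inl ⟨_, g.injective e⟩)
  · rw [r0, r1, hW, disjoint_right]; exact fun z hz => far_sub (hgU z hz)
  · rw [r0, r1]
    rintro z hz (⟨y, rfl⟩ | ⟨t, ht, rfl⟩)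
    · exact far_sub (hgL y) hz
    · have hne : t ≠ 0 := by rintro rfl; exact hLV s0 (h0 ▸ hz)
      have : α 1 ∈ connectedComponentIn (range L)ᶜ (α t) := by
        refine same_comp_of_subset (C := α '' Ioc 0 1) (isPreconnected_Ioc.image _ hαc.continuousOn) ?_
          ⟨t, ⟨ht.1.lt_of_ne hne.symm, ht.2⟩, rfl⟩ ⟨1, by simp, rfl⟩
        rintro _ ⟨u, hu, rfl⟩ h; exact hu.1.ne' (hα0 u ⟨hu.1.le, hu.2⟩ h)
      rw [← connectedComponentIn_eq hz, ← h1] at this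
      exact far_sub (hgL s1) this
  · rw [r0, r1]
    intro z hz
    have hz' := hz
    rw [hW] at hz'
    rintro (h | ⟨t, ht, rfl⟩)
    · exact hgU z hz' (Or.inl h)
    · have hne : t ≠ 1 := by
        rintro rfl
        exact connectedComponentIn_subset _ _ hz ⟨s1, h1⟩
      have : α 0 ∈ connectedComponentIn (range fun y => g (L y))ᶜ (α t) := by
        refine same_comp_of_subset (C := α '' Ico 0 1) (isPreconnected_Ico.image _ hαc.continuousOn) ?_
          ⟨t, ⟨ht.1, ht.2.lt_of_ne hne⟩, rfl⟩ ⟨0, by simp, rfl⟩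
        rintro _ ⟨u, hu, rfl⟩ h; exact hu.2.ne (hα1 u ⟨hu.1, hu.2.le⟩ h)
      rw [← connectedComponentIn_eq hz, hW] at this
      exact hgU _ this (Or.inl ⟨s0, h0⟩)

theorem pl_vert (c : ℂ) : PLine (fun y : ℝ => c + y * I) := by
  have : Isometry (fun y : ℝ => c + y * I) := Isometry.of_dist_eq fun x y => by
    rw [dist_add_left, dist_eq_norm, ← sub_mul, norm_mul, norm_I, mul_one, ← ofReal_sub, norm_real,
      Real.dist_eq, Real.norm_eq_abs]
  exact ⟨this.continuous, this.injective, this.isClosedEmbedding.tendsto_cocompact⟩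

theorem rng_vert (c : ℂ) : range (fun y : ℝ => c + y * I) = {z | z.re = c.re} := by
  ext z
  constructor
  · rintro ⟨y, rfl⟩; simp
  · intro h
    refine ⟨z.im - c.im, Complex.ext ?_ ?_⟩
    · simpa using (show z.re = c.re from h).symm
    · simp

theorem comp_lt {c : ℝ} {a : ℂ} (ha : a.re < c) :
    connectedComponentIn {z : ℂ | z.re = c}ᶜ a = {z | z.re < c} := by
  have hs : ({z : ℂ | z.re = c}ᶜ : Set ℂ) ⊆ {z | z.re < c} ∪ {z | c < z.re} := fun z hz => lt_or_gt_of_ne hz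
  refine Subset.antisymm ?_ ?_
  · refine isPreconnected_connectedComponentIn.subset_left_of_subset_union
      (isOpen_lt continuous_re continuous_const) (isOpen_lt continuous_const continuous_re)
      (disjoint_left.2 fun z (h : z.re < c) (h' : c < z.re) => lt_asymm h h') ((connectedComponentIn_subset _ _).trans hs)
      ⟨a, mem_connectedComponentIn ha.ne, ha⟩
  · exact (convex_halfSpace_re_lt c).isPreconnected.subset_connectedComponentIn ha fun z h => ne_of_lt h

theorem comp_gt {c : ℝ} {a : ℂ} (ha : c < a.re) :
    connectedComponentIn {z : ℂ | z.re = c}ᶜ a = {z | c < z.re} := by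
  have hs : ({z : ℂ | z.re = c}ᶜ : Set ℂ) ⊆ {z | z.re < c} ∪ {z | c < z.re} := fun z hz => lt_or_gt_of_ne hz
  refine Subset.antisymm ?_ ?_
  · refine isPreconnected_connectedComponentIn.subset_right_of_subset_union
      (isOpen_lt continuous_re continuous_const) (isOpen_lt continuous_const continuous_re)
      (disjoint_left.2 fun z (h : z.re < c) (h' : c < z.re) => lt_asymm h h') ((connectedComponentIn_subset _ _).trans hs)
      ⟨a, mem_connectedComponentIn ha.ne', ha⟩
  · exact (convex_halfSpace_re_gt c).isPreconnected.subset_connectedComponentIn ha fun z h => ne_of_gt h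

theorem far_vert {c a : ℂ} (ha : a.re < c.re) : Far (fun y : ℝ => c + y * I) a = {z | c.re < z.re} := by
  rw [Far, rng_vert, comp_lt ha]
  ext z; simp only [mem_compl_iff, mem_union, mem_ofPred_eq, not_or, not_lt]
  exact ⟨fun h => lt_of_le_of_ne h.2 (Ne.symm h.1), fun h => ⟨h.ne', h.le⟩⟩

theorem model_sys (t : ℝ) : Sys (fun y : ℝ => -(t * I) + y * I) (fun y : ℝ => 1 + y * I)
    (fun s : ℝ => (s : ℂ) - (1 - s) * t * I) (-1) 2 := by
  refine ⟨pl_vert _, pl_vert _, by fun_prop, ?_, by simp, by simp, fun s u e => ?_, fun s hs u e => ?_,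
    fun s hs u e => ?_, ?_, ?_, ?_, ?_, ?_⟩
  · intro s _ u _ e; simpa using congrArg Complex.re e
  · simpa using congrArg Complex.re e
  · simpa using congrArg Complex.re e
  · simpa using congrArg Complex.re e
  · rw [rng_vert]; simp
  · rw [rng_vert]; simp
  · rw [rng_vert, rng_vert, comp_lt (by simp), comp_gt (by simp)]
    refine disjoint_left.2 fun z h h' => ?_
    simp at h h'; linarith
  · rw [rng_vert, rng_vert, comp_lt (by simp)]
    rintro z h (h' | ⟨s, hs, rfl⟩)
    · simp at h h'; linarith
    · simp at h; linarith [hs.1]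
  · rw [rng_vert, rng_vert, comp_gt (by simp)]
    rintro z h (h' | ⟨s, hs, rfl⟩)
    · simp at h h'; linarith
    · simp at h; linarith [hs.2]

theorem model_brk {τ : ℂ ≃ₜ ℂ} (hτ : ∀ z, (τ z).re = z.re + 1) : Brk τ {z | z.re < 0}ᶜ {z | 0 < z.re} := by
  have hn : ∀ (n : ℤ) z, ((τ ^ n) z).re = z.re + n := by
    intro n z
    induction n using Int.induction_on with
    | zero => simp
    | succ i ih => rw [zp_succ, hτ, ih]; push_cast; ring
    | pred i ih =>
      have h1 := zp_succ τ (-i - 1) z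
      have h2 := hτ ((τ ^ (-(i:ℤ) - 1)) z)
      rw [← h1, sub_add_cancel, ih] at h2
      push_cast at h2 ⊢; linarith
  refine ⟨(isOpen_lt continuous_re continuous_const).isClosed_compl, isOpen_lt continuous_const continuous_re,
    fun z h => ?_, fun z h => ?_, fun z => ⟨⌈-z.re⌉, ?_⟩, fun z => ⟨⌊-z.re⌋ - 1, ?_⟩⟩
  · simp at h ⊢; exact h.le
  · simp at h ⊢; rw [hτ]; linarith
  · simp only [mem_compl_iff, mem_ofPred_eq, hn, not_lt]; linarith [Int.le_ceil (-z.re)]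
  · simp only [mem_compl_iff, mem_ofPred_eq, hn, not_lt, not_le]
    push_cast; linarith [Int.floor_le (-z.re)]

theorem SS_eq (τ : ℂ ≃ₜ ℂ) (V U : Set ℂ) : SS τ Vᶜ U = (V ∪ τ '' U)ᶜ := by
  ext z
  have : z ∈ τ '' U ↔ τ⁻¹ z ∈ U := by
    constructor
    · rintro ⟨w, hw, rfl⟩
      rw [show τ⁻¹ (τ w) = w from τ.symm_apply_apply w]; exact hw
    · exact fun h => ⟨_, h, τ.apply_symm_apply z⟩
  simp only [SS, mem_ofPred_eq, mem_compl_iff, mem_union, not_or, this]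

noncomputable def tau (δ : ℝ) (hδ : δ * δ = 1) : ℂ ≃ₜ ℂ where
  toFun z := ⟨z.re + 1, δ * z.im⟩
  invFun z := ⟨z.re - 1, δ * z.im⟩
  left_inv z := Complex.ext (by simp) (by simp only; rw [← mul_assoc, hδ, one_mul])
  right_inv z := Complex.ext (by simp) (by simp only; rw [← mul_assoc, hδ, one_mul])
  continuous_toFun := by
    have : (fun z : ℂ => (⟨z.re + 1, δ * z.im⟩ : ℂ)) = fun z : ℂ => ((z.re + 1 : ℝ) : ℂ) + ((δ * z.im : ℝ) : ℂ) * I := by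
      ext z; exact mk_eq_add_mul_I _ _
    rw [this]; fun_prop
  continuous_invFun := by
    have : (fun z : ℂ => (⟨z.re - 1, δ * z.im⟩ : ℂ)) = fun z : ℂ => ((z.re - 1 : ℝ) : ℂ) + ((δ * z.im : ℝ) : ℂ) * I := by
      ext z; exact mk_eq_add_mul_I _ _
    rw [this]; fun_prop

theorem line_conj {g : ℂ ≃ₜ ℂ} {L : ℝ → ℂ} (hL : PLine L) {a : ℂ} (ha : a ∉ range L)
    (hB : Brk g (connectedComponentIn (range L)ᶜ a)ᶜ (Far L a)) :
    ∃ (h : ℂ ≃ₜ ℂ) (δ : ℝ) (hδ : δ * δ = 1), ∀ z, h (tau δ hδ z) = g (h z) := by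
  obtain ⟨s0, s1, α, b, S, hW⟩ := sys_of_brk hL ha hB
  obtain ⟨ε, hε, S, hS, hW⟩ : ∃ ε : ℝ, ε * ε = 1 ∧ Sys (fun y => L (s0 + y)) (fun y => g (L (s1 + ε * y))) α a b ∧
      BSep (fun y => L (s0 + y)) (fun y => g (L (s1 + ε * y))) α a b ∧
      connectedComponentIn (range fun y => g (L (s1 + ε * y)))ᶜ b = g '' Far L a := by
    rcases S.sep with h | h
    · exact ⟨1, by simp, by simpa using S, by simpa using h, by simpa using hW⟩
    · refine ⟨-1, by simp, by simpa using S.neg, by simpa using h, ?_⟩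
      have := rng_neg fun y => g (L (s1 + y))
      simp only [neg_one_mul]
      rw [this, hW]
  set t0 := s1 - s0 with ht0
  have S' := model_sys t0
  obtain ⟨κ, hκ, S', hS', hr'⟩ : ∃ κ : ℝ, κ * κ = 1 ∧ Sys (fun y : ℝ => -(t0 * I) + y * I) (fun y : ℝ => 1 + ((κ * y : ℝ) : ℂ) * I)
      (fun s : ℝ => (s : ℂ) - (1 - s) * t0 * I) (-1) 2 ∧
      BSep (fun y : ℝ => -(t0 * I) + y * I) (fun y : ℝ => 1 + ((κ * y : ℝ) : ℂ) * I)
      (fun s : ℝ => (s : ℂ) - (1 - s) * t0 * I) (-1) 2 ∧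
      range (fun y : ℝ => 1 + ((κ * y : ℝ) : ℂ) * I) = {z | z.re = 1} := by
    have h1 := rng_vert 1
    rcases S'.sep with h | h
    · refine ⟨1, by simp, by simpa using S', by simpa using h, by simpa using h1⟩
    · refine ⟨-1, by simp, by simpa using S'.neg, by simpa using h, ?_⟩
      have := rng_neg fun y : ℝ => (1 : ℂ) + y * I
      rw [h1] at this
      simpa using this
  have hδ : (κ * ε) * (κ * ε) = 1 := by linear_combination ε * ε * hκ + hε
  set τ := tau (κ * ε) hδ with hτd
  have hτr : ∀ z, (τ z).re = z.re + 1 := fun z => rfl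
  have hτi : ∀ z, (τ z).im = κ * ε * z.im := fun z => rfl
  have hB' := model_brk hτr
  obtain ⟨F, F', f1, f2, f3, f4, f5, f6, f7, f8, f9, f10⟩ := S'.iso hS' S hS
  have r0 : range (fun y => L (s0 + y)) = range L := (Homeomorph.addLeft s0).surjective.range_comp L
  have eS : SS g (connectedComponentIn (range L)ᶜ a)ᶜ (Far L a) =
      (connectedComponentIn (range fun y => L (s0 + y))ᶜ a ∪
        connectedComponentIn (range fun y => g (L (s1 + ε * y)))ᶜ b)ᶜ := by rw [SS_eq, r0, hW]
  have eS' : SS τ {z | z.re < 0}ᶜ {z | 0 < z.re} =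
      (connectedComponentIn (range fun y : ℝ => -(t0 * I) + y * I)ᶜ (-1) ∪
        connectedComponentIn (range fun y : ℝ => 1 + ((κ * y : ℝ) : ℂ) * I)ᶜ 2)ᶜ := by
    have hv : (-(t0 * I) : ℂ).re = 0 := by simp
    rw [SS_eq, hr', rng_vert, hv, comp_lt (by simp), comp_gt (by simp)]
    congr 2
    ext z
    constructor
    · rintro ⟨w, hw, rfl⟩
      have : 0 < w.re := hw
      show 1 < (τ w).re
      rw [hτr]; linarith
    · intro hz
      refine ⟨τ.symm z, ?_, τ.apply_symm_apply z⟩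
      have := hτr (τ.symm z)
      rw [τ.apply_symm_apply] at this
      have h1 : 1 < z.re := hz
      show 0 < (τ.symm z).re
      linarith
  rw [← eS'] at f1 f3 f4 f5
  rw [← eS] at f2 f3 f4 f6
  have key : ∀ y : ℝ, τ (-(t0 * I) + y * I) = 1 + ((κ * (ε * (y - t0)) : ℝ) : ℂ) * I := fun y =>
    Complex.ext (by rw [hτr]; simp) (by rw [hτi]; simp; ring)
  have key2 : ∀ y : ℝ, s1 + ε * (ε * (y - t0)) = s0 + y := fun y => by
    rw [ht0]; linear_combination (y - s1 + s0) * hε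
  have q1 : ∀ z ∈ {z : ℂ | z.re < 0}ᶜ, z ∉ {z : ℂ | 0 < z.re} → F (τ z) = g (F z) := by
    intro z hz hz'
    have : z ∈ range (fun y : ℝ => -(t0 * I) + y * I) := by
      rw [rng_vert]
      simp at hz hz' ⊢; linarith
    obtain ⟨y, rfl⟩ := this
    simp only [key, f7, f8, key2]
  have q2 : ∀ z ∈ (connectedComponentIn (range L)ᶜ a)ᶜ, z ∉ Far L a → F' (g z) = τ (F' z) := by
    intro z hz hz'
    have : z ∈ range L := by
      by_contra h; exact hz' fun h' => h'.elim h hz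
    obtain ⟨x, rfl⟩ := this
    have h1 := f10 (ε * (x - s0 - t0))
    have h2 := f9 (x - s0)
    rw [key2] at h1
    simp only [add_sub_cancel] at h1 h2
    rw [h1, h2, key]
  obtain ⟨h, hh⟩ := hB'.conj hB f1 f2 q1 q2 f3 f4 f5 f6
  exact ⟨h, _, hδ, hh⟩

def Rt (q : ℤ × ℤ) : ℤ × ℤ := (q.1 - q.2, q.1)

def Dir (u : ℤ × ℤ) : Prop :=
  u = (1, 0) ∨ u = (1, 1) ∨ u = (0, 1) ∨ u = (-1, 0) ∨ u = (-1, -1) ∨ u = (0, -1)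

theorem Dir.rt {u : ℤ × ℤ} (h : Dir u) : Dir (Rt u) := by
  rcases h with rfl | rfl | rfl | rfl | rfl | rfl <;> simp [Dir, Rt]

theorem Dir.ri {u : ℤ × ℤ} (h : Dir u) : Dir (u - Rt u) := by
  rcases h with rfl | rfl | rfl | rfl | rfl | rfl <;> simp [Dir, Rt]

theorem Dir.neg {u : ℤ × ℤ} (h : Dir u) : Dir (-u) := by
  rcases h with rfl | rfl | rfl | rfl | rfl | rfl <;> simp [Dir]

def EE (q : ℤ × ℤ) : ℂ := ⟨q.1, q.2⟩

theorem EE_add (p q : ℤ × ℤ) : EE (p + q) = EE p + EE q := Complex.ext (by simp [EE]) (by simp [EE])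

noncomputable def hat (x y : ℝ) : ℝ := max 0 (1 - max (max |x| |y|) |x - y|)

noncomputable def Phi (c : ℤ × ℤ → ℝ) (z : ℂ) : ℝ := ∑ᶠ q : ℤ × ℤ, c q * hat (z.re - q.1) (z.im - q.2)

def HT (u : ℤ × ℤ) : Prop := ∀ β γ : ℝ, 0 ≤ β → 0 ≤ γ → β + γ ≤ 1 → ∀ q : ℤ × ℤ,
  hat (β * u.1 + γ * (Rt u).1 - q.1) (β * u.2 + γ * (Rt u).2 - q.2) =
    (if q = 0 then 1 - β - γ else 0) + (if q = u then β else 0) + (if q = Rt u then γ else 0)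

theorem hat_rt (x y : ℝ) : hat (x - y) x = hat x y := by
  unfold hat
  rw [show x - y - x = -y by ring, abs_neg]
  simp only [max_comm, max_left_comm]

theorem HT.step {u : ℤ × ℤ} (h : HT u) : HT (Rt u) := by
  intro β γ hβ hγ hs q
  have := h β γ hβ hγ hs (q.2, q.2 - q.1)
  rw [← hat_rt] at this
  have e1 : ((q.2, q.2 - q.1) : ℤ × ℤ) = 0 ↔ q = 0 := by
    rw [Prod.ext_iff, Prod.ext_iff]; simp; omega
  have e2 : ∀ w : ℤ × ℤ, ((q.2, q.2 - q.1) : ℤ × ℤ) = w ↔ q = Rt w := by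
    intro w; rw [Prod.ext_iff, Prod.ext_iff]; simp [Rt]; omega
  simp only [e1, e2] at this
  rw [← this]
  congr 1 <;> simp [Rt] <;> ring

theorem HT.base : HT (1, 0) := by
  intro β γ hβ hγ hs q
  have hR : Rt (1, 0) = (1, 1) := rfl
  rw [hR]
  obtain ⟨i, j⟩ := q
  simp only [Prod.mk_eq_zero, Prod.mk.injEq]
  have z1 : ∀ x y : ℝ, 1 ≤ |x| → hat x y = 0 := fun x y h => max_eq_left (by
    have := (le_max_left |x| |y|).trans (le_max_left _ |x - y|); linarith)
  have z2 : ∀ x y : ℝ, 1 ≤ |y| → hat x y = 0 := fun x y h => max_eq_left (by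
    have := (le_max_right |x| |y|).trans (le_max_left _ |x - y|); linarith)
  have z3 : ∀ x y : ℝ, 1 ≤ |x - y| → hat x y = 0 := fun x y h => max_eq_left (by
    have := le_max_right (max |x| |y|) |x - y|; linarith)
  have hv : ∀ x y m : ℝ, |x| ≤ m → |y| ≤ m → |x - y| ≤ m → (m ≤ |x| ∨ m ≤ |y| ∨ m ≤ |x - y|) → m ≤ 1 →
      hat x y = 1 - m := by
    intro x y m h1 h2 h3 h4 h5
    have : max (max |x| |y|) |x - y| = m := le_antisymm (max_le (max_le h1 h2) h3) (by
      simp only [le_max_iff]; tauto)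
    rw [hat, this, max_eq_right (by linarith)]
  push_cast
  rcases (show i ≤ -1 ∨ 2 ≤ i ∨ i = 0 ∨ i = 1 by omega) with hi | hi | rfl | rfl
  · rw [z1 _ _ (le_abs.2 (Or.inl (by have : (i:ℝ) ≤ -1 := by exact_mod_cast hi
                                     linarith)))]
    simp [show i ≠ 0 by omega, show i ≠ 1 by omega]
  · rw [z1 _ _ (le_abs.2 (Or.inr (by have : (2:ℝ) ≤ i := by exact_mod_cast hi
                                     linarith)))]
    simp [show i ≠ 0 by omega, show i ≠ 1 by omega]
  all_goals rcases (show j ≤ -1 ∨ 2 ≤ j ∨ j = 0 ∨ j = 1 by omega) with hj | hj | rfl | rfl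
  · rw [z2 _ _ (le_abs.2 (Or.inl (by have : (j:ℝ) ≤ -1 := by exact_mod_cast hj
                                     linarith)))]
    simp [show j ≠ 0 by omega]
  · rw [z2 _ _ (le_abs.2 (Or.inr (by have : (2:ℝ) ≤ j := by exact_mod_cast hj
                                     linarith)))]
    simp [show j ≠ 0 by omega]
  · rw [hv _ _ (β + γ) (abs_le.2 (by constructor <;> push_cast <;> linarith)) (abs_le.2 (by constructor <;> push_cast <;> linarith))
      (abs_le.2 (by constructor <;> push_cast <;> linarith)) (Or.inl (le_abs.2 (Or.inl (by push_cast; linarith)))) hs]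
    norm_num; ring
  · rw [z3 _ _ (le_abs.2 (Or.inl (by push_cast; linarith)))]; norm_num
  · rw [z2 _ _ (le_abs.2 (Or.inl (by have : (j:ℝ) ≤ -1 := by exact_mod_cast hj
                                     linarith)))]
    simp [show j ≠ 0 by omega, show j ≠ 1 by omega]
  · rw [z2 _ _ (le_abs.2 (Or.inr (by have : (2:ℝ) ≤ j := by exact_mod_cast hj
                                     linarith)))]
    simp [show j ≠ 0 by omega, show j ≠ 1 by omega]
  · rw [hv _ _ (1 - β) (abs_le.2 (by constructor <;> push_cast <;> linarith)) (abs_le.2 (by constructor <;> push_cast <;> linarith))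
      (abs_le.2 (by constructor <;> push_cast <;> linarith)) (Or.inr (Or.inr (le_abs.2 (Or.inr (by push_cast; linarith))))) (by linarith)]
    norm_num
  · rw [hv _ _ (1 - γ) (abs_le.2 (by constructor <;> push_cast <;> linarith)) (abs_le.2 (by constructor <;> push_cast <;> linarith))
      (abs_le.2 (by constructor <;> push_cast <;> linarith)) (Or.inr (Or.inl (le_abs.2 (Or.inr (by push_cast; linarith))))) (by linarith)]
    norm_num

theorem Dir.ht {u : ℤ × ℤ} (h : Dir u) : HT u := by
  have h1 := HT.base.step
  have h2 := h1.step
  have h3 := h2.step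
  have h4 := h3.step
  have h5 := h4.step
  simp [Rt] at h1 h2 h3 h4 h5
  rcases h with rfl | rfl | rfl | rfl | rfl | rfl
  exacts [HT.base, h1, h2, h3, h4, h5]

theorem phi_tri (c : ℤ × ℤ → ℝ) (b : ℤ × ℤ) {u : ℤ × ℤ} (hu : Dir u) {β γ : ℝ} (hβ : 0 ≤ β) (hγ : 0 ≤ γ)
    (hs : β + γ ≤ 1) : Phi c (EE b + β * EE u + γ * EE (Rt u)) =
      (1 - β - γ) * c b + β * c (b + u) + γ * c (b + Rt u) := by
  unfold Phi
  have key : ∀ q : ℤ × ℤ, c q * hat ((EE b + β * EE u + γ * EE (Rt u)).re - q.1)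
      ((EE b + β * EE u + γ * EE (Rt u)).im - q.2) =
      (if q = b then c q * (1 - β - γ) else 0) + (if q = b + u then c q * β else 0) +
        (if q = b + Rt u then c q * γ else 0) := by
    intro q
    have := hu.ht β γ hβ hγ hs (q - b)
    simp only [sub_eq_zero, sub_eq_iff_eq_add'] at this
    rw [show (EE b + β * EE u + γ * EE (Rt u)).re - q.1 = β * u.1 + γ * (Rt u).1 - ((q - b).1 : ℤ) by
        simp [EE]; ring,
      show (EE b + β * EE u + γ * EE (Rt u)).im - q.2 = β * u.2 + γ * (Rt u).2 - ((q - b).2 : ℤ) by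
        simp [EE]; ring, this]
    simp [mul_add]
  rw [finsum_congr key, finsum_eq_sum_of_support_subset (s := {b, b + u, b + Rt u})]
  · rw [Finset.sum_add_distrib, Finset.sum_add_distrib, Finset.sum_ite_eq', Finset.sum_ite_eq',
      Finset.sum_ite_eq', if_pos (by simp), if_pos (by simp), if_pos (by simp)]
    ring
  · intro q hq
    by_contra h
    simp at h
    exact hq (by simp [h])

theorem exists_tri (z : ℂ) : ∃ (b u : ℤ × ℤ) (β γ : ℝ), Dir u ∧ 0 ≤ β ∧ 0 ≤ γ ∧ β + γ ≤ 1 ∧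
    z = EE b + β * EE u + γ * EE (Rt u) := by
  have h1 := Int.floor_add_fract z.re
  have h2 := Int.floor_add_fract z.im
  have a1 := Int.fract_nonneg z.re
  have a2 := Int.fract_nonneg z.im
  have b1 := Int.fract_lt_one z.re
  have b2 := Int.fract_lt_one z.im
  rcases le_total (Int.fract z.im) (Int.fract z.re) with h | h
  · refine ⟨(⌊z.re⌋, ⌊z.im⌋), (1, 0), Int.fract z.re - Int.fract z.im, Int.fract z.im, by simp [Dir],
      by linarith, by linarith, by linarith, Complex.ext ?_ ?_⟩
    · simp [EE, Rt]; linarith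
    · simp [EE, Rt]
  · refine ⟨(⌊z.re⌋, ⌊z.im⌋), (1, 1), Int.fract z.re, Int.fract z.im - Int.fract z.re, by simp [Dir],
      by linarith, by linarith, by linarith, Complex.ext ?_ ?_⟩
    · simp [EE, Rt]
    · simp [EE, Rt]

theorem Rt_Rt (u : ℤ × ℤ) : Rt (Rt u) = Rt u - u := by ext <;> simp [Rt]

theorem Rt_sub (u v : ℤ × ℤ) : Rt (u - v) = Rt u - Rt v := by ext <;> simp [Rt]; ring

theorem EE_sub (p q : ℤ × ℤ) : EE (p - q) = EE p - EE q := Complex.ext (by simp [EE]) (by simp [EE])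

theorem Dir.ne {u : ℤ × ℤ} (h : Dir u) : u ≠ 0 ∧ Rt u ≠ 0 ∧ u ≠ Rt u ∧ u + u ≠ Rt u ∧ Rt u + u ≠ 0 := by
  rcases h with rfl | rfl | rfl | rfl | rfl | rfl <;> simp [Rt]

abbrev St (B : Set (ℤ × ℤ)) : Type := {s : (ℤ × ℤ) × (ℤ × ℤ) // Dir s.2 ∧ s.1 ∈ B ∧ s.1 + s.2 ∉ B}

open Classical in
noncomputable def sg (B : Set (ℤ × ℤ)) : Equiv.Perm (St B) where
  toFun s := if h : s.1.1 + Rt s.1.2 ∈ B then ⟨(s.1.1 + Rt s.1.2, s.1.2 - Rt s.1.2), s.2.1.ri, h, by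
      have := s.2.2.2; rwa [show s.1.1 + Rt s.1.2 + (s.1.2 - Rt s.1.2) = s.1.1 + s.1.2 by abel]⟩ else ⟨(s.1.1, Rt s.1.2), s.2.1.rt, s.2.2.1, h⟩
  invFun s := if h : s.1.1 + (s.1.2 - Rt s.1.2) ∈ B then ⟨(s.1.1 + (s.1.2 - Rt s.1.2), Rt s.1.2), s.2.1.rt, h, by
      have := s.2.2.2; rwa [show s.1.1 + (s.1.2 - Rt s.1.2) + Rt s.1.2 = s.1.1 + s.1.2 by abel]⟩
      else ⟨(s.1.1, s.1.2 - Rt s.1.2), s.2.1.ri, s.2.2.1, h⟩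
  left_inv s := by
    obtain ⟨⟨b, u⟩, h1, h2, h3⟩ := s
    simp only at h1 h2 h3 ⊢
    have e1 : b + Rt u + (u - Rt u - Rt (u - Rt u)) = b := by rw [Rt_sub, Rt_Rt]; abel
    have e2 : b + (Rt u - Rt (Rt u)) = b + u := by rw [Rt_Rt]; abel
    by_cases h : b + Rt u ∈ B
    · simp only [h, dite_true, e1, h2]
      congr 2; rw [Rt_sub, Rt_Rt]; abel
    · simp only [h, dite_false, e2, h3]
      congr 2; rw [Rt_Rt]; abel
  right_inv s := by
    obtain ⟨⟨b, u⟩, h1, h2, h3⟩ := s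
    simp only at h1 h2 h3 ⊢
    have e1 : b + (u - Rt u) + Rt (Rt u) = b := by rw [Rt_Rt]; abel
    have e2 : b + Rt (u - Rt u) = b + u := by rw [Rt_sub, Rt_Rt]; abel
    by_cases h : b + (u - Rt u) ∈ B
    · simp only [h, dite_true, e1, h2]
      congr 2; rw [Rt_Rt]; abel
    · simp only [h, dite_false, e2, h3]
      congr 2; rw [Rt_sub, Rt_Rt]; abel

noncomputable def md {B : Set (ℤ × ℤ)} (s : St B) : ℂ := EE s.1.1 + EE s.1.2 / 2

def Bar (B : Set (ℤ × ℤ)) (s : St B) (l β γ : ℝ) : Prop := γ = l / 2 ∧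
  ((s.1.1 + Rt s.1.2 ∈ B ∧ β = 1 / 2) ∨ (s.1.1 + Rt s.1.2 ∉ B ∧ β = (1 - l) / 2))

theorem bar_ex {B : Set (ℤ × ℤ)} (s : St B) (l : ℝ) : ∃ β γ : ℝ, Bar B s l β γ ∧
    md s + l * (md (sg B s) - md s) = EE s.1.1 + β * EE s.1.2 + γ * EE (Rt s.1.2) := by
  by_cases h : s.1.1 + Rt s.1.2 ∈ B
  · refine ⟨1 / 2, l / 2, ⟨rfl, Or.inl ⟨h, rfl⟩⟩, ?_⟩
    simp only [md, sg, Equiv.coe_fn_mk, h, dite_true, EE_add, EE_sub]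
    push_cast; ring
  · refine ⟨(1 - l) / 2, l / 2, ⟨rfl, Or.inr ⟨h, rfl⟩⟩, ?_⟩
    simp only [md, sg, Equiv.coe_fn_mk, h, dite_false]
    push_cast; ring

theorem Bar.pos {B : Set (ℤ × ℤ)} {s : St B} {l β γ : ℝ} (h : Bar B s l β γ) (h0 : 0 ≤ l) (h1 : l ≤ 1) :
    0 ≤ β ∧ 0 ≤ γ ∧ β + γ ≤ 1 := by
  obtain ⟨rfl, ⟨-, rfl⟩ | ⟨-, rfl⟩⟩ := h <;> refine ⟨?_, ?_, ?_⟩ <;> linarith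

theorem bar_inj {B : Set (ℤ × ℤ)} {s s' : St B} {l l' : ℝ} (h0 : 0 ≤ l) (h1 : l < 1) (h0' : 0 ≤ l') (h1' : l' < 1)
    (he : md s + l * (md (sg B s) - md s) = md s' + l' * (md (sg B s') - md s')) : s = s' ∧ l = l' := by
  obtain ⟨β, γ, hb, e⟩ := bar_ex s l
  obtain ⟨β', γ', hb', e'⟩ := bar_ex s' l'
  obtain ⟨p1, p2, p3⟩ := hb.pos h0 h1.le
  obtain ⟨p1', p2', p3'⟩ := hb'.pos h0' h1'.le
  rw [e, e'] at he
  obtain ⟨⟨b, u⟩, hu, hB, hN⟩ := s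
  obtain ⟨⟨b', u'⟩, hu', hB', hN'⟩ := s'
  obtain ⟨rfl, hb⟩ := hb
  obtain ⟨rfl, hb'⟩ := hb'
  simp only at hu hB hN hu' hB' hN' he hb hb' e e'
  have H : ∀ x : ℤ × ℤ, (1 - β - l / 2) * (if b = x then 1 else 0) + β * (if b + u = x then 1 else 0) +
      l / 2 * (if b + Rt u = x then 1 else 0) = (1 - β' - l' / 2) * (if b' = x then 1 else 0) +
      β' * (if b' + u' = x then 1 else 0) + l' / 2 * (if b' + Rt u' = x then (1 : ℝ) else 0) := fun x => by
    rw [← phi_tri (fun q => if q = x then 1 else 0) b hu p1 p2 p3,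
      ← phi_tri (fun q => if q = x then 1 else 0) b' hu' p1' p2' p3', he]
  obtain ⟨n1, n2, n3, n4, n5⟩ := hu.ne
  obtain ⟨n1', n2', n3', -⟩ := hu'.ne
  have w : 0 < 1 - β - l / 2 ∧ 0 < β := by
    rcases hb with ⟨-, rfl⟩ | ⟨-, rfl⟩ <;> constructor <;> linarith
  have w' : 0 < 1 - β' - l' / 2 ∧ 0 < β' := by
    rcases hb' with ⟨-, rfl⟩ | ⟨-, rfl⟩ <;> constructor <;> linarith
  have d1 : b + u ≠ b := by simpa using n1
  have d2 : b + Rt u ≠ b := by simpa using n2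
  have d3 : b + Rt u ≠ b + u := by simpa using n3.symm
  have d1' : b' + u' ≠ b' := by simpa using n1'
  have d2' : b' + Rt u' ≠ b' := by simpa using n2'
  have d3' : b' + Rt u' ≠ b' + u' := by simpa using n3'.symm
  have f1 : b' = b ∨ b' + Rt u' = b := by
    by_contra! hc
    have := H b
    rw [if_pos rfl, if_neg d1, if_neg d2, if_neg hc.1, if_neg hc.2, if_neg (fun h => hN' (by rw [h]; exact hB))] at this
    linarith
  have f2 : b' + u' = b + u ∨ b' + Rt u' = b + u := by
    by_contra! hc
    have := H (b + u)
    rw [if_pos rfl, if_neg d1.symm, if_neg d3, if_neg hc.1, if_neg hc.2, if_neg (fun h => hN (by rw [← h]; exact hB'))] at this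
    linarith
  have g1 : b = b' ∨ b + Rt u = b' := by
    by_contra! hc
    have := H b'
    rw [if_pos rfl, if_neg d1', if_neg d2', if_neg hc.1, if_neg hc.2, if_neg (fun h => hN (by rw [h]; exact hB'))] at this
    linarith
  have g2 : b + u = b' + u' ∨ b + Rt u = b' + u' := by
    by_contra! hc
    have := H (b' + u')
    rw [if_pos rfl, if_neg d1'.symm, if_neg d3', if_neg hc.1, if_neg hc.2, if_neg (fun h => hN' (by rw [← h]; exact hB))] at this
    linarith
  have main : b = b' ∧ u = u' := by
    rcases f1 with f1 | f1 <;> rcases f2 with f2 | f2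
    · subst f1; exact ⟨rfl, (add_left_cancel f2).symm⟩
    · subst f1
      rcases g2 with g2 | g2
      · exact ⟨rfl, add_left_cancel g2⟩
      · have a1 := add_left_cancel g2
        have a2 := add_left_cancel f2
        rw [← a1, Rt_Rt] at a2
        exact (n4 (by rw [← sub_eq_iff_eq_add.1 a2])).elim
    · rcases g1 with g1 | g1
      · subst g1; exact ⟨rfl, (add_left_cancel f2).symm⟩
      · subst g1
        have a1 : Rt u + Rt u' = 0 := by rw [add_assoc] at f1; simpa using f1
        have a2 : Rt u + u' = u := by rw [add_assoc] at f2; exact add_left_cancel f2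
        have a3 : u' = u - Rt u := eq_sub_of_add_eq' a2
        rw [a3, Rt_sub, Rt_Rt] at a1
        exact (n5 (by rw [← a1]; abel)).elim
    · exact (d1 (f2.symm.trans f1)).elim
  obtain ⟨rfl, rfl⟩ := main
  refine ⟨rfl, ?_⟩
  have := H (b + Rt u)
  rw [if_neg d2.symm, if_neg d3.symm, if_pos rfl] at this
  linarith

noncomputable def poly (m : ℤ → ℂ) (t : ℝ) : ℂ := m ⌊t⌋ + (Int.fract t : ℝ) * (m (⌊t⌋ + 1) - m ⌊t⌋)

theorem poly_int (m : ℤ → ℂ) (k : ℤ) : poly m k = m k := by simp [poly]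

theorem poly_cont (m : ℤ → ℂ) : Continuous (poly m) := by
  have lf : LocallyFinite (fun k : ℤ => Icc (k : ℝ) (k + 1)) := by
    intro t
    refine ⟨Ioo (t - 1) (t + 1), Ioo_mem_nhds (by linarith) (by linarith), (finite_Icc (⌊t⌋ - 2) (⌊t⌋ + 2)).subset ?_⟩
    rintro k ⟨x, ⟨h1, h2⟩, h3, h4⟩
    have a1 := Int.floor_le t
    have a2 := Int.lt_floor_add_one t
    have b1 : ((⌊t⌋ - 2 - 1 : ℤ) : ℝ) < k := by push_cast; linarith
    have b2 : (k : ℝ) < ((⌊t⌋ + 2 : ℤ) : ℝ) := by push_cast; linarith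
    have b1' := Int.cast_lt.1 b1
    have b2' := Int.cast_lt.1 b2
    exact ⟨by omega, by omega⟩
  refine lf.continuous ?_ (fun k => isClosed_Icc) fun k => ?_
  · exact eq_univ_of_forall fun t => mem_iUnion.2 ⟨⌊t⌋, Int.floor_le t, (Int.lt_floor_add_one t).le⟩
  · have : ContinuousOn (fun t : ℝ => m k + ((t - k : ℝ) : ℂ) * (m (k + 1) - m k)) (Icc (k : ℝ) (k + 1)) := by fun_prop
    refine this.congr fun t ht => ?_
    rcases eq_or_lt_of_le ht.2 with h | h
    · have : t = ((k + 1 : ℤ) : ℝ) := by push_cast; exact h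
      rw [this, poly_int]; push_cast; ring
    · have hf : ⌊t⌋ = k := Int.floor_eq_iff.2 ⟨ht.1, h⟩
      rw [poly, ← Int.self_sub_floor, hf]

theorem Dir.norm {u : ℤ × ℤ} (h : Dir u) : ‖EE u‖ ≤ 2 := by
  refine (Complex.norm_le_abs_re_add_abs_im _).trans ?_
  rcases h with rfl | rfl | rfl | rfl | rfl | rfl <;> norm_num [EE]

theorem finite_EE (M : ℝ) : {q : ℤ × ℤ | ‖EE q‖ ≤ M}.Finite := by
  refine ((finite_Icc (-⌈M⌉) ⌈M⌉).prod (finite_Icc (-⌈M⌉) ⌈M⌉)).subset fun q hq => ?_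
  have h0 : ‖EE q‖ ≤ M := hq
  have a1 := abs_le.1 ((Complex.abs_re_le_norm (EE q)).trans (h0.trans (Int.le_ceil M)))
  have a2 := abs_le.1 ((Complex.abs_im_le_norm (EE q)).trans (h0.trans (Int.le_ceil M)))
  simp only [EE] at a1 a2
  exact ⟨⟨by exact_mod_cast a1.1, by exact_mod_cast a1.2⟩, ⟨by exact_mod_cast a2.1, by exact_mod_cast a2.2⟩⟩

theorem sg_ne {B : Set (ℤ × ℤ)} (s : St B) : sg B s ≠ s := by
  obtain ⟨n1, n2, n3, -⟩ := s.2.1.ne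
  intro h
  have h' := congrArg Subtype.val h
  by_cases hc : s.1.1 + Rt s.1.2 ∈ B
  · simp only [sg, Equiv.coe_fn_mk, hc, dite_true] at h'
    have := congrArg Prod.fst h'
    exact n2 (by simpa using this)
  · simp only [sg, Equiv.coe_fn_mk, hc, dite_false] at h'
    exact n3 (congrArg Prod.snd h').symm

noncomputable def colr (B : Set (ℤ × ℤ)) (q : ℤ × ℤ) : ℝ := open Classical in if q ∈ B then 1 else -1

theorem grid_path (B : Set (ℤ × ℤ)) (s0 : St B) : ∃ P : ℝ → ℂ, (∀ t, Phi (colr B) (P t) = 0) ∧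
    (∀ t, ∃ s : St B, ‖P t - EE s.1.1‖ ≤ 2) ∧
    (PLine P ∨ ∃ K, IsCompact K ∧ K ⊆ range P ∧ ¬ IsPreconnected Kᶜ) := by
  set e := sg B
  set S : ℤ → St B := fun k => (e ^ k) s0 with hS
  have hS1 : ∀ k, S (k + 1) = e (S k) := fun k => by rw [hS]; simp only; rw [add_comm, zpow_add, zpow_one]; rfl
  set P := poly (fun k => md (S k)) with hP
  have hPe : ∀ t, P t = md (S ⌊t⌋) + (Int.fract t : ℝ) * (md (e (S ⌊t⌋)) - md (S ⌊t⌋)) := fun t => by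
    rw [hP, poly, hS1]
  have hPi : ∀ k : ℤ, P k = md (S k) := fun k => poly_int _ k
  have inj : ∀ t t', P t = P t' → S ⌊t⌋ = S ⌊t'⌋ ∧ Int.fract t = Int.fract t' := fun t t' h => by
    rw [hPe, hPe] at h
    exact bar_inj (Int.fract_nonneg t) (Int.fract_lt_one t) (Int.fract_nonneg t') (Int.fract_lt_one t') h
  have hc : Continuous P := poly_cont _
  have near : ∀ t, ‖P t - EE (S ⌊t⌋).1.1‖ ≤ 2 := fun t => by
    obtain ⟨β, γ, hb, he⟩ := bar_ex (S ⌊t⌋) (Int.fract t)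
    obtain ⟨p1, p2, p3⟩ := hb.pos (Int.fract_nonneg t) (Int.fract_lt_one t).le
    have hu := (S ⌊t⌋).2.1
    rw [hPe, he, add_assoc, add_sub_cancel_left]
    refine (norm_add_le _ _).trans ?_
    rw [norm_mul, norm_mul, Complex.norm_of_nonneg p1, Complex.norm_of_nonneg p2]
    nlinarith [hu.norm, hu.rt.norm]
  refine ⟨P, fun t => ?_, fun t => ⟨_, near t⟩, ?_⟩
  · obtain ⟨β, γ, hb, he⟩ := bar_ex (S ⌊t⌋) (Int.fract t)
    obtain ⟨p1, p2, p3⟩ := hb.pos (Int.fract_nonneg t) (Int.fract_lt_one t).le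
    rw [hPe, he, phi_tri _ _ (S ⌊t⌋).2.1 p1 p2 p3]
    obtain ⟨hg, ⟨h1, hb⟩ | ⟨h1, hb⟩⟩ := hb <;> simp only [colr, h1, (S ⌊t⌋).2.2.1, (S ⌊t⌋).2.2.2, if_true, if_false, hg, hb] <;> ring
  by_cases hi : Function.Injective S
  · left
    refine ⟨hc, fun t t' h => ?_, ?_⟩
    · obtain ⟨h1, h2⟩ := inj t t' h
      rw [← Int.floor_add_fract t, hi h1, h2, Int.floor_add_fract]
    · rw [← cobounded_eq_cocompact (α := ℂ), ← tendsto_norm_atTop_iff_cobounded, Filter.tendsto_atTop]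
      intro M
      have fin : {k : ℤ | ‖EE (S k).1.1‖ ≤ M + 2}.Finite := by
        have f1 : {s : St B | ‖EE s.1.1‖ ≤ M + 2}.Finite := by
          have d : {u | Dir u}.Finite := by
            refine (Set.toFinite {(1, 0), (1, 1), (0, 1), (-1, 0), (-1, -1), (0, -1)}).subset fun u hu => ?_
            simpa [Dir] using hu
          refine Finite.of_finite_image (f := Subtype.val) (((finite_EE (M + 2)).prod d).subset ?_) Subtype.val_injective.injOn
          rintro _ ⟨s, hs, rfl⟩
          exact ⟨hs, s.2.1⟩
        exact f1.preimage hi.injOn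
      have fin2 : IsCompact (⋃ k ∈ {k : ℤ | ‖EE (S k).1.1‖ ≤ M + 2}, Icc (k : ℝ) (k + 1)) :=
        fin.isCompact_biUnion fun k _ => isCompact_Icc
      filter_upwards [fin2.compl_mem_cocompact] with t ht
      by_contra! hM
      refine ht (mem_biUnion (x := ⌊t⌋) ?_ ⟨Int.floor_le t, (Int.lt_floor_add_one t).le⟩)
      have := near t
      have h2 := norm_sub_norm_le (EE (S ⌊t⌋).1.1) (P t)
      rw [norm_sub_rev] at h2
      show ‖EE (S ⌊t⌋).1.1‖ ≤ M + 2
      linarith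
  · right
    have per : ∃ n : ℕ, 0 < n ∧ S n = s0 := by
      simp only [Function.Injective, not_forall] at hi
      obtain ⟨i, j, hij, hne⟩ := hi
      have key : ∀ i j : ℤ, i < j → S i = S j → ∃ n : ℕ, 0 < n ∧ S n = s0 := by
        intro i j hlt h
        refine ⟨(j - i).toNat, by omega, ?_⟩
        rw [Int.toNat_of_nonneg (by omega)]
        apply (e ^ i).injective
        show (e ^ i) ((e ^ (j - i)) s0) = (e ^ i) s0
        rw [← Equiv.Perm.mul_apply, ← zpow_add, add_sub_cancel]
        exact h.symm
      rcases lt_or_gt_of_ne hne with h | h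
      exacts [key i j h hij, key j i h hij.symm]
    classical
    obtain ⟨hN0, hN⟩ := Nat.find_spec per
    have hmin := fun m => Nat.find_min per (m := m)
    set N := Nat.find per
    have S0 : S 0 = s0 := rfl
    have hN1 : N ≠ 1 := fun h => by
      have := hS1 0
      rw [h] at hN
      rw [S0] at this
      exact sg_ne s0 (this.symm.trans hN)
    have hmin' : ∀ k : ℤ, 0 < k → k < N → S k ≠ S 0 := fun k h1 h2 h3 => hmin k.toNat (by omega) ⟨by omega, by
      rw [Int.toNat_of_nonneg h1.le]; exact h3⟩
    have hN2 : (2 : ℝ) ≤ N := by exact_mod_cast (show 2 ≤ N by omega)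
    have P0 : P 0 = md (S 0) := by simpa using hPi 0
    have P1 : P 1 = md (S 1) := by simpa using hPi 1
    have PN : P N = P 0 := by
      have := hPi N
      rw [P0, S0, ← hN]; simpa using this
    have P01 : P 0 ≠ P 1 := fun h => by
      have := (inj _ _ h).1
      simp only [Int.floor_zero, Int.floor_one] at this
      exact hmin' 1 one_pos (by omega) this.symm
    refine ⟨P '' Icc 0 1 ∪ (fun t : ℝ => P (N * (1 - t) + t)) '' Icc 0 1, ?_, ?_,
      two_paths_sep hc.continuousOn (by fun_prop) (by simp [PN]) (by simp) P01 ?_⟩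
    · exact (isCompact_Icc.image hc).union (isCompact_Icc.image (by fun_prop))
    · rintro z (⟨t, -, rfl⟩ | ⟨t, -, rfl⟩) <;> exact mem_range_self _
    · rintro z ⟨⟨t, ht, rfl⟩, t', ht', he⟩
      simp only at he
      rcases eq_or_lt_of_le ht.2 with rfl | h1
      · right; rfl
      rcases eq_or_lt_of_le ht'.1 with rfl | h2
      · left; rw [← he]; simp [PN]
      exfalso
      set x := N * (1 - t') + t' with hx
      have x1 : 1 ≤ x := by nlinarith [ht'.2]
      have x2 : x < N := by nlinarith
      have hf : ⌊t⌋ = 0 := Int.floor_eq_zero_iff.2 ⟨ht.1, h1⟩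
      have := (inj _ _ he).1
      rw [hf] at this
      refine hmin' ⌊x⌋ (Int.floor_pos.2 x1) ?_ this
      have := (Int.floor_le x).trans_lt x2
      exact_mod_cast this

def Chn (B : Set (ℤ × ℤ)) : ℤ × ℤ → ℤ × ℤ → Prop := Relation.ReflTransGen fun q r => Dir (r - q) ∧ r ∈ B

theorem lat_ind {T : Set (ℤ × ℤ)} {q0 : ℤ × ℤ} (h0 : q0 ∈ T) (hT : ∀ q u, Dir u → q ∈ T → q + u ∈ T) (q : ℤ × ℤ) :
    q ∈ T := by
  have a1 : ∀ q1 ∈ T, ∀ u, Dir u → ∀ i : ℤ, q1 + i • u ∈ T := by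
    intro q1 h1 u hu i
    induction i with
    | zero => simpa using h1
    | succ i ih => rw [add_smul, one_smul, ← add_assoc]; exact hT _ _ hu ih
    | pred i ih => rw [sub_smul, one_smul, sub_eq_add_neg, ← add_assoc]; exact hT _ _ hu.neg ih
  have := a1 _ (a1 _ h0 (1, 0) (by simp [Dir]) (q.1 - q0.1)) (0, 1) (by simp [Dir]) (q.2 - q0.2)
  convert this using 1
  ext <;> simp

theorem choose_B {B0 : Set (ℤ × ℤ)} {qp qm : ℤ × ℤ} (hp : qp ∈ B0) (hm : qm ∉ B0) : ∃ B : Set (ℤ × ℤ),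
    qp ∈ B ∧ qm ∉ B ∧ (∀ q ∈ B, Chn B qp q) ∧ (∀ q ∉ B, Chn Bᶜ qm q) ∧
    ∀ b u, Dir u → b ∈ B → b + u ∉ B → b ∈ B0 ∧ b + u ∉ B0 := by
  set B1 : Set (ℤ × ℤ) := {q | Chn B0 qp q} with hB1
  have s1 : B1 ⊆ B0 := fun q hq => by
    rcases Relation.ReflTransGen.cases_tail hq with h | ⟨r, -, h⟩
    exacts [h ▸ hp, h.2]
  set N1 : Set (ℤ × ℤ) := {q | Chn B1ᶜ qm q} with hN1
  have s2 : N1 ⊆ B1ᶜ := fun q hq => by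
    rcases Relation.ReflTransGen.cases_tail hq with h | ⟨r, -, h⟩
    exacts [h ▸ fun h => hm (s1 h), h.2]
  have adj : ∀ b u, Dir u → b ∉ N1 → b + u ∈ N1 → b ∈ B1 := fun b u hu hb hn => by
    by_contra h
    exact hb (Relation.ReflTransGen.tail hn ⟨by simpa using hu.neg, h⟩)
  have cB1 : ∀ q ∈ B1, Chn N1ᶜ qp q := by
    intro q hq
    induction hq with
    | refl => exact Relation.ReflTransGen.refl
    | tail h1 h2 ih => exact ih.tail ⟨h2.1, fun h => s2 h (Relation.ReflTransGen.tail h1 h2)⟩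
  refine ⟨N1ᶜ, fun h => s2 h Relation.ReflTransGen.refl, not_not.2 Relation.ReflTransGen.refl, ?_, ?_, ?_⟩
  · have : ∀ q, q ∈ {q | q ∈ N1 ∨ Chn N1ᶜ qp q} := lat_ind (q0 := qm) (Or.inl Relation.ReflTransGen.refl) (by
      intro q u hu hq
      by_cases hn : q + u ∈ N1
      · exact Or.inl hn
      rcases hq with hq | hq
      · exact Or.inr (cB1 _ (adj _ _ hu.neg hn (by simpa using hq)))
      · exact Or.inr (hq.tail ⟨by simpa using hu, hn⟩))
    exact fun q hq => (this q).resolve_left hq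
  · intro q hq
    have hq : q ∈ N1 := not_not.1 hq
    rw [compl_compl]
    induction hq with
    | refl => exact Relation.ReflTransGen.refl
    | tail h1 h2 ih => exact (ih (not_not.2 h1)).tail ⟨h2.1, Relation.ReflTransGen.tail h1 h2⟩
  · intro b u hu hb hn
    have hn : b + u ∈ N1 := not_not.1 hn
    have h1 := adj b u hu hb hn
    exact ⟨s1 h1, fun h => s2 hn (Relation.ReflTransGen.tail h1 ⟨by simpa using hu, h⟩)⟩

theorem exists_St {B : Set (ℤ × ℤ)} {qp qm : ℤ × ℤ} (hp : qp ∈ B) (hm : qm ∉ B) : Nonempty (St B) := by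
  by_contra h
  refine lat_ind (T := Bᶜ) hm (fun q u hu hq hn => h ⟨⟨(q + u, -u), hu.neg, hn, ?_⟩⟩) qp hp
  simpa using hq

def InT (b u : ℤ × ℤ) (z : ℂ) : Prop := ∃ β γ : ℝ, 0 ≤ β ∧ 0 ≤ γ ∧ β + γ ≤ 1 ∧ z = EE b + β * EE u + γ * EE (Rt u)

theorem inT0 (b u : ℤ × ℤ) : InT b u (EE b) := ⟨0, 0, le_rfl, le_rfl, by norm_num, by simp⟩

theorem inT1 (b u : ℤ × ℤ) : InT b u (EE (b + u)) := ⟨1, 0, by norm_num, le_rfl, by norm_num, by simp [EE_add]⟩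

theorem inT2 (b u : ℤ × ℤ) : InT b u (EE (b + Rt u)) := ⟨0, 1, le_rfl, by norm_num, by norm_num, by simp [EE_add]⟩

theorem tri_join {c : ℤ × ℤ → ℝ} {K : Set ℂ} (hK : ∀ z ∈ K, Phi c z = 0) {b u : ℤ × ℤ} (hu : Dir u) {z w : ℂ}
    (hz : InT b u z) (hw : InT b u w) (hzK : z ∉ K) (ε : ℝ) (h1 : 0 ≤ ε * Phi c z) (h2 : 0 < ε * Phi c w) :
    connectedComponentIn Kᶜ w = connectedComponentIn Kᶜ z := by
  obtain ⟨β, γ, p1, p2, p3, rfl⟩ := hz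
  obtain ⟨β', γ', q1, q2, q3, rfl⟩ := hw
  rw [phi_tri c b hu p1 p2 p3] at h1
  rw [phi_tri c b hu q1 q2 q3] at h2
  set z := EE b + β * EE u + γ * EE (Rt u)
  set w := EE b + β' * EE u + γ' * EE (Rt u) with hw
  refine connectedComponentIn_eq (same_comp_of_subset (convex_segment z w).isPreconnected ?_
    (left_mem_segment ℝ z w) (right_mem_segment ℝ z w)) |>.symm
  rintro x ⟨r, s, hr, hs, hrs, rfl⟩ hx
  rcases eq_or_lt_of_le hs with rfl | hs'
  · rw [add_zero] at hrs; subst hrs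
    exact hzK (by simpa using hx)
  have e : r • z + s • w = EE b + ((r * β + s * β' : ℝ) : ℂ) * EE u + ((r * γ + s * γ' : ℝ) : ℂ) * EE (Rt u) := by
    have : (r : ℂ) + s = 1 := by exact_mod_cast hrs
    rw [hw]; simp only [z, Complex.real_smul]; push_cast
    linear_combination EE b * this
  have := hK _ hx
  rw [e, phi_tri c b hu (by positivity) (by positivity) (by nlinarith)] at this
  have e2 : r * (ε * ((1 - β - γ) * c b + β * c (b + u) + γ * c (b + Rt u))) +
      s * (ε * ((1 - β' - γ') * c b + β' * c (b + u) + γ' * c (b + Rt u))) = 0 := by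
    rw [← mul_zero ε, ← this]
    linear_combination ε * c b * hrs
  have := mul_pos hs' h2
  have := mul_nonneg hr h1
  linarith

theorem phi_EE (c : ℤ × ℤ → ℝ) (q : ℤ × ℤ) : Phi c (EE q) = c q := by
  have := phi_tri c q (u := (1, 0)) (by simp [Dir]) le_rfl le_rfl (by norm_num)
  simpa using this

theorem chain_join {B C : Set (ℤ × ℤ)} {K : Set ℂ} (hK : ∀ z ∈ K, Phi (colr B) z = 0) (ε : ℝ)
    (hC : ∀ q ∈ C, 0 < ε * colr B q) {q0 q : ℤ × ℤ} (h0 : q0 ∈ C) (hq : Chn C q0 q) :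
    connectedComponentIn Kᶜ (EE q) = connectedComponentIn Kᶜ (EE q0) := by
  induction hq with
  | refl => rfl
  | @tail q r h1 h2 ih =>
    have hq : q ∈ C := by
      rcases Relation.ReflTransGen.cases_tail h1 with h | ⟨r, -, h⟩
      exacts [h ▸ h0, h.2]
    rw [← ih]
    refine tri_join hK h2.1 (inT0 q _) (by simpa using inT1 q (r - q)) ?_ ε ?_ ?_
    · intro h
      have := hC q hq
      rw [← phi_EE (colr B) q, hK _ h] at this
      simp at this
    · rw [phi_EE]; exact (hC q hq).le
    · rw [phi_EE]; exact hC r h2.2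

theorem grid_cover {B : Set (ℤ × ℤ)} {qp qm : ℤ × ℤ} (hp : qp ∈ B) (hm : qm ∉ B) (hcp : ∀ q ∈ B, Chn B qp q)
    (hcm : ∀ q ∉ B, Chn Bᶜ qm q) {K : Set ℂ} (hK : ∀ z ∈ K, Phi (colr B) z = 0) (z : ℂ) (hz : z ∉ K) :
    z ∈ connectedComponentIn Kᶜ (EE qp) ∨ z ∈ connectedComponentIn Kᶜ (EE qm) := by
  obtain ⟨b, u, β, γ, hu, p1, p2, p3, e⟩ := exists_tri z
  have hzT : InT b u z := ⟨β, γ, p1, p2, p3, e⟩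
  have hph := phi_tri (colr B) b hu p1 p2 p3
  rw [← e] at hph
  have c1 : ∀ q ∈ B, colr B q = 1 := fun q hq => if_pos hq
  have c2 : ∀ q ∉ B, colr B q = -1 := fun q hq => if_neg hq
  rcases le_or_gt 0 (Phi (colr B) z) with h | h
  · left
    have : ∃ q ∈ B, InT b u (EE q) := by
      by_contra! hn
      rw [c2 b fun h => hn _ h (inT0 b u), c2 _ fun h => hn _ h (inT1 b u), c2 _ fun h => hn _ h (inT2 b u)] at hph
      linarith
    obtain ⟨q, hq, hT⟩ := this
    rw [← chain_join hK 1 (fun q hq => by rw [c1 q hq]; norm_num) hp (hcp q hq),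
      tri_join hK hu hzT hT hz 1 (by linarith) (by rw [phi_EE, c1 q hq]; norm_num)]
    exact mem_connectedComponentIn hz
  · right
    have : ∃ q ∉ B, InT b u (EE q) := by
      by_contra! hn
      have hn' : ∀ q, InT b u (EE q) → q ∈ B := fun q h => by_contra fun h' => hn q h' h
      rw [c1 b (hn' _ (inT0 b u)), c1 _ (hn' _ (inT1 b u)), c1 _ (hn' _ (inT2 b u))] at hph
      linarith
    obtain ⟨q, hq, hT⟩ := this
    rw [← chain_join hK (-1) (fun q hq => by rw [c2 q hq]; norm_num) hm (hcm q hq),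
      tri_join hK hu hzT hT hz (-1) (by linarith) (by rw [phi_EE, c2 q hq]; norm_num)]
    exact mem_connectedComponentIn hz

theorem unbdd_of_f {f : ℂ → ℝ} (hf : Continuous f) {C : Set ℂ} (h : ∀ M : ℝ, ∃ z ∈ C, M < |f z|) :
    ¬ Bornology.IsBounded C := by
  intro hb
  obtain ⟨M, hM⟩ := (hb.isCompact_closure).exists_bound_of_continuousOn hf.continuousOn
  obtain ⟨z, hz, h⟩ := h M
  exact absurd (hM z (subset_closure hz)) (by rw [Real.norm_eq_abs]; linarith)

theorem conj_of_unif (g : ℂ ≃ₜ ℂ) (f : ℂ → ℝ) (hf : Continuous f) (hfg : ∀ z, f (g z) = f z + 1)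
    (hu : ∀ z w, dist z w ≤ 3 → |f z - f w| < 1 / 4) :
    ∃ (h : ℂ ≃ₜ ℂ) (δ : ℝ) (hδ : δ * δ = 1), ∀ z, h (tau δ hδ z) = g (h z) := by
  have fz : ∀ (n : ℤ) z, f ((g ^ n) z) = f z + n := by
    intro n z
    induction n with
    | zero => simp
    | succ n ih => rw [zp_succ, hfg, ih]; push_cast; ring
    | pred n ih =>
      have := hfg ((g ^ (-(n : ℤ) - 1)) z)
      rw [← zp_succ, sub_add_cancel, ih] at this
      push_cast at this ⊢; linarith
  have same : ∀ z, ∃ N : ℤ, ∀ K : Set ℂ, (∀ w ∈ K, |f w| < 1 / 2) → ∀ n : ℤ, N ≤ |n| →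
      (g ^ n) z ∈ connectedComponentIn Kᶜ ((g ^ n) 0) := by
    intro z
    have hcs : IsCompact (segment ℝ 0 z) := by
      rw [segment_eq_image]; exact isCompact_Icc.image (by fun_prop)
    obtain ⟨M, hM⟩ := hcs.exists_bound_of_continuousOn hf.continuousOn
    refine ⟨⌈M⌉ + 1, fun K hK n hn => same_comp_of_subset
      ((convex_segment (0 : ℂ) z).isPreconnected.image _ (g ^ n).continuous.continuousOn) ?_
      (mem_image_of_mem _ (left_mem_segment ℝ 0 z)) (mem_image_of_mem _ (right_mem_segment ℝ 0 z))⟩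
    rintro _ ⟨w, hw, rfl⟩ hwK
    have h1 := hM w hw
    have h2 := hK _ hwK
    rw [fz] at h2
    rw [Real.norm_eq_abs] at h1
    have h3 : (⌈M⌉ : ℝ) + 1 ≤ |(n : ℝ)| := by exact_mod_cast hn
    have h4 := Int.le_ceil M
    have h5 : |(n : ℝ)| ≤ |f w + n| + |f w| := by
      have := abs_sub (f w + n) (f w)
      rwa [add_sub_cancel_left] at this
    linarith
  obtain ⟨N1, hN1⟩ := same (g 0)
  obtain ⟨n0, hn0, hn1⟩ : ∃ n0 : ℤ, N1 + 1 ≤ n0 ∧ |f 0| + 2 < n0 ∧ 0 < n0 := by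
    refine ⟨max (N1 + 1) (⌈|f 0|⌉ + 3), le_max_left _ _, ?_, ?_⟩
    · have h1 := Int.le_ceil |f 0|
      have h2 : ((⌈|f 0|⌉ + 3 : ℤ) : ℝ) ≤ (max (N1 + 1) (⌈|f 0|⌉ + 3) : ℤ) := by exact_mod_cast le_max_right _ _
      push_cast at h2 ⊢; linarith
    · have := Int.ceil_nonneg (abs_nonneg (f 0))
      exact lt_max_of_lt_right (by omega)
  obtain ⟨hn1, hnp⟩ := hn1
  have f0 := abs_le.1 (le_refl |f 0|)

  have lat : ∀ z, ∃ q : ℤ × ℤ, |f (EE q) - f z| < 1 / 4 ∧ ∀ K : Set ℂ, (∀ w ∈ K, |f w| < 1 / 2) → 1 < |f z| →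
      connectedComponentIn Kᶜ (EE q) = connectedComponentIn Kᶜ z := by
    intro z
    have hq : dist (EE (⌊z.re⌋, ⌊z.im⌋)) z ≤ 3 := by
      rw [Complex.dist_eq]
      refine (Complex.norm_le_abs_re_add_abs_im _).trans ?_
      have e1 : (EE (⌊z.re⌋, ⌊z.im⌋) - z).re = -Int.fract z.re := by
        simp [EE, ← Int.self_sub_floor]
      have e2 : (EE (⌊z.re⌋, ⌊z.im⌋) - z).im = -Int.fract z.im := by
        simp [EE, ← Int.self_sub_floor]
      rw [e1, e2, abs_neg, abs_neg, Int.abs_fract, Int.abs_fract]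
      linarith [Int.fract_lt_one z.re, Int.fract_lt_one z.im]
    refine ⟨_, hu _ _ hq, fun K hK hz => (connectedComponentIn_eq (same_comp_of_subset
      (convex_closedBall z 3).isPreconnected ?_ (mem_closedBall_self (by norm_num)) (mem_closedBall.2 hq))).symm⟩
    intro w hw hwK
    have h1 := hu w z (mem_closedBall.1 hw)
    have h2 := hK w hwK
    have h3 := abs_sub_abs_le_abs_sub (f z) (f w)
    rw [abs_sub_comm] at h3
    linarith
  have hp0 : 1 < f ((g ^ n0) 0) := by rw [fz]; linarith
  have hm0 : f ((g ^ (-n0)) 0) < -1 := by rw [fz]; push_cast; linarith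
  obtain ⟨qp, hqp, cqp⟩ := lat ((g ^ n0) 0)
  obtain ⟨qm, hqm, cqm⟩ := lat ((g ^ (-n0)) 0)
  have endp : ∀ K : Set ℂ, (∀ w ∈ K, |f w| < 1 / 2) → ∀ n, n0 ≤ n →
      connectedComponentIn Kᶜ ((g ^ n) 0) = connectedComponentIn Kᶜ (EE qp) := by
    intro K hK n hn
    rw [cqp K hK (hp0.trans_le (le_abs_self _))]
    induction n, hn using Int.leInduction with
    | base => rfl
    | succ n hn ih =>
      rw [← ih, connectedComponentIn_eq (hN1 K hK n (by rw [abs_of_nonneg] <;> omega)), zp_add, zpow_one]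
  have endm : ∀ K : Set ℂ, (∀ w ∈ K, |f w| < 1 / 2) → ∀ n, n ≤ -n0 →
      connectedComponentIn Kᶜ ((g ^ n) 0) = connectedComponentIn Kᶜ (EE qm) := by
    intro K hK n hn
    rw [cqm K hK (lt_abs.2 (Or.inr (by linarith)))]
    induction n, hn using Int.leInductionDown with
    | base => rfl
    | pred n hn ih =>
      rw [← ih, connectedComponentIn_eq (hN1 K hK (n - 1) (by rw [abs_of_nonpos] <;> omega))]
      have := zp_add g (n - 1) 1 0
      rw [sub_add_cancel, zpow_one] at this
      rw [this]
  have notK : ∀ K : Set ℂ, (∀ w ∈ K, |f w| < 1 / 2) → ∀ n, n0 ≤ |n| → (g ^ n) 0 ∈ Kᶜ := by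
    intro K hK n hn h
    have := hK _ h
    rw [fz] at this
    have h2 : (n0 : ℝ) ≤ |(n : ℝ)| := by exact_mod_cast hn
    have h5 : |(n : ℝ)| ≤ |f 0 + n| + |f 0| := by
      have := abs_sub (f 0 + n) (f 0)
      rwa [add_sub_cancel_left] at this
    linarith
  have inp : ∀ K : Set ℂ, (∀ w ∈ K, |f w| < 1 / 2) → ∀ n, n0 ≤ n → (g ^ n) 0 ∈ connectedComponentIn Kᶜ (EE qp) :=
    fun K hK n hn => endp K hK n hn ▸ mem_connectedComponentIn (notK K hK n (hn.trans (le_abs_self n)))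
  have inm : ∀ K : Set ℂ, (∀ w ∈ K, |f w| < 1 / 2) → ∀ n, n ≤ -n0 → (g ^ n) 0 ∈ connectedComponentIn Kᶜ (EE qm) :=
    fun K hK n hn => endm K hK n hn ▸ mem_connectedComponentIn (notK K hK n (le_abs.2 (Or.inr (by omega))))
  have ubp : ∀ K : Set ℂ, (∀ w ∈ K, |f w| < 1 / 2) → ¬ Bornology.IsBounded (connectedComponentIn Kᶜ (EE qp)) := by
    intro K hK
    refine unbdd_of_f hf fun M => ⟨_, inp K hK (max n0 (⌈M + |f 0|⌉ + 1)) (le_max_left _ _), ?_⟩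
    have h1 := Int.le_ceil (M + |f 0|)
    have h2 : ((⌈M + |f 0|⌉ + 1 : ℤ) : ℝ) ≤ (max n0 (⌈M + |f 0|⌉ + 1) : ℤ) := by exact_mod_cast le_max_right _ _
    rw [fz]; rw [Int.cast_add, Int.cast_one] at h2
    exact lt_of_lt_of_le (by linarith) (le_abs_self _)
  have ubm : ∀ K : Set ℂ, (∀ w ∈ K, |f w| < 1 / 2) → ¬ Bornology.IsBounded (connectedComponentIn Kᶜ (EE qm)) := by
    intro K hK
    refine unbdd_of_f hf fun M => ⟨_, inm K hK (-(max n0 (⌈M + |f 0|⌉ + 1))) (neg_le_neg (le_max_left _ _)), ?_⟩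
    have h1 := Int.le_ceil (M + |f 0|)
    have h2 : ((⌈M + |f 0|⌉ + 1 : ℤ) : ℝ) ≤ (max n0 (⌈M + |f 0|⌉ + 1) : ℤ) := by exact_mod_cast le_max_right _ _
    rw [fz, Int.cast_neg]; rw [Int.cast_add, Int.cast_one] at h2
    exact lt_of_lt_of_le (by linarith) (neg_le_abs _)

  have a1 := abs_lt.1 hqp
  have a2 := abs_lt.1 hqm
  obtain ⟨B, hpB, hmB, cp, cm, hmix⟩ := choose_B (B0 := {q | 0 < f (EE q)}) (qp := qp) (qm := qm)
    (show 0 < f (EE qp) by linarith) (show ¬ 0 < f (EE qm) by linarith)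
  obtain ⟨s0⟩ := exists_St hpB hmB
  obtain ⟨L, hL0, hLn, hL⟩ := grid_path B s0
  have fL : ∀ w ∈ range L, |f w| < 1 / 2 := by
    rintro _ ⟨t, rfl⟩
    obtain ⟨s, hs⟩ := hLn t
    obtain ⟨m1, m2⟩ := hmix _ _ s.2.1 s.2.2.1 s.2.2.2
    have h1 : 0 < f (EE s.1.1) := m1
    have h2 : f (EE (s.1.1 + s.1.2)) ≤ 0 := not_lt.1 m2
    have h3 := abs_lt.1 (hu (EE s.1.1) (EE (s.1.1 + s.1.2)) (by
      rw [dist_comm, Complex.dist_eq, EE_add, add_sub_cancel_left]; linarith [s.2.1.norm]))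
    have h4 := abs_lt.1 (hu (L t) (EE s.1.1) (by rw [Complex.dist_eq]; linarith))
    exact abs_lt.2 ⟨by linarith, by linarith⟩
  have phL : ∀ z ∈ range L, Phi (colr B) z = 0 := by rintro _ ⟨t, rfl⟩; exact hL0 t
  rcases hL with hL | ⟨K, hKc, hKL, hK⟩
  swap
  · refine (hK ?_).elim
    have e := comp_eq_of_unbounded hKc (ubp K fun w hw => fL w (hKL hw)) (ubm K fun w hw => fL w (hKL hw))
    have : Kᶜ = connectedComponentIn Kᶜ (EE qp) := Subset.antisymm (fun z hz => by
      rcases grid_cover hpB hmB cp cm (fun z hz => phL z (hKL hz)) z hz with h | h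
      exacts [h, e ▸ h]) (connectedComponentIn_subset _ _)
    rw [this]; exact isPreconnected_connectedComponentIn
  have cov := grid_cover hpB hmB cp cm phL
  have ha : EE qm ∉ range L := fun h => by
    have := phL _ h
    rw [phi_EE, colr, if_neg hmB] at this; norm_num at this
  have hb : EE qp ∉ range L := fun h => by
    have := phL _ h
    rw [phi_EE, colr, if_pos hpB] at this; norm_num at this
  have hbF : EE qp ∈ Far L (EE qm) := by
    rintro (h | h)
    · exact hb h
    obtain ⟨z, hz⟩ := hL.far_nonempty ha
    refine hz (Or.inr ?_)
    rcases cov z (fun h => hz (Or.inl h)) with h' | h'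
    · rwa [connectedComponentIn_eq h]
    · exact h'
  have hU := hL.far_eq_comp ha hbF
  set V := connectedComponentIn (range L)ᶜ (EE qm) with hV
  set U := Far L (EE qm) with hUd
  have oV : IsOpen V := isOpen_comp hL.closed _
  have UV : U ⊆ Vᶜ := fun z hz h => hz (Or.inr h)
  have pU : ∀ n, n0 ≤ n → (g ^ n) 0 ∈ U := fun n hn => hU ▸ inp _ fL n hn
  have pV : ∀ n, n ≤ -n0 → (g ^ n) 0 ∈ V := fun n hn => inm _ fL n hn
  have gL : ∀ w ∈ range L, g w ∉ range L := fun w hw h => by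
    have h1 := abs_lt.1 (fL _ hw)
    have h2 := abs_lt.1 (fL _ h)
    rw [hfg] at h2; linarith
  have pre : ∀ S : Set ℂ, IsPreconnected S → IsPreconnected (g ⁻¹' S) := fun S hS => by
    rw [← g.image_symm]
    exact hS.image _ g.symm.continuous.continuousOn
  refine line_conj hL ha ⟨oV.isClosed_compl, hL.far_open ha, UV, ?_, fun z => ?_, fun z => ?_⟩
  · have pL : IsPreconnected (g '' range L) :=
      (isPreconnected_range hL.cont).image _ g.continuous.continuousOn
    have sL : ∀ w ∈ range L, g w ∈ connectedComponentIn (range L)ᶜ (g (L 0)) := fun w hw =>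
      same_comp_of_subset pL (by rintro _ ⟨w, hw, rfl⟩; exact gL w hw) ⟨L 0, mem_range_self _, rfl⟩ ⟨w, hw, rfl⟩
    rcases cov (g (L 0)) (gL _ (mem_range_self _)) with h | h
    · rw [← connectedComponentIn_eq h, ← hU] at sL
      have pS : IsPreconnected (V ∪ range L) := isPreconnected_connectedComponentIn.subset_closure
        subset_union_left (union_subset subset_closure (hL.sub_cl_comp ha))
      have sub : g ⁻¹' (V ∪ range L) ⊆ V := by
        have hx : (g ^ (-n0 - 1)) 0 ∈ V := pV _ (by omega)
        intro z hz
        rw [hV, connectedComponentIn_eq hx]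
        refine same_comp_of_subset (pre _ pS) ?_ ?_ hz
        · rintro w (hw | hw) hwL
          · exact UV (sL w hwL) hw
          · exact gL w hwL hw
        · left; rw [← zp_succ, sub_add_cancel]; exact pV _ le_rfl
      exact fun z hz h => hz (sub h.symm)
    · rw [← connectedComponentIn_eq h, ← hV] at sL
      have pS : IsPreconnected (U ∪ range L) := (hL.far_preconn ha).subset_closure
        subset_union_left (union_subset subset_closure (hL.sub_cl_far ha))
      have sub : g ⁻¹' (U ∪ range L) ⊆ U := by
        have hx : (g ^ n0) 0 ∈ U := pU _ le_rfl
        rw [hU] at hx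
        intro z hz
        rw [hU, connectedComponentIn_eq hx]
        refine same_comp_of_subset (pre _ pS) ?_ ?_ hz
        · rintro w (hw | hw) hwL
          · exact UV hw (sL w hwL)
          · exact gL w hwL hw
        · left; rw [← zp_succ]; exact pU _ (by omega)
      exfalso
      have all : ∀ n, n ≤ n0 → (g ^ n) 0 ∈ U := by
        intro n hn
        induction n, hn using Int.leInductionDown with
        | base => exact pU _ le_rfl
        | pred n hn ih =>
          apply sub
          left; rw [← zp_succ, sub_add_cancel]; exact ih
      exact UV (all (-n0) (by omega)) (pV _ le_rfl)
  · obtain ⟨N, hN⟩ := same z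
    refine ⟨max N n0, UV ?_⟩
    rw [hU, ← endp _ fL _ (le_max_right N n0)]
    exact hN _ fL _ ((le_max_left N n0).trans (le_abs_self _))
  · obtain ⟨N, hN⟩ := same z
    refine ⟨-max N n0, not_not.2 ?_⟩
    rw [← endm _ fL _ (neg_le_neg (le_max_right N n0))]
    exact hN _ fL _ ((le_max_left N n0).trans (by rw [abs_neg]; exact le_abs_self _))

theorem radial_exp {a a' : ℝ} (ha : 0 ≤ a) (h : a ≤ a') {u u' : ℂ} (hu : ‖u‖ ≤ ‖u'‖) :
    a * ‖u - u'‖ ≤ ‖(a : ℂ) * u - a' * u'‖ := by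
  have e : (a' : ℂ) * u' - a * u = a • (u' - u) + (a' - a) • u' := by
    simp only [Complex.real_smul]; push_cast; ring
  rw [norm_sub_rev, norm_sub_rev (_ * u), e]
  have h1 : a * ‖u' - u‖ = ‖a • (u' - u)‖ := by rw [norm_smul, Real.norm_of_nonneg ha]
  rw [h1]
  refine le_of_sq_le_sq ?_ (norm_nonneg _)
  rw [norm_add_sq_real, real_inner_smul_left, real_inner_smul_right, inner_sub_left, real_inner_self_eq_norm_sq]
  have h2 := real_inner_le_norm u u'
  have h3 : 0 ≤ ‖u'‖ ^ 2 - inner ℝ u u' := by nlinarith [norm_nonneg u']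
  have h4 := mul_nonneg ha (mul_nonneg (sub_nonneg.2 h) h3)
  nlinarith [sq_nonneg ‖(a' - a) • u'‖]

theorem radial_homeo {κ : ℝ → ℝ} (hc : Continuous κ) (hm : Monotone κ) (h1 : ∀ r, 0 ≤ r → 1 ≤ κ r) :
    ∃ Ψ : ℂ ≃ₜ ℂ, ∀ u u', ‖u‖ ≤ ‖u'‖ → κ ‖u‖ * ‖u - u'‖ ≤ ‖Ψ u - Ψ u'‖ := by
  set F : ℂ → ℂ := fun u => (κ ‖u‖ : ℂ) * u with hF
  have ex : ∀ u u', ‖u‖ ≤ ‖u'‖ → κ ‖u‖ * ‖u - u'‖ ≤ ‖F u - F u'‖ := fun u u' h =>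
    radial_exp (zero_le_one.trans (h1 _ (norm_nonneg u))) (hm h) h
  have ex1 : ∀ u u', ‖u - u'‖ ≤ ‖F u - F u'‖ := by
    intro u u'
    rcases le_total ‖u‖ ‖u'‖ with h | h
    · nlinarith [ex u u' h, h1 _ (norm_nonneg u), norm_nonneg (u - u')]
    · rw [norm_sub_rev, norm_sub_rev (F u)]
      nlinarith [ex u' u h, h1 _ (norm_nonneg u'), norm_nonneg (u' - u)]
  have inj : Function.Injective F := fun u u' h => by
    have := ex1 u u'
    rw [h, sub_self, norm_zero] at this
    exact sub_eq_zero.1 (norm_le_zero_iff.1 this)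
  have surj : Function.Surjective F := by
    intro w
    rcases eq_or_ne w 0 with rfl | hw
    · exact ⟨0, by simp [hF]⟩
    have hw' : 0 < ‖w‖ := norm_pos_iff.2 hw
    have hcn : ContinuousOn (fun r => κ r * r) (Icc 0 ‖w‖) := by fun_prop
    obtain ⟨r, hr, e⟩ := intermediate_value_Icc hw'.le hcn
      (show ‖w‖ ∈ _ from ⟨by simp, by nlinarith [h1 ‖w‖ hw'.le]⟩)
    refine ⟨((r / ‖w‖ : ℝ) : ℂ) * w, ?_⟩
    have en : ‖((r / ‖w‖ : ℝ) : ℂ) * w‖ = r := by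
      rw [norm_mul, Complex.norm_of_nonneg (div_nonneg hr.1 hw'.le), div_mul_cancel₀ _ hw'.ne']
    simp only [hF, en]
    rw [← mul_assoc, ← Complex.ofReal_mul, mul_div_assoc']
    simp only at e
    rw [e, div_self hw'.ne', Complex.ofReal_one, one_mul]
  let Q := Equiv.ofBijective F ⟨inj, surj⟩
  have hQ : ∀ z, F (Q.symm z) = z := fun z => Equiv.ofBijective_apply_symm_apply F ⟨inj, surj⟩ z
  refine ⟨⟨Q, by show Continuous F; fun_prop, ?_⟩, ex⟩
  refine (LipschitzWith.of_dist_le_mul (K := 1) fun x y => ?_).continuous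
  have := ex1 (Q.symm x) (Q.symm y)
  rw [hQ, hQ] at this
  rw [dist_eq_norm, dist_eq_norm, NNReal.coe_one, one_mul]
  exact this

theorem exists_unif {f : ℂ → ℝ} (hf : Continuous f) : ∃ Ψ : ℂ ≃ₜ ℂ, ∀ z w, dist z w ≤ 3 →
    |f (Ψ.symm z) - f (Ψ.symm w)| < 1 / 4 := by
  have hex : ∀ k : ℕ, ∃ c : ℝ, 1 ≤ c ∧ ∀ u u' : ℂ, ‖u‖ ≤ k + 1 → c * ‖u - u'‖ ≤ 3 → |f u - f u'| < 1 / 4 := by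
    intro k
    have := (isCompact_closedBall (0 : ℂ) (k + 1)).uniformContinuousAt_of_continuousAt f
      (fun a _ => hf.continuousAt) (dist_mem_uniformity (show (0 : ℝ) < 1 / 4 by norm_num))
    obtain ⟨ε, hε, h⟩ := mem_uniformity_dist.1 this
    refine ⟨1 + 6 / ε, by have : 0 < 6 / ε := by positivity
                          linarith, fun u u' hu h3 => ?_⟩
    have hd : dist u u' < ε := by
      rw [dist_eq_norm]
      by_contra! hc
      have : 6 / ε * ε = 6 := div_mul_cancel₀ _ hε.ne'
      have h6 : 0 < 6 / ε := by positivity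
      nlinarith
    have := h hd (by simpa using hu)
    rwa [← Real.dist_eq]
  choose c hc1 hc using hex
  set C : ℝ → ℝ := fun r => ∑ k ∈ Finset.range (⌊r⌋₊ + 1), c k with hC
  have hCm : Monotone C := fun r s hrs => Finset.sum_le_sum_of_subset_of_nonneg
    (Finset.range_mono (Nat.succ_le_succ (Nat.floor_mono hrs))) fun k _ _ => zero_le_one.trans (hc1 k)
  have hCc : ∀ r, c ⌊r⌋₊ ≤ C r := fun r => Finset.single_le_sum (f := c) (fun k _ => zero_le_one.trans (hc1 k))
    (Finset.mem_range.2 (Nat.lt_succ_self _))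
  have hC1 : ∀ r, 1 ≤ C r := fun r => (hc1 _).trans (hCc r)
  have hint : ∀ a b, IntervalIntegrable C MeasureTheory.volume a b := fun a b => (hCm.monotoneOn _).intervalIntegrable
  set κ : ℝ → ℝ := fun r => ∫ t in (0 : ℝ)..(r + 1), C t with hκ
  have kc : Continuous κ := (intervalIntegral.continuous_primitive hint 0).comp (continuous_id.add continuous_const)
  have kd : ∀ r s, r ≤ s → κ r + (s - r) * C (r + 1) ≤ κ s := by
    intro r s hrs
    have e := intervalIntegral.integral_add_adjacent_intervals (hint 0 (r + 1)) (hint (r + 1) (s + 1))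
    have : ∫ t in (r + 1)..(s + 1), C (r + 1) ≤ ∫ t in (r + 1)..(s + 1), C t :=
      intervalIntegral.integral_mono_on (by linarith) (by simp) (hint _ _) fun t ht => hCm ht.1
    rw [intervalIntegral.integral_const, smul_eq_mul, add_sub_add_right_eq_sub] at this
    simp only [hκ]; linarith
  have k0 : κ (-1) = 0 := by simp [hκ]
  have km : Monotone κ := fun r s hrs => by nlinarith [kd r s hrs, hC1 (r + 1)]
  have kC : ∀ r, 0 ≤ r → C r ≤ κ r := fun r hr => by
    have h1 := kd (r - 1) r (by linarith)
    have h2 := km (show -1 ≤ r - 1 by linarith)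
    rw [sub_add_cancel, sub_sub_cancel, one_mul] at h1
    linarith
  obtain ⟨Ψ, hΨ⟩ := radial_homeo kc km fun r hr => (hC1 r).trans (kC r hr)
  have key : ∀ u u', ‖u‖ ≤ ‖u'‖ → ‖Ψ u - Ψ u'‖ ≤ 3 → |f u - f u'| < 1 / 4 := fun u u' h h3 =>
    hc ⌊‖u‖⌋₊ u u' (Nat.lt_floor_add_one _).le (le_trans (mul_le_mul_of_nonneg_right
      ((hCc _).trans (kC _ (norm_nonneg u))) (norm_nonneg _)) ((hΨ u u' h).trans h3))
  refine ⟨Ψ, fun z w h => ?_⟩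
  rcases le_total ‖Ψ.symm z‖ ‖Ψ.symm w‖ with h' | h'
  · exact key _ _ h' (by simpa [dist_eq_norm] using h)
  · rw [abs_sub_comm]
    exact key _ _ h' (by rw [dist_comm] at h; simpa [dist_eq_norm] using h)

theorem conj_of_f (g : ℂ ≃ₜ ℂ) (f : ℂ → ℝ) (hf : Continuous f) (hfg : ∀ z, f (g z) = f z + 1) :
    ∃ (h : ℂ ≃ₜ ℂ) (δ : ℝ) (hδ : δ * δ = 1), ∀ z, h (tau δ hδ z) = g (h z) := by
  obtain ⟨Ψ, hΨ⟩ := exists_unif hf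
  obtain ⟨h, δ, hδ, H⟩ := conj_of_unif (Ψ.symm.trans (g.trans Ψ)) (fun z => f (Ψ.symm z))
    (hf.comp Ψ.symm.continuous) (fun z => by simp [hfg]) hΨ
  refine ⟨h.trans Ψ.symm, δ, hδ, fun z => ?_⟩
  simp [H]

theorem conj_of_pow_eq_translation
    (g : (ℝ × ℝ) ≃ₜ (ℝ × ℝ)) (p : ℕ) (hp : 1 ≤ p) (v : ℝ × ℝ) (hv : v ≠ 0)
    (hgp : ∀ z : ℝ × ℝ, (g.toEquiv ^ p) z = z + v) :
    ∃ h : (ℝ × ℝ) ≃ₜ (ℝ × ℝ),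
      (∀ z, h (g (h.symm z)) = (z.1 + 1, z.2)) ∨ (∀ z, h (g (h.symm z)) = (z.1 + 1, -z.2)) := by
  set d := v.1 * v.1 + v.2 * v.2 with hd
  have hd0 : d ≠ 0 := fun h => hv (by
    have h1 : v.1 = 0 := by nlinarith [mul_self_nonneg v.1, mul_self_nonneg v.2]
    have h2 : v.2 = 0 := by nlinarith [mul_self_nonneg v.1, mul_self_nonneg v.2]
    exact Prod.ext h1 h2)
  have hp0 : (p : ℝ) ≠ 0 := by positivity
  have hit : ∀ z, g^[p] z = z + v := fun z => by
    rw [← hgp, ← Equiv.Perm.iterate_eq_pow]; rfl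
  set x : ℝ × ℝ → ℝ := fun z => (z.1 * v.1 + z.2 * v.2) / d with hx
  have hxv : ∀ z, x (z + v) = x z + 1 := fun z => by
    simp only [hx, Prod.fst_add, Prod.snd_add]; field_simp; rw [hd]; ring
  set F : ℝ × ℝ → ℝ := fun z => ∑ k ∈ Finset.range p, x (g^[k] z) with hF
  have hFg : ∀ z, F (g z) = F z + 1 := fun z => by
    have h1 := Finset.sum_range_succ (fun k => x (g^[k] z)) p
    rw [Finset.sum_range_succ', hit, hxv] at h1
    simp only [Function.iterate_succ_apply, Function.iterate_zero, id_eq] at h1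
    simp only [hF]; linarith
  have hFc : Continuous F := by
    refine continuous_finsetSum _ fun k _ => ?_
    have : Continuous x := by fun_prop
    exact this.comp (g.continuous.iterate k)
  let E : ℝ × ℝ ≃ₜ ℂ := Complex.equivRealProdCLM.symm.toHomeomorph
  obtain ⟨h, δ, hδ, H⟩ := conj_of_f (E.symm.trans (g.trans E)) (fun z => F (E.symm z))
    (hFc.comp E.symm.continuous) (fun z => by simp [hFg])
  have key : ∀ z, E.symm (h.symm (E (g (E.symm (h (E z)))))) = (z.1 + 1, δ * z.2) := fun z => by
    have := H (E z)
    simp only [Homeomorph.trans_apply] at this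
    rw [← this, Homeomorph.symm_apply_apply]
    rfl
  refine ⟨E.trans (h.symm.trans E.symm), ?_⟩
  rcases mul_self_eq_one_iff.1 hδ with rfl | rfl
  · left; intro z; have := key z; rw [one_mul] at this; exact this
  · right; intro z; have := key z; rw [neg_one_mul] at this; exact this
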